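/- Let α > 0 and γ ∈ (−1,1). There exist δ₀ > 0, σ > 0 and C > 0 such that the following holds. Let h : [0,∞) → ℝ be continuous with sup_{t≥0}|h(t)| < δ₀, let w_* be one of the two domain walls w_*^±, and let m : [0,∞) × ℝ → ℝ³ satisfy: |m(t,x)| = 1 for all (t,x); m is continuously differentiable in t and twice continuously differentiable in x with ∂ₜm, ∂ₓm, ∂ₓₓm jointly continuous; m solves the Landau–Lifshitz–Gilbert equation ∂ₜm = m ∧ H(m) − α·m ∧ (m ∧ H(m)) pointwise, where H(m)(t,x) = ∂ₓₓm(t,x) + 2γ·e₁ ∧ ∂ₓm(t,x) − m₂(t,x)e₂ − m₃(t,x)e₃ + h(t)e₁; for every t ≥ 0 the functions m₂(t,·), m₃(t,·), ∂ₓm(t,·), ∂ₓₓm(t,·) belong to L²(ℝ), the map t ↦ m(t,·) − w_* is continuous from [0,∞) into H¹(ℝ,ℝ³), and t ↦ ∂ₓₓm(t,·) is continuous from [0,∞) into L²(ℝ,ℝ³). If ‖m(0,·) − w_*‖_{ℋ¹} < δ₀, then there exists g_∞ = (y_∞, φ_∞) ∈ ℝ² with |g_∞| ≤ C·‖m(0,·)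 − w_*‖_{ℋ¹} such that for all t ≥ 0, ‖m(t,·) − R_{φ_∞+φ_*(t)} w_*(· − y_∞ − y_*(t))‖_{H¹} ≤ C·e^{−σt}·‖m(0,·) − w_*‖_{ℋ¹}, where y_*(t) = −(α/√(1−γ²))·∫₀ᵗ h(s)ds and φ_*(t) = (−1 + αγ/√(1−γ²))·∫₀ᵗ h(s)ds. -/

import Mathlib

open MeasureTheory Filter ENNReal

noncomputable section

abbrev E3 := EuclideanSpace ℝ (Fin 3)

/-- canonical basis vectors of ℝ³ -/
def e1 : E3 := !₂[1, 0, 0]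
def e2 : E3 := !₂[0, 1, 0]
def e3 : E3 := !₂[0, 0, 1]

/-- cross product in ℝ³ -/
def cross3 (a b : E3) : E3 :=
  !₂[a 1 * b 2 - a 2 * b 1, a 2 * b 0 - a 0 * b 2, a 0 * b 1 - a 1 * b 0]

/-- scalar product in ℝ³ -/
def dot3 (a b : E3) : ℝ := a 0 * b 0 + a 1 * b 1 + a 2 * b 2

/-- θ_*(x) = 2 arctan (exp (−√(1−γ²) x)) -/
def thetaStar (γ x : ℝ) : ℝ := 2 * Real.arctan (Real.exp (-Real.sqrt (1 - γ ^ 2) * x))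

/-- φ_*(x) = −γ x -/
def phiStar (γ x : ℝ) : ℝ := -γ * x

/-- the domain walls w_*^± (s = ±1 is the sign) -/
def wStar (γ s x : ℝ) : E3 :=
  !₂[Real.cos (thetaStar γ x),
    s * (Real.sin (thetaStar γ x) * Real.cos (phiStar γ x)),
    s * (Real.sin (thetaStar γ x) * Real.sin (phiStar γ x))]

/-- rotation about the axis e₁ by angle φ -/
def rot (φ : ℝ) (v : E3) : E3 :=
  !₂[v 0, v 1 * Real.cos φ - v 2 * Real.sin φ, v 1 * Real.sin φ + v 2 * Real.cos φ]

/-- the energy gradient δE(m) = −m″ − 2γ e₁ ∧ m′ + m₂e₂ + m₃e₃ -/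
def deltaE (γ : ℝ) (m : ℝ → E3) (x : ℝ) : E3 :=
  -(deriv (deriv m) x) - (2 * γ) • cross3 e1 (deriv m x) + (m x 1) • e2 + (m x 2) • e3

/-- the L² norm of a function on ℝ -/
def L2norm {E : Type*} [NormedAddCommGroup E] (u : ℝ → E) : ℝ :=
  (eLpNorm u 2 volume).toReal

/-- the H¹ norm ‖u‖_{L²} + ‖u′‖_{L²} -/
def H1norm {E : Type*} [NormedAddCommGroup E] [NormedSpace ℝ E] (u : ℝ → E) : ℝ :=
  L2norm u + L2norm (deriv u)

/-- the ℋ¹ seminorm ‖m₂‖_{L²} + ‖m₃‖_{L²} + ‖m′‖_{L²} -/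
def HH1 (m : ℝ → E3) : ℝ :=
  L2norm (fun x => m x 1) + L2norm (fun x => m x 2) + L2norm (deriv m)

/-- the micromagnetic energy E(m) -/
def energy (γ : ℝ) (m : ℝ → E3) : ℝ :=
  (1 / 2) * ∫ x : ℝ,
    (‖deriv m x‖ ^ 2 + 2 * γ * dot3 (deriv m x) (cross3 e1 (m x)) + (1 - (m x 0) ^ 2))

/-- effective magnetic field H(m) = ∂ₓₓm + 2γ e₁ ∧ ∂ₓm − m₂e₂ − m₃e₃ + h(t)e₁ -/
def Hfield (γ : ℝ) (h : ℝ → ℝ) (m : ℝ → ℝ → E3) (t x : ℝ) : E3 :=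
  deriv (deriv (fun ξ => m t ξ)) x + (2 * γ) • cross3 e1 (deriv (fun ξ => m t ξ) x)
    - (m t x 1) • e2 - (m t x 2) • e3 + h t • e1

section

/-! ### algebra -/

@[simp] lemma e1_0 : e1 0 = 1 := by simp [e1]
@[simp] lemma e1_1 : e1 1 = 0 := by simp [e1]
@[simp] lemma e1_2 : e1 2 = 0 := by simp [e1]
@[simp] lemma e2_0 : e2 0 = 0 := by simp [e2]
@[simp] lemma e2_1 : e2 1 = 1 := by simp [e2]
@[simp] lemma e2_2 : e2 2 = 0 := by simp [e2]
@[simp] lemma e3_0 : e3 0 = 0 := by simp [e3]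
@[simp] lemma e3_1 : e3 1 = 0 := by simp [e3]
@[simp] lemma e3_2 : e3 2 = 1 := by simp [e3]
@[simp] lemma cross3_0 (a b : E3) : cross3 a b 0 = a 1 * b 2 - a 2 * b 1 := by simp [cross3]
@[simp] lemma cross3_1 (a b : E3) : cross3 a b 1 = a 2 * b 0 - a 0 * b 2 := by simp [cross3]
@[simp] lemma cross3_2 (a b : E3) : cross3 a b 2 = a 0 * b 1 - a 1 * b 0 := by simp [cross3]
@[simp] lemma rot_0 (φ : ℝ) (v : E3) : rot φ v 0 = v 0 := by simp [rot]
@[simp] lemma rot_1 (φ : ℝ) (v : E3) :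
    rot φ v 1 = v 1 * Real.cos φ - v 2 * Real.sin φ := by simp [rot]
@[simp] lemma rot_2 (φ : ℝ) (v : E3) :
    rot φ v 2 = v 1 * Real.sin φ + v 2 * Real.cos φ := by simp [rot]

lemma ext3 {a b : E3} (h0 : a 0 = b 0) (h1 : a 1 = b 1) (h2 : a 2 = b 2) : a = b := by
  ext i; fin_cases i <;> assumption

lemma nsq (v : E3) : ‖v‖ ^ 2 = v 0 ^ 2 + v 1 ^ 2 + v 2 ^ 2 := by
  rw [EuclideanSpace.norm_sq_eq]; simp [Fin.sum_univ_three]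

lemma inner3 (a b : E3) : inner ℝ a b = a 0 * b 0 + a 1 * b 1 + a 2 * b 2 := by
  simp [PiLp.inner_apply, Fin.sum_univ_three]; ring

lemma abs_comp_le (v : E3) (i : Fin 3) : |v i| ≤ ‖v‖ := by
  simpa using PiLp.norm_apply_le v i

/-- gradient of the height function -/
def cF (a : E3) : E3 := e1 - a 0 • a

/-- Bogomolny defect -/
def cD (γ κ : ℝ) (a b : E3) : E3 := b + γ • cross3 e1 a - κ • cF a

/-- space derivative of the defect -/
def cDx (γ κ : ℝ) (a b c : E3) : E3 := c + γ • cross3 e1 b + κ • (b 0 • a + a 0 • b)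

/-- tension -/
def cT (γ κ : ℝ) (a b c : E3) : E3 :=
  cDx γ κ a b c + γ • cross3 e1 (cD γ κ a b) - (κ * a 0) • cD γ κ a b

def cX (γ : ℝ) (a b c : E3) : E3 :=
  c + (2 * γ) • cross3 e1 b - (a 1) • e2 - (a 2) • e3

/-- right-hand side of LLG -/
def cM (α γ h : ℝ) (a b c : E3) : E3 :=
  cross3 a (cX γ a b c + h • e1) - α • cross3 a (cross3 a (cX γ a b c + h • e1))

/-- right-hand side modulo symmetries -/
def cG (α γ κ h : ℝ) (a b c : E3) : E3 :=
  cross3 a (cT γ κ a b c) - α • cross3 a (cross3 a (cT γ κ a b c)) - (α * h / κ) • cD γ κ a b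

/-- the covariant derivative of D -/
def cN (γ κ : ℝ) (a b c : E3) : E3 :=
  (cDx γ κ a b c + γ • cross3 e1 (cD γ κ a b)) -
    (inner ℝ a (cDx γ κ a b c + γ • cross3 e1 (cD γ κ a b))) • a

lemma cT_eq {γ κ : ℝ} (hk : γ ^ 2 + κ ^ 2 = 1) (a b c : E3) (ha : ‖a‖ = 1) :
    cT γ κ a b c = cX γ a b c + (κ ^ 2 * (1 - a 0 ^ 2) + κ * b 0) • a := by
  have hk' : γ ^ 2 = 1 - κ ^ 2 := by linarith
  apply ext3 <;> simp [cT, cX, cDx, cD, cF] <;> ring_nf <;> simp only [hk'] <;> ring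

lemma cross_cT {γ κ : ℝ} (hk : γ ^ 2 + κ ^ 2 = 1) (a b c : E3) (ha : ‖a‖ = 1) :
    cross3 a (cT γ κ a b c) = cross3 a (cX γ a b c) := by
  rw [cT_eq hk a b c ha]
  apply ext3 <;> simp <;> ring

lemma inner_cD {γ κ : ℝ} (a b : E3) (ha : ‖a‖ = 1) (hab : inner ℝ a b = 0) :
    inner ℝ a (cD γ κ a b) = 0 := by
  have h1 := nsq a
  rw [ha] at h1
  rw [inner3] at *
  simp [cD, cF]
  linear_combination hab - κ * a 0 * h1

lemma cM_eq {α γ κ h : ℝ} (hκ : κ ≠ 0) (hk : γ ^ 2 + κ ^ 2 = 1) (a b c : E3) (ha : ‖a‖ = 1) :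
    cM α γ h a b c = cG α γ κ h a b c + (α * h / κ) • b
      + ((-1 + α * γ / κ) * h) • cross3 e1 a := by
  have h1 := nsq a
  rw [ha] at h1
  have e : cX γ a b c + h • e1 = cT γ κ a b c + (h • e1 -
     (κ ^ 2 * (1 - a 0 ^ 2) + κ * b 0) • a) := by
    rw [cT_eq hk a b c ha]; abel
  rw [cM, cG, e]
  generalize cT γ κ a b c = T
  have h2 : a 1 ^ 2 = 1 - a 0 ^ 2 - a 2 ^ 2 := by linarith
  apply ext3 <;> simp [cD, cF] <;> field_simp <;> ring_nf <;> simp only [h2] <;> ring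

/-- the pointwise power identity -/
lemma inner_cM_cT {α γ κ h : ℝ} (hk : γ ^ 2 + κ ^ 2 = 1) (a b c : E3) (ha : ‖a‖ = 1) :
    inner ℝ (cM α γ h a b c) (cT γ κ a b c) =
      α * ‖cross3 a (cT γ κ a b c)‖ ^ 2 + h * inner ℝ (cross3 a e1) (cT γ κ a b c)
        + α * h * inner ℝ (cF a) (cT γ κ a b c) := by
  have h1 := nsq a
  rw [ha] at h1
  have e : cX γ a b c + h • e1 = cT γ κ a b c + (h • e1 -
     (κ ^ 2 * (1 - a 0 ^ 2) + κ * b 0) • a) := by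
    rw [cT_eq hk a b c ha]; abel
  rw [cM, e]
  generalize cT γ κ a b c = T
  rw [nsq, inner3, inner3, inner3]
  simp [cF]
  linear_combination (-α * h * T 0) * h1

/-- total derivative identities -/
lemma tot1 {γ κ : ℝ} (hk : γ ^ 2 + κ ^ 2 = 1) (a b c : E3) (ha : ‖a‖ = 1) :
    inner ℝ (cross3 a e1) (cT γ κ a b c) =
      inner ℝ (cross3 a e1) (cDx γ κ a b c) + inner ℝ (cross3 b e1) (cD γ κ a b) := by
  simp only [inner3]
  simp [cT, cDx, cD, cF]
  ring

lemma inner_D_N {γ κ : ℝ} (a b c : E3) (ha : ‖a‖ = 1) (hab : inner ℝ a b = 0) :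
    inner ℝ (cD γ κ a b) (cDx γ κ a b c) = inner ℝ (cD γ κ a b) (cN γ κ a b c) := by
  have h3 := inner_cD (γ := γ) (κ := κ) a b ha hab
  rw [cN, inner_sub_right, inner_smul_right, real_inner_comm a, h3, inner_add_right]
  have : inner ℝ (cD γ κ a b) (γ • cross3 e1 (cD γ κ a b)) = 0 := by
    rw [inner3]; simp; ring
  rw [this]; ring

lemma tot2 {γ κ : ℝ} (a b c : E3) (ha : ‖a‖ = 1)
    (hab : inner ℝ a b = 0) :
    inner ℝ (cF a) (cT γ κ a b c) - a 0 * ‖cD γ κ a b‖ ^ 2 =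
      inner ℝ (cF a) (cDx γ κ a b c) + inner ℝ (-(b 0 • a + a 0 • b)) (cD γ κ a b) := by
  have h3 := inner_cD (γ := γ) (κ := κ) a b ha hab
  have h4 : inner ℝ b (cD γ κ a b) =
      inner ℝ (cD γ κ a b - γ • cross3 e1 a + κ • cF a) (cD γ κ a b) := by
    congr 1; simp only [cD]; abel
  simp only [cT]
  generalize cDx γ κ a b c = Y at *
  generalize cD γ κ a b = D at *
  simp only [inner3, nsq] at *
  simp [cF] at *
  linear_combination a 0 * h4 + b 0 * h3

lemma cross_sq (a z : E3) (ha : ‖a‖ = 1) :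
    ‖cross3 a z‖ ^ 2 = ‖z‖ ^ 2 - (inner ℝ a z) ^ 2 := by
  have h1 := nsq a
  rw [ha] at h1
  rw [nsq, nsq, inner3]; simp
  linear_combination (-(z 0 ^ 2 + z 1 ^ 2 + z 2 ^ 2)) * h1

lemma tot3 {γ κ : ℝ} (a b c : E3) (ha : ‖a‖ = 1)
    (hab : inner ℝ a b = 0) :
    ‖cross3 a (cT γ κ a b c)‖ ^ 2 = ‖cN γ κ a b c‖ ^ 2 + κ ^ 2 * ‖cD γ κ a b‖ ^ 2
      + κ * cD γ κ a b 0 * ‖cD γ κ a b‖ ^ 2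
      - κ * (b 0 * ‖cD γ κ a b‖ ^ 2 + a 0 * (2 * inner ℝ (cD γ κ a b) (cDx γ κ a b c))) := by
  have h3 := inner_cD (γ := γ) (κ := κ) a b ha hab
  have h4 : cD γ κ a b 0 = b 0 - κ * (1 - a 0 ^ 2) := by
    simp only [cD, cF, PiLp.add_apply, PiLp.sub_apply, PiLp.smul_apply, smul_eq_mul, e1_0, cross3_0, e1_1, e1_2]; ring
  rw [inner_D_N a b c ha hab, cross_sq _ _ ha, cT, cN, h4]
  generalize cDx γ κ a b c + γ • cross3 e1 (cD γ κ a b) = Z at *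
  generalize cD γ κ a b = D at *
  simp only [norm_sub_sq_real, inner_sub_right, inner_smul_right, inner_smul_left, norm_smul,
    mul_pow, ha, real_inner_comm Z D, real_inner_comm a D, real_inner_comm a Z, h3]
  simp
  have : (|κ| * |a 0|) ^ 2 = κ ^ 2 * a 0 ^ 2 := by rw [mul_pow, sq_abs, sq_abs]
  rw [this]
  ring

/-- pointwise comparison of the reduced velocity with the dissipation -/
lemma cG_sq (α γ κ h : ℝ) (a b c : E3) (ha : ‖a‖ = 1) :
    ‖cG α γ κ h a b c‖ ^ 2 ≤ 2 * (1 + α ^ 2) * ‖cross3 a (cT γ κ a b c)‖ ^ 2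
      + 2 * (α * h / κ) ^ 2 * ‖cD γ κ a b‖ ^ 2 := by
  rw [cG]
  generalize cT γ κ a b c = T
  generalize cD γ κ a b = D
  have h1 : ‖cross3 a (cross3 a T)‖ ^ 2 = ‖cross3 a T‖ ^ 2 := by
    rw [cross_sq _ _ ha]
    have : inner ℝ a (cross3 a T) = 0 := by rw [inner3]; simp; ring
    rw [this]; ring
  have h2 : ‖cross3 a T - α • cross3 a (cross3 a T)‖ ^ 2 = (1 + α ^ 2) * ‖cross3 a T‖ ^ 2 := by
    rw [norm_sub_sq_real, norm_smul, mul_pow, h1, inner_smul_right]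
    have : inner ℝ (cross3 a T) (cross3 a (cross3 a T)) = 0 := by rw [inner3]; simp; ring
    rw [this]; simp; ring
  have h3 : ‖(α * h / κ) • D‖ ^ 2 = (α * h / κ) ^ 2 * ‖D‖ ^ 2 := by
    rw [norm_smul, mul_pow, Real.norm_eq_abs, sq_abs]
  have h4 := parallelogram_law_with_norm ℝ (cross3 a T - α • cross3 a (cross3 a T))
    ((α * h / κ) • D)
  nlinarith [sq_nonneg ‖cross3 a T - α • cross3 a (cross3 a T) + (α * h / κ) • D‖]

end

section

/-! ### pointwise estimates -/

lemma norm_cross_le (a b : E3) : ‖cross3 a b‖ ≤ ‖a‖ * ‖b‖ := by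
  apply abs_le_of_sq_le_sq' _ (by positivity) |>.2
  have : ‖cross3 a b‖ ^ 2 = ‖a‖ ^ 2 * ‖b‖ ^ 2 - (inner ℝ a b) ^ 2 := by
    rw [nsq, nsq, nsq, inner3]; simp; ring
  rw [this, mul_pow]; nlinarith [sq_nonneg (inner ℝ a b)]

lemma cross3_sub_left (a b c : E3) : cross3 (a - b) c = cross3 a c - cross3 b c := by
  apply ext3 <;> simp <;> ring
lemma cross3_sub_right (a b c : E3) : cross3 c (a - b) = cross3 c a - cross3 c b := by
  apply ext3 <;> simp <;> ring
lemma cross3_add_right (a b c : E3) : cross3 c (a + b) = cross3 c a + cross3 c b := by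
  apply ext3 <;> simp <;> ring
lemma cross3_smul_right (r : ℝ) (a c : E3) : cross3 c (r • a) = r • cross3 c a := by
  apply ext3 <;> simp <;> ring

lemma norm_e1 : ‖e1‖ = 1 := by
  have := nsq e1
  simp at this
  rcases this with h | h
  · exact h
  · linarith [norm_nonneg e1]

/-- size of the transverse part -/
def pp (a : E3) : ℝ := |a 1| + |a 2|

lemma pp_nonneg (a : E3) : 0 ≤ pp a := by unfold pp; positivity

lemma sq_le_of_pp {x : ℝ} (hx : 0 ≤ x) {a : E3} (h : x ^ 2 ≤ a 1 ^ 2 + a 2 ^ 2) : x ≤ pp a := by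
  apply abs_le_of_sq_le_sq' _ (pp_nonneg a) |>.2
  unfold pp
  nlinarith [abs_nonneg (a 1), abs_nonneg (a 2), sq_abs (a 1), sq_abs (a 2),
    mul_nonneg (abs_nonneg (a 1)) (abs_nonneg (a 2))]

lemma norm_cF_le (a : E3) (ha : ‖a‖ = 1) : ‖cF a‖ ≤ pp a := by
  apply sq_le_of_pp (norm_nonneg _)
  have h1 := nsq a
  rw [ha] at h1
  rw [nsq]; simp [cF]
  have h2 : a 1 ^ 2 = 1 - a 0 ^ 2 - a 2 ^ 2 := by linarith
  apply le_of_eq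
  ring_nf; simp only [h2]; ring

lemma norm_cross_e1_le (a : E3) : ‖cross3 e1 a‖ ≤ pp a := by
  apply sq_le_of_pp (norm_nonneg _)
  rw [nsq]; simp; linarith

lemma norm_cross_e1_le' (a : E3) : ‖cross3 a e1‖ ≤ pp a := by
  apply sq_le_of_pp (norm_nonneg _)
  rw [nsq]; simp; linarith

lemma norm_cross_e1 (a : E3) : ‖cross3 e1 a‖ ≤ ‖a‖ := by
  simpa [norm_e1] using norm_cross_le e1 a

lemma norm_smul_sub_le (a a' b b' : E3) (ha' : ‖a'‖ ≤ 1) :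
    ‖b 0 • a' - b' 0 • a'‖ ≤ ‖b - b'‖ := by
  rw [← sub_smul, norm_smul]
  have := abs_comp_le (b - b') 0
  simp at this
  calc _ ≤ ‖b - b'‖ * 1 := by
        apply mul_le_mul (by simpa using this) ha' (norm_nonneg _) (norm_nonneg _)
    _ = _ := mul_one _

lemma cF_lip (a a' : E3) (ha : ‖a‖ = 1) (ha' : ‖a'‖ = 1) :
    ‖cF a - cF a'‖ ≤ 2 * ‖a - a'‖ := by
  have e : cF a - cF a' = -((a 0 • a' - a' 0 • a') + a 0 • (a - a')) := by
    simp only [cF, smul_sub]; abel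
  rw [e, norm_neg]
  have h1 := norm_smul_sub_le a a' a a' ha'.le
  have h2 : ‖a 0 • (a - a')‖ ≤ ‖a - a'‖ := by
    rw [norm_smul]
    have := abs_comp_le a 0
    rw [ha] at this
    calc _ ≤ 1 * ‖a - a'‖ := by gcongr; simpa using this
      _ = _ := one_mul _
  linarith [norm_add_le (a 0 • a' - a' 0 • a') (a 0 • (a - a'))]

/-- `|r| ≤ 1` scaling -/
lemma norm_smul_le1 {r : ℝ} (hr : |r| ≤ 1) (v : E3) : ‖r • v‖ ≤ ‖v‖ := by
  rw [norm_smul]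
  calc _ ≤ 1 * ‖v‖ := by gcongr; simpa using hr
    _ = _ := one_mul _

lemma comp_le1 {a : E3} (ha : ‖a‖ = 1) (i : Fin 3) : |a i| ≤ 1 := ha ▸ abs_comp_le a i


lemma cD_lip {γ κ : ℝ} (hγ : |γ| ≤ 1) (hκ : |κ| ≤ 1) (a a' b b' : E3) (ha : ‖a‖ = 1) (ha' : ‖a'‖ = 1) :
    ‖cD γ κ a b - cD γ κ a' b'‖ ≤ ‖b - b'‖ + 3 * ‖a - a'‖ := by
  have e : cD γ κ a b - cD γ κ a' b' = (b - b') + γ • cross3 e1 (a - a') - κ • (cF a - cF a') := by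
    simp only [cD, cross3_sub_right, smul_sub]; abel
  rw [e]
  have h1 := norm_smul_le1 hγ (cross3 e1 (a - a'))
  have h2 := norm_cross_e1 (a - a')
  have h3 := norm_smul_le1 hκ (cF a - cF a')
  have h4 := cF_lip a a' ha ha'
  linarith [norm_sub_le ((b - b') + γ • cross3 e1 (a - a')) (κ • (cF a - cF a')),
    norm_add_le (b - b') (γ • cross3 e1 (a - a'))]

lemma cD_le {γ κ : ℝ} (hγ : |γ| ≤ 1) (hκ : |κ| ≤ 1) (a b : E3) (ha : ‖a‖ = 1) : ‖cD γ κ a b‖ ≤ ‖b‖ + 2 * pp a := by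
  rw [cD]
  have h1 := norm_smul_le1 hγ (cross3 e1 a)
  have h2 := norm_cross_e1_le a
  have h3 := norm_smul_le1 hκ (cF a)
  have h4 := norm_cF_le a ha
  linarith [norm_sub_le (b + γ • cross3 e1 a) (κ • cF a), norm_add_le b (γ • cross3 e1 a)]

lemma cDx_lip {γ κ : ℝ} (hγ : |γ| ≤ 1) (hκ : |κ| ≤ 1) (a a' b b' c c' : E3) (ha : ‖a‖ = 1) (ha' : ‖a'‖ = 1) :
    ‖cDx γ κ a b c - cDx γ κ a' b' c'‖ ≤
      ‖c - c'‖ + 3 * ‖b - b'‖ + 2 * (‖a - a'‖ * ‖b'‖) := by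
  have e : cDx γ κ a b c - cDx γ κ a' b' c' = (c - c') + γ • cross3 e1 (b - b')
     + κ • (((b 0 • a - b' 0 • a) + b' 0 • (a - a')) +
       (a 0 • (b - b') + (a 0 • b' - a' 0 • b'))) := by
    simp only [cDx, cross3_sub_right, smul_sub, smul_add]; abel
  rw [e]
  have h1 := norm_smul_le1 hγ (cross3 e1 (b - b'))
  have h2 := norm_cross_e1 (b - b')
  have h3 := norm_smul_le1 hκ (((b 0 • a - b' 0 • a) + b' 0 • (a - a')) +
       (a 0 • (b - b') + (a 0 • b' - a' 0 • b')))
  have h4 := norm_smul_sub_le a a b b' ha.le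
  have h5 : ‖b' 0 • (a - a')‖ ≤ ‖a - a'‖ * ‖b'‖ := by
    rw [norm_smul, mul_comm]; gcongr; exact abs_comp_le b' 0
  have h6 := norm_smul_le1 (comp_le1 ha 0) (b - b')
  have h7 : ‖a 0 • b' - a' 0 • b'‖ ≤ ‖a - a'‖ * ‖b'‖ := by
    rw [← sub_smul, norm_smul]; gcongr; simpa using abs_comp_le (a - a') 0
  linarith [norm_add_le ((c - c') + γ • cross3 e1 (b - b'))
    (κ • (((b 0 • a - b' 0 • a) + b' 0 • (a - a')) + (a 0 • (b - b') + (a 0 • b' - a' 0 • b')))),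
    norm_add_le (c - c') (γ • cross3 e1 (b - b')),
    norm_add_le ((b 0 • a - b' 0 • a) + b' 0 • (a - a')) (a 0 • (b - b') + (a 0 • b' - a' 0 • b')),
    norm_add_le (b 0 • a - b' 0 • a) (b' 0 • (a - a')),
    norm_add_le (a 0 • (b - b')) (a 0 • b' - a' 0 • b')]

lemma cDx_le {γ κ : ℝ} (hγ : |γ| ≤ 1) (hκ : |κ| ≤ 1) (a b c : E3) (ha : ‖a‖ = 1) : ‖cDx γ κ a b c‖ ≤ ‖c‖ + 3 * ‖b‖ := by
  have := cDx_lip hγ hκ a a b 0 c 0 ha ha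
  simpa [cDx, show cross3 e1 0 = 0 by apply ext3 <;> simp] using this

lemma cX_lip {γ : ℝ} (hγ : |γ| ≤ 1) (a a' b b' c c' : E3) :
    ‖cX γ a b c - cX γ a' b' c'‖ ≤ ‖c - c'‖ + 2 * ‖b - b'‖ + ‖a - a'‖ := by
  have e : cX γ a b c - cX γ a' b' c' = (c - c') + (2 : ℝ) • γ • cross3 e1 (b - b')
     + cross3 e1 (cross3 e1 (a - a')) := by
    simp only [cX, cross3_sub_right, smul_sub]
    apply ext3 <;> simp <;> ring
  rw [e]
  have h1 := norm_smul_le1 hγ (cross3 e1 (b - b'))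
  have h2 := norm_cross_e1 (b - b')
  have h4 := norm_cross_e1 (cross3 e1 (a - a'))
  have h5 := norm_cross_e1 (a - a')
  have h3 : ‖(2 : ℝ) • γ • cross3 e1 (b - b')‖ = 2 * ‖γ • cross3 e1 (b - b')‖ := by
    rw [norm_smul]; norm_num
  linarith [norm_add_le ((c - c') + (2 : ℝ) • γ • cross3 e1 (b - b'))
     (cross3 e1 (cross3 e1 (a - a'))), norm_add_le (c - c') ((2 : ℝ) • γ • cross3 e1 (b - b'))]

lemma cX_le {γ : ℝ} (hγ : |γ| ≤ 1) (a b c : E3) :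
    ‖cX γ a b c‖ ≤ ‖c‖ + 2 * ‖b‖ + pp a := by
  have h := cX_lip hγ a a b 0 c 0
  have e : ‖cX γ a 0 0‖ ≤ pp a := by
    apply sq_le_of_pp (norm_nonneg _)
    rw [nsq]; simp [cX]
  have := norm_add_le (cX γ a b c - cX γ a 0 0) (cX γ a 0 0)
  simp at this h
  linarith

lemma cT_le {γ κ : ℝ} (hγ : |γ| ≤ 1) (hκ : |κ| ≤ 1) (a b c : E3) (ha : ‖a‖ = 1) : ‖cT γ κ a b c‖ ≤ ‖c‖ + 5 * ‖b‖ + 4 * pp a := by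
  rw [cT]
  have h1 := norm_smul_le1 hγ (cross3 e1 (cD γ κ a b))
  have h2 := norm_cross_e1 (cD γ κ a b)
  have h0 : |κ * a 0| ≤ 1 := by
    rw [abs_mul]; exact mul_le_one₀ hκ (abs_nonneg _) (comp_le1 ha 0)
  have h3 := norm_smul_le1 h0 (cD γ κ a b)
  have h4 := cDx_le hγ hκ a b c ha
  have h5 := cD_le hγ hκ a b ha
  linarith [norm_sub_le (cDx γ κ a b c + γ • cross3 e1 (cD γ κ a b)) ((κ * a 0) • cD γ κ a b),
    norm_add_le (cDx γ κ a b c) (γ • cross3 e1 (cD γ κ a b))]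

lemma cross_lip (a a' z z' : E3) (ha : ‖a‖ = 1) :
    ‖cross3 a z - cross3 a' z'‖ ≤ ‖z - z'‖ + ‖a - a'‖ * ‖z'‖ := by
  have e : cross3 a z - cross3 a' z' = cross3 a (z - z') + cross3 (a - a') z' := by
    rw [cross3_sub_left, cross3_sub_right]; abel
  rw [e]
  have h1 := norm_cross_le a (z - z')
  rw [ha] at h1
  linarith [norm_add_le (cross3 a (z - z')) (cross3 (a - a') z'), norm_cross_le (a - a') z']

lemma cM_expand (α γ h : ℝ) (a b c : E3) (ha : ‖a‖ = 1) :
    cM α γ h a b c = cross3 a (cX γ a b c) - α • cross3 a (cross3 a (cX γ a b c))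
      + h • (cross3 a e1 + α • cF a) := by
  have h1 := nsq a
  rw [ha] at h1
  rw [cM]
  generalize cX γ a b c = X
  have h2 : a 1 ^ 2 = 1 - a 0 ^ 2 - a 2 ^ 2 := by linarith
  apply ext3 <;> simp [cF] <;> ring_nf <;> simp only [h2] <;> ring

lemma cM_lip {α γ : ℝ} (hα : 0 < α) (hγ : |γ| ≤ 1) (h h' : ℝ) (a a' b b' c c' : E3)
    (ha : ‖a‖ = 1) (ha' : ‖a'‖ = 1) :
    ‖cM α γ h a b c - cM α γ h' a' b' c'‖ ≤
      (1 + 2 * α) * (‖c - c'‖ + 2 * ‖b - b'‖ + (1 + |h|) * ‖a - a'‖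
        + ‖a - a'‖ * (‖c'‖ + 2 * ‖b'‖ + pp a') + |h - h'| * pp a') := by
  rw [cM_expand _ _ _ _ _ _ ha, cM_expand _ _ _ _ _ _ ha']
  have hX := cX_lip hγ a a' b b' c c'
  have hX' := cX_le hγ a' b' c'
  generalize cX γ a b c = X at *
  generalize cX γ a' b' c' = X' at *
  have e : cross3 a X - α • cross3 a (cross3 a X) + h • (cross3 a e1 + α • cF a) -
      (cross3 a' X' - α • cross3 a' (cross3 a' X') + h' • (cross3 a' e1 + α • cF a')) =
      (cross3 a X - cross3 a' X') + (-α) • (cross3 a (cross3 a X) - cross3 a' (cross3 a' X'))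
      + h • ((cross3 a e1 - cross3 a' e1) + α • (cF a - cF a'))
      + (h - h') • (cross3 a' e1 + α • cF a') := by
    simp only [smul_sub, smul_add, sub_smul, neg_smul]; abel
  rw [e]
  have h1 := cross_lip a a' X X' ha
  have h2 := cross_lip a a' (cross3 a X) (cross3 a' X') ha
  have h3 := norm_cross_le a' X'
  rw [ha', one_mul] at h3
  have h4 : ‖a - a'‖ * ‖cross3 a' X'‖ ≤ ‖a - a'‖ * ‖X'‖ := by gcongr
  have h4' : ‖a - a'‖ * ‖X'‖ ≤ ‖a - a'‖ * (‖c'‖ + 2 * ‖b'‖ + pp a') := by gcongr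
  have h5 : ‖(-α) • (cross3 a (cross3 a X) - cross3 a' (cross3 a' X'))‖ =
      α * ‖cross3 a (cross3 a X) - cross3 a' (cross3 a' X')‖ := by
    rw [norm_smul]; simp [abs_of_pos hα]
  have h6 : ‖h • ((cross3 a e1 - cross3 a' e1) + α • (cF a - cF a'))‖ ≤
      |h| * (‖a - a'‖ + α * (2 * ‖a - a'‖)) := by
    rw [norm_smul]
    gcongr
    · simp
    · refine (norm_add_le _ _).trans ?_
      gcongr
      · rw [← cross3_sub_left]
        simpa [norm_e1] using norm_cross_le (a - a') e1
      · rw [norm_smul, Real.norm_eq_abs, abs_of_pos hα]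
        gcongr
        exact cF_lip a a' ha ha'
  have h7 : ‖(h - h') • (cross3 a' e1 + α • cF a')‖ ≤ |h - h'| * (pp a' + α * pp a') := by
    rw [norm_smul]
    gcongr
    · simp
    · refine (norm_add_le _ _).trans ?_
      gcongr
      · exact norm_cross_e1_le' a'
      · rw [norm_smul, Real.norm_eq_abs, abs_of_pos hα]
        gcongr
        exact norm_cF_le a' ha'
  have h8 := norm_add_le ((cross3 a X - cross3 a' X') + (-α) • (cross3 a (cross3 a X) - cross3 a' (cross3 a' X'))
      + h • ((cross3 a e1 - cross3 a' e1) + α • (cF a - cF a'))) ((h - h') • (cross3 a' e1 + α • cF a'))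
  have h9 := norm_add_le ((cross3 a X - cross3 a' X') + (-α) • (cross3 a (cross3 a X) - cross3 a' (cross3 a' X')))
      (h • ((cross3 a e1 - cross3 a' e1) + α • (cF a - cF a')))
  have h10 := norm_add_le (cross3 a X - cross3 a' X') ((-α) • (cross3 a (cross3 a X) - cross3 a' (cross3 a' X')))
  have h11 : α * ‖cross3 a (cross3 a X) - cross3 a' (cross3 a' X')‖ ≤
    α * ((‖c - c'‖ + 2 * ‖b - b'‖ + ‖a - a'‖) + 2 * (‖a - a'‖ * (‖c'‖ + 2 * ‖b'‖ + pp a'))) := by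
    gcongr; linarith
  have p1 : 0 ≤ α * (‖c - c'‖ + 2 * ‖b - b'‖ + ‖a - a'‖) := by positivity
  have p3 : 0 ≤ α * (|h - h'| * pp a') := by have := pp_nonneg a'; positivity
  have p4 : 0 ≤ |h| * ‖a - a'‖ := by positivity
  nlinarith

lemma cM_le {α γ : ℝ} (hα : 0 < α) (hγ : |γ| ≤ 1) (h : ℝ) (a b c : E3)
    (ha : ‖a‖ = 1) :
    ‖cM α γ h a b c‖ ≤ (1 + α) * (‖c‖ + 2 * ‖b‖ + (1 + |h|) * pp a) := by
  rw [cM_expand _ _ _ _ _ _ ha]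
  have hX' := cX_le hγ a b c
  generalize cX γ a b c = X at *
  have h1 := norm_cross_le a X
  have h2 := norm_cross_le a (cross3 a X)
  rw [ha, one_mul] at h1 h2
  have h5 : ‖α • cross3 a (cross3 a X)‖ ≤ α * ‖X‖ := by
    rw [norm_smul, Real.norm_eq_abs, abs_of_pos hα]; gcongr; linarith
  have h7 : ‖h • (cross3 a e1 + α • cF a)‖ ≤ |h| * (pp a + α * pp a) := by
    rw [norm_smul]
    gcongr
    · simp
    · refine (norm_add_le _ _).trans ?_
      gcongr
      · exact norm_cross_e1_le' a
      · rw [norm_smul, Real.norm_eq_abs, abs_of_pos hα]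
        gcongr
        exact norm_cF_le a ha
  have h8 := norm_add_le (cross3 a X - α • cross3 a (cross3 a X)) (h • (cross3 a e1 + α • cF a))
  have h9 := norm_sub_le (cross3 a X) (α • cross3 a (cross3 a X))
  have h10 : α * ‖X‖ ≤ α * (‖c‖ + 2 * ‖b‖ + pp a) := by gcongr
  nlinarith

/-- Lipschitz-type bound for the transverse size -/
lemma pp_lip (a a' : E3) : pp a ≤ pp a' + 2 * ‖a - a'‖ := by
  have h1 := abs_comp_le (a - a') 1
  have h2 := abs_comp_le (a - a') 2
  simp only [PiLp.sub_apply] at h1 h2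
  unfold pp
  have := abs_sub_abs_le_abs_sub (a 1) (a' 1)
  have := abs_sub_abs_le_abs_sub (a 2) (a' 2)
  linarith

end

section

/-! ### L² tools -/

/-- squared L² norm -/
def S2 {E : Type*} [NormedAddCommGroup E] (u : ℝ → E) : ℝ := ∫ x, ‖u x‖ ^ 2

lemma S2_nonneg {E : Type*} [NormedAddCommGroup E] (u : ℝ → E) : 0 ≤ S2 u :=
  integral_nonneg fun x => by positivity

lemma sq_int {E : Type*} [NormedAddCommGroup E] {u : ℝ → E} (hu : MemLp u 2 volume) :
    Integrable (fun x => ‖u x‖ ^ 2) :=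
  (memLp_two_iff_integrable_sq_norm hu.1).1 hu

lemma L2norm_eq {E : Type*} [NormedAddCommGroup E] {u : ℝ → E} (hu : MemLp u 2 volume) :
    L2norm u = √(S2 u) := by
  rw [L2norm, hu.eLpNorm_eq_integral_rpow_norm (by norm_num) (by norm_num),
    ENNReal.toReal_ofReal (by positivity), Real.sqrt_eq_rpow, S2]
  norm_num

lemma L2norm_sq {E : Type*} [NormedAddCommGroup E] {u : ℝ → E} (hu : MemLp u 2 volume) :
    S2 u = L2norm u ^ 2 := by
  rw [L2norm_eq hu, Real.sq_sqrt (S2_nonneg u)]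

lemma L2norm_nonneg {E : Type*} [NormedAddCommGroup E] (u : ℝ → E) : 0 ≤ L2norm u :=
  ENNReal.toReal_nonneg

lemma inner_int {u v : ℝ → E3} (hu : MemLp u 2 volume) (hv : MemLp v 2 volume) :
    Integrable (fun x => inner ℝ (u x) (v x)) := by
  refine ((L2.integrable_inner (𝕜 := ℝ) hu.toLp hv.toLp)).congr ?_
  filter_upwards [hu.coeFn_toLp, hv.coeFn_toLp] with x h1 h2
  rw [h1, h2]

lemma inner_cs {u v : ℝ → E3} (hu : MemLp u 2 volume) (hv : MemLp v 2 volume) :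
    |∫ x, inner ℝ (u x) (v x)| ≤ √(S2 u) * √(S2 v) := by
  have h := abs_real_inner_le_norm (MemLp.toLp u hu) (MemLp.toLp v hv)
  rw [L2.inner_def, Lp.norm_toLp, Lp.norm_toLp] at h
  have e : ∫ x, inner ℝ ((MemLp.toLp u hu : ℝ → E3) x) ((MemLp.toLp v hv : ℝ → E3) x) = ∫ x, inner ℝ (u x) (v x) := by
    apply integral_congr_ae
    filter_upwards [hu.coeFn_toLp, hv.coeFn_toLp] with x h1 h2
    rw [h1, h2]
  rw [e] at h
  rw [← L2norm_eq hu, ← L2norm_eq hv]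
  exact h

lemma tendsto_inner_int {ι : Type*} {l : Filter ι} {u v : ι → ℝ → E3} {u0 v0 : ℝ → E3}
    (hu : ∀ᶠ i in l, MemLp (u i) 2 volume) (hv : ∀ᶠ i in l, MemLp (v i) 2 volume)
    (hu0 : MemLp u0 2 volume) (hv0 : MemLp v0 2 volume)
    (h1 : Tendsto (fun i => S2 (fun x => u i x - u0 x)) l (nhds 0))
    (h2 : Tendsto (fun i => S2 (fun x => v i x - v0 x)) l (nhds 0)) :
    Tendsto (fun i => ∫ x, inner ℝ (u i x) (v i x)) l (nhds (∫ x, inner ℝ (u0 x) (v0 x))) := by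
  have s1 : Tendsto (fun i => √(S2 (fun x => u i x - u0 x))) l (nhds 0) := by
    have := (Real.continuous_sqrt.tendsto 0).comp h1
    rw [Real.sqrt_zero] at this; exact this
  have s2 : Tendsto (fun i => √(S2 (fun x => v i x - v0 x))) l (nhds 0) := by
    have := (Real.continuous_sqrt.tendsto 0).comp h2
    rw [Real.sqrt_zero] at this; exact this
  rw [← tendsto_sub_nhds_zero_iff]
  have hb : Tendsto (fun i => √(S2 (fun x => u i x - u0 x)) * √(S2 (fun x => v i x - v0 x))
      + √(S2 (fun x => u i x - u0 x)) * √(S2 v0) + √(S2 u0) * √(S2 (fun x => v i x - v0 x)))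
      l (nhds 0) := by
    have := ((s1.mul s2).add (s1.mul_const (√(S2 v0)))).add (s2.const_mul (√(S2 u0)))
    simpa using this
  refine squeeze_zero_norm' ?_ hb
  filter_upwards [hu, hv] with i hi hi'
  have m1 : MemLp (fun x => u i x - u0 x) 2 volume := hi.sub hu0
  have m2 : MemLp (fun x => v i x - v0 x) 2 volume := hi'.sub hv0
  have e : (∫ x, inner ℝ (u i x) (v i x)) - (∫ x, inner ℝ (u0 x) (v0 x)) =
      (∫ x, inner ℝ (u i x - u0 x) (v i x - v0 x)) + (∫ x, inner ℝ (u i x - u0 x) (v0 x))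
      + ∫ x, inner ℝ (u0 x) (v i x - v0 x) := by
    have hadd : Integrable (fun x => inner ℝ (u i x - u0 x) (v i x - v0 x)
        + inner ℝ (u i x - u0 x) (v0 x)) := (inner_int m1 m2).add (inner_int m1 hv0)
    rw [← integral_sub (inner_int hi hi') (inner_int hu0 hv0),
      ← integral_add (inner_int m1 m2) (inner_int m1 hv0),
      ← integral_add hadd (inner_int hu0 m2)]
    congr 1; ext x
    simp only [inner_sub_left, inner_sub_right, Pi.add_apply]; ring
  rw [e, Real.norm_eq_abs]
  refine (abs_add_three _ _ _).trans ?_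
  gcongr
  · exact inner_cs m1 m2
  · exact inner_cs m1 hv0
  · exact inner_cs hu0 m2

lemma inner_self_S2 (u : ℝ → E3) : ∫ x, inner ℝ (u x) (u x) = S2 u := by
  simp [S2]

/-- domination lemma: if `‖u‖ ≤ Σ` of three functions -/
lemma memLp_dom {E : Type*} [NormedAddCommGroup E] {u : ℝ → E} {g : ℝ → ℝ}
    (hg : MemLp g 2 volume) (hu : Continuous u) (h : ∀ x, ‖u x‖ ≤ g x) : MemLp u 2 volume :=
  hg.of_le hu.aestronglyMeasurable (Eventually.of_forall fun x => (h x).trans (le_abs_self _))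

lemma S2_mono {E F : Type*} [NormedAddCommGroup E] [NormedAddCommGroup F] {u : ℝ → E} {g : ℝ → F}
    (hg : MemLp g 2 volume) (h : ∀ x, ‖u x‖ ≤ ‖g x‖) : S2 u ≤ S2 g := by
  apply integral_mono_of_nonneg (Eventually.of_forall fun x => by positivity) (sq_int hg)
  exact Eventually.of_forall fun x => by
    have := h x
    simp only
    gcongr

lemma S2_le_sum2 {E F G : Type*} [NormedAddCommGroup E] [NormedAddCommGroup F]
    [NormedAddCommGroup G] {u : ℝ → E} {f : ℝ → F} {g : ℝ → G} {A B : ℝ}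
    (hf : MemLp f 2 volume) (hg : MemLp g 2 volume)
    (h : ∀ x, ‖u x‖ ^ 2 ≤ A * ‖f x‖ ^ 2 + B * ‖g x‖ ^ 2) : S2 u ≤ A * S2 f + B * S2 g := by
  have : S2 u ≤ ∫ x, (A * ‖f x‖ ^ 2 + B * ‖g x‖ ^ 2) := by
    apply integral_mono_of_nonneg (Eventually.of_forall fun x => by positivity)
    · exact ((sq_int hf).const_mul A).add ((sq_int hg).const_mul B)
    · exact Eventually.of_forall h
  rwa [integral_add ((sq_int hf).const_mul A) ((sq_int hg).const_mul B), integral_const_mul,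
    integral_const_mul] at this

lemma sup_le_int {φ φ' : ℝ → ℝ} (hd : ∀ x, HasDerivAt φ (φ' x) x) (h1 : Integrable φ)
    (h2 : Integrable φ') (x : ℝ) : |φ x| ≤ ∫ y, |φ' y| := by
  have ht := tendsto_zero_of_hasDerivAt_of_integrableOn_Iic (a := x) (fun y _ => hd y)
    h2.integrableOn h1.integrableOn
  have h := integral_Iic_of_hasDerivAt_of_tendsto (hd x).continuousAt.continuousWithinAt
    (fun y _ => hd y) h2.integrableOn ht
  rw [sub_zero] at h
  rw [← h]
  refine (abs_integral_le_integral_abs).trans ?_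
  exact setIntegral_le_integral h2.abs (Eventually.of_forall fun y => abs_nonneg _)

lemma sup_sq_le {u u' : ℝ → E3} (hd : ∀ x, HasDerivAt u (u' x) x) (h1 : MemLp u 2 volume)
    (h2 : MemLp u' 2 volume) (x : ℝ) : ‖u x‖ ^ 2 ≤ S2 u + S2 u' := by
  have hd' : ∀ x, HasDerivAt (fun x => ‖u x‖ ^ 2) (2 * inner ℝ (u x) (u' x)) x := fun x =>
    (hd x).norm_sq
  have h := sup_le_int hd' (sq_int h1) ((inner_int h1 h2).const_mul 2) x
  rw [abs_of_nonneg (by positivity)] at h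
  refine h.trans ?_
  rw [S2, S2, ← integral_add (sq_int h1) (sq_int h2)]
  apply integral_mono ((inner_int h1 h2).const_mul 2).abs ((sq_int h1).add (sq_int h2))
  intro y
  have := abs_real_inner_le_norm (u y) (u' y)
  simp only [abs_mul, abs_two, Pi.add_apply]
  nlinarith [sq_nonneg (‖u y‖ - ‖u' y‖)]

/-- Cauchy–Schwarz with weight on an interval -/
lemma cs_weight {s t : ℝ} (hst : s < t) {g : ℝ → E3} {ω : ℝ → ℝ} (hg : Continuous g)
    (hω : Continuous ω) (hp : ∀ τ, 0 < ω τ) :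
    ‖∫ τ in s..t, g τ‖ ^ 2 ≤ (∫ τ in s..t, ω τ) * ∫ τ in s..t, (ω τ)⁻¹ * ‖g τ‖ ^ 2 := by
  set A := ∫ τ in s..t, ω τ with hA
  set I := ∫ τ in s..t, ‖g τ‖ with hI
  set B := ∫ τ in s..t, (ω τ)⁻¹ * ‖g τ‖ ^ 2 with hB
  have h0 : ‖∫ τ in s..t, g τ‖ ≤ I := intervalIntegral.norm_integral_le_integral_norm hst.le
  have hApos : 0 < A := intervalIntegral.intervalIntegral_pos_of_pos_on
    (hω.intervalIntegrable _ _) (fun x _ => hp x) hst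
  have hinv : Continuous fun τ => (ω τ)⁻¹ := hω.inv₀ fun τ => (hp τ).ne'
  have h1 : 0 ≤ ∫ τ in s..t, (ω τ)⁻¹ * (A * ‖g τ‖ - I * ω τ) ^ 2 := by
    apply intervalIntegral.integral_nonneg hst.le
    intro u _
    have := hp u
    positivity
  have e : ∫ τ in s..t, (ω τ)⁻¹ * (A * ‖g τ‖ - I * ω τ) ^ 2 =
      ∫ τ in s..t, (A ^ 2 * ((ω τ)⁻¹ * ‖g τ‖ ^ 2) - (2 * A * I) * ‖g τ‖ + I ^ 2 * ω τ) := by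
    congr 1; ext τ
    have := (hp τ).ne'
    field_simp; ring
  rw [e, intervalIntegral.integral_add, intervalIntegral.integral_sub,
    intervalIntegral.integral_const_mul, intervalIntegral.integral_const_mul,
    intervalIntegral.integral_const_mul, ← hA, ← hB, ← hI] at h1
  · have h2 : I ^ 2 ≤ A * B := by nlinarith
    calc _ ≤ I ^ 2 := by gcongr
      _ ≤ _ := h2
  all_goals apply Continuous.intervalIntegrable; fun_prop

lemma S2_lintegral {E : Type*} [NormedAddCommGroup E] {u : ℝ → E} {A : ℝ} (hA : 0 ≤ A)
    (hu : Continuous u) (h : ∫⁻ x, ENNReal.ofReal (‖u x‖ ^ 2) ≤ ENNReal.ofReal A) :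
    MemLp u 2 volume ∧ S2 u ≤ A := by
  have hm : MemLp u 2 volume := by
    rw [memLp_two_iff_integrable_sq_norm hu.aestronglyMeasurable]
    refine ⟨by fun_prop, ?_⟩
    rw [hasFiniteIntegral_iff_ofReal (Eventually.of_forall fun x => by positivity)]
    exact h.trans_lt ENNReal.ofReal_lt_top
  refine ⟨hm, ?_⟩
  rw [← ofReal_integral_eq_lintegral_ofReal (sq_int hm)
    (Eventually.of_forall fun x => by positivity)] at h
  exact (ENNReal.ofReal_le_ofReal_iff hA).1 h

lemma tonelli {s t : ℝ} (hst : s < t) {g : ℝ → ℝ → E3} {ω β : ℝ → ℝ}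
    (hg : Continuous (fun p : ℝ × ℝ => g p.1 p.2))
    (hω : Continuous ω) (hp : ∀ τ, 0 < ω τ) (hβ : IntervalIntegrable β volume s t)
    (hm : ∀ τ ∈ Set.Ioc s t, MemLp (g τ) 2 volume)
    (hb : ∀ τ ∈ Set.Ioc s t, (ω τ)⁻¹ * S2 (g τ) ≤ β τ) :
    MemLp (fun x => ∫ τ in s..t, g τ x) 2 volume ∧
      S2 (fun x => ∫ τ in s..t, g τ x) ≤ (∫ τ in s..t, ω τ) * ∫ τ in s..t, β τ := by
  have hinv : Continuous fun τ => (ω τ)⁻¹ := hω.inv₀ fun τ => (hp τ).ne'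
  have hApos : 0 < ∫ τ in s..t, ω τ := intervalIntegral.intervalIntegral_pos_of_pos_on
    (hω.intervalIntegrable _ _) (fun x _ => hp x) hst
  have hb0 : ∀ τ ∈ Set.Ioc s t, 0 ≤ β τ := fun τ h => le_trans
    (mul_nonneg (inv_nonneg.2 (hp τ).le) (S2_nonneg _)) (hb τ h)
  have hB : 0 ≤ ∫ τ in s..t, β τ := by
    rw [intervalIntegral.integral_of_le hst.le]
    exact setIntegral_nonneg measurableSet_Ioc hb0
  apply S2_lintegral (mul_nonneg hApos.le hB)
  · have : Continuous (Function.uncurry fun (x : ℝ) (τ : ℝ) => g τ x) := by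
      exact hg.comp continuous_swap
    exact intervalIntegral.continuous_parametric_intervalIntegral_of_continuous' this s t
  have hc1 : ∀ x, Continuous fun τ => g τ x := fun x =>
    hg.comp (Continuous.prodMk continuous_id continuous_const)
  calc ∫⁻ x, ENNReal.ofReal (‖∫ τ in s..t, g τ x‖ ^ 2)
      ≤ ∫⁻ x, ENNReal.ofReal (∫ τ in s..t, ω τ) *
          ∫⁻ τ in Set.Ioc s t, ENNReal.ofReal ((ω τ)⁻¹ * ‖g τ x‖ ^ 2) := by
        apply lintegral_mono
        intro x
        have hcc := hc1 x
        have hci : Continuous fun τ => (ω τ)⁻¹ * ‖g τ x‖ ^ 2 := by fun_prop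
        have := cs_weight hst (hc1 x) hω hp
        refine (ENNReal.ofReal_le_ofReal this).trans ?_
        rw [ENNReal.ofReal_mul hApos.le]
        refine mul_le_mul' le_rfl (le_of_eq ?_)
        rw [intervalIntegral.integral_of_le hst.le, ofReal_integral_eq_lintegral_ofReal]
        · exact (hci.intervalIntegrable s t).1
        · exact Eventually.of_forall fun τ => mul_nonneg (inv_nonneg.2 (hp τ).le) (by positivity)
    _ = ENNReal.ofReal (∫ τ in s..t, ω τ) *
          ∫⁻ x, ∫⁻ τ in Set.Ioc s t, ENNReal.ofReal ((ω τ)⁻¹ * ‖g τ x‖ ^ 2) := by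
        rw [lintegral_const_mul']; exact ENNReal.ofReal_ne_top
    _ = ENNReal.ofReal (∫ τ in s..t, ω τ) *
          ∫⁻ τ in Set.Ioc s t, ∫⁻ x, ENNReal.ofReal ((ω τ)⁻¹ * ‖g τ x‖ ^ 2) := by
        congr 1
        apply lintegral_lintegral_swap
        apply Measurable.aemeasurable
        apply Measurable.ennreal_ofReal
        apply Continuous.measurable
        have : Continuous fun p : ℝ × ℝ => g p.2 p.1 := hg.comp continuous_swap
        show Continuous fun p : ℝ × ℝ => (ω p.2)⁻¹ * ‖g p.2 p.1‖ ^ 2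
        exact (hinv.comp continuous_snd).mul (this.norm.pow 2)
    _ ≤ ENNReal.ofReal (∫ τ in s..t, ω τ) * ∫⁻ τ in Set.Ioc s t, ENNReal.ofReal (β τ) := by
        gcongr ENNReal.ofReal (∫ τ in s..t, ω τ) * ?_
        apply setLIntegral_mono_ae' measurableSet_Ioc
        refine Eventually.of_forall fun τ hτ => ?_
        rw [← ofReal_integral_eq_lintegral_ofReal ((sq_int (hm τ hτ)).const_mul _)
          (Eventually.of_forall fun x => mul_nonneg (inv_nonneg.2 (hp τ).le) (by positivity)),
          integral_const_mul]
        exact ENNReal.ofReal_le_ofReal (hb τ hτ)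
    _ = _ := by
        rw [ENNReal.ofReal_mul hApos.le, intervalIntegral.integral_of_le (f := β) hst.le,
          ofReal_integral_eq_lintegral_ofReal hβ.1]
        exact (ae_restrict_iff' measurableSet_Ioc).2 (Eventually.of_forall hb0)

end

section

/-! ### Single-time identities -/

lemma cont_cross {X : Type*} [TopologicalSpace X] {f g : X → E3} (hf : Continuous f)
    (hg : Continuous g) : Continuous fun p => cross3 (f p) (g p) := by
  unfold cross3
  fun_prop

lemma cont_comp {X : Type*} [TopologicalSpace X] {f : X → E3} (hf : Continuous f) (i : Fin 3) :
    Continuous fun p => f p i := by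
  fun_prop

lemma cont_cF {X : Type*} [TopologicalSpace X] {f : X → E3} (hf : Continuous f) :
    Continuous fun p => cF (f p) := by
  unfold cF
  fun_prop

lemma cont_pp {X : Type*} [TopologicalSpace X] {f : X → E3} (hf : Continuous f) :
    Continuous fun p => pp (f p) := by
  unfold pp
  fun_prop

lemma cont_cD {X : Type*} [TopologicalSpace X] (γ κ : ℝ) {f g : X → E3} (hf : Continuous f)
    (hg : Continuous g) : Continuous fun p => cD γ κ (f p) (g p) := by
  unfold cD
  have := cont_cross (continuous_const (y := e1)) hf
  have := cont_cF hf
  fun_prop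

lemma cont_cDx {X : Type*} [TopologicalSpace X] (γ κ : ℝ) {f g k : X → E3} (hf : Continuous f)
    (hg : Continuous g) (hk : Continuous k) : Continuous fun p => cDx γ κ (f p) (g p) (k p) := by
  unfold cDx
  have := cont_cross (continuous_const (y := e1)) hg
  fun_prop

lemma cont_cT {X : Type*} [TopologicalSpace X] (γ κ : ℝ) {f g k : X → E3} (hf : Continuous f)
    (hg : Continuous g) (hk : Continuous k) : Continuous fun p => cT γ κ (f p) (g p) (k p) := by
  unfold cT
  have h1 := cont_cD γ κ hf hg
  have h2 := cont_cDx γ κ hf hg hk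
  have h3 := cont_cross (continuous_const (y := e1)) h1
  fun_prop

lemma cont_cX {X : Type*} [TopologicalSpace X] (γ : ℝ) {f g k : X → E3} (hf : Continuous f)
    (hg : Continuous g) (hk : Continuous k) : Continuous fun p => cX γ (f p) (g p) (k p) := by
  unfold cX
  have h3 := cont_cross (continuous_const (y := e1)) hg
  fun_prop

lemma cont_cM {X : Type*} [TopologicalSpace X] (α γ : ℝ) {h : X → ℝ} {f g k : X → E3}
    (hh : Continuous h) (hf : Continuous f)
    (hg : Continuous g) (hk : Continuous k) :
    Continuous fun p => cM α γ (h p) (f p) (g p) (k p) := by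
  unfold cM
  have h1 : Continuous fun p => cX γ (f p) (g p) (k p) + h p • e1 :=
    (cont_cX γ hf hg hk).add (hh.smul continuous_const)
  exact (cont_cross hf h1).sub ((cont_cross hf (cont_cross hf h1)).const_smul α)

lemma cont_cG {X : Type*} [TopologicalSpace X] (α γ κ : ℝ) {h : X → ℝ} {f g k : X → E3}
    (hh : Continuous h) (hf : Continuous f)
    (hg : Continuous g) (hk : Continuous k) :
    Continuous fun p => cG α γ κ (h p) (f p) (g p) (k p) := by
  unfold cG
  have h1 := cont_cT γ κ hf hg hk
  have h2 := cont_cD γ κ hf hg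
  have h3 := cont_cross hf h1
  have h4 := cont_cross hf h3
  fun_prop

lemma cont_cN {X : Type*} [TopologicalSpace X] (γ κ : ℝ) {f g k : X → E3} (hf : Continuous f)
    (hg : Continuous g) (hk : Continuous k) : Continuous fun p => cN γ κ (f p) (g p) (k p) := by
  unfold cN
  have h1 := cont_cD γ κ hf hg
  have h2 := cont_cDx γ κ hf hg hk
  have h3 := cont_cross (continuous_const (y := e1)) h1
  fun_prop

def crossL : E3 →L[ℝ] E3 := LinearMap.toContinuousLinearMap
  { toFun := cross3 e1
    map_add' := fun a b => cross3_add_right a b e1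
    map_smul' := fun r a => cross3_smul_right r a e1 }

lemma crossL_apply (a : E3) : crossL a = cross3 e1 a := rfl

lemma deriv_cross {a : ℝ → E3} {b : E3} {x : ℝ} (h : HasDerivAt a b x) :
    HasDerivAt (fun x => cross3 e1 (a x)) (cross3 e1 b) x :=
  crossL.hasFDerivAt.comp_hasDerivAt x h

lemma cross_anti (a b : E3) : cross3 a b = -cross3 b a := by
  apply ext3 <;> simp <;> ring

lemma deriv_cross' {a : ℝ → E3} {b : E3} {x : ℝ} (h : HasDerivAt a b x) :
    HasDerivAt (fun x => cross3 (a x) e1) (cross3 b e1) x := by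
  simp only [cross_anti _ e1]
  exact (deriv_cross h).neg

lemma deriv_comp3 {a : ℝ → E3} {b : E3} {x : ℝ} (h : HasDerivAt a b x) (i : Fin 3) :
    HasDerivAt (fun x => a x i) (b i) x :=
  (EuclideanSpace.proj i : E3 →L[ℝ] ℝ).hasFDerivAt.comp_hasDerivAt x h

lemma deriv_cF {a : ℝ → E3} {b : E3} {x : ℝ} (h : HasDerivAt a b x) :
    HasDerivAt (fun x => cF (a x)) (-(b 0 • a x + a x 0 • b)) x := by
  unfold cF
  have := ((deriv_comp3 h 0).smul h).const_sub e1
  refine this.congr_deriv ?_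
  rw [add_comm]

lemma deriv_cD (γ κ : ℝ) {a b : ℝ → E3} {c : E3} {x : ℝ} (h : HasDerivAt a (b x) x)
    (h' : HasDerivAt b c x) :
    HasDerivAt (fun x => cD γ κ (a x) (b x)) (cDx γ κ (a x) (b x) c) x := by
  unfold cD
  have := (h'.add ((deriv_cross h).const_smul γ)).sub ((deriv_cF h).const_smul κ)
  refine this.congr_deriv ?_
  unfold cDx
  rw [smul_neg, sub_neg_eq_add]

/-- a C² profile with values in the sphere and finite energy -/
structure Prof (a b c : ℝ → E3) : Prop where
  un : ∀ x, ‖a x‖ = 1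
  da : ∀ x, HasDerivAt a (b x) x
  db : ∀ x, HasDerivAt b (c x) x
  cc : Continuous c
  m1 : MemLp (fun x => a x 1) 2 volume
  m2 : MemLp (fun x => a x 2) 2 volume
  mb : MemLp b 2 volume
  mc : MemLp c 2 volume

namespace Prof
variable {a b c : ℝ → E3} (P : Prof a b c)

lemma ca (P : Prof a b c) : Continuous a := continuous_iff_continuousAt.2 fun x => (P.da x).continuousAt
lemma cb (P : Prof a b c) : Continuous b := continuous_iff_continuousAt.2 fun x => (P.db x).continuousAt

lemma orth (P : Prof a b c) (x : ℝ) : inner ℝ (a x) (b x) = 0 := by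
  have h := (P.da x).norm_sq
  have e : (fun x => ‖a x‖ ^ 2) = fun _ => (1:ℝ) := by ext y; rw [P.un]; norm_num
  rw [e] at h
  have := h.unique (hasDerivAt_const x 1)
  linarith

lemma mpp (P : Prof a b c) : MemLp (fun x => pp (a x)) 2 volume := by
  have := P.m1.norm.add P.m2.norm
  exact this

lemma mnb (P : Prof a b c) : MemLp (fun x => ‖b x‖) 2 volume := P.mb.norm
lemma mnc (P : Prof a b c) : MemLp (fun x => ‖c x‖) 2 volume := P.mc.norm

lemma mD (P : Prof a b c) {γ κ : ℝ} (hγ : |γ| ≤ 1) (hκ : |κ| ≤ 1) :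
    MemLp (fun x => cD γ κ (a x) (b x)) 2 volume :=
  memLp_dom (P.mnb.add (P.mpp.const_mul 2)) (cont_cD γ κ P.ca P.cb)
    fun x => cD_le hγ hκ _ _ (P.un x)

lemma mDx (P : Prof a b c) {γ κ : ℝ} (hγ : |γ| ≤ 1) (hκ : |κ| ≤ 1) :
    MemLp (fun x => cDx γ κ (a x) (b x) (c x)) 2 volume :=
  memLp_dom (P.mnc.add (P.mnb.const_mul 3)) (cont_cDx γ κ P.ca P.cb P.cc)
    fun x => cDx_le hγ hκ _ _ _ (P.un x)

lemma mT (P : Prof a b c) {γ κ : ℝ} (hγ : |γ| ≤ 1) (hκ : |κ| ≤ 1) :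
    MemLp (fun x => cT γ κ (a x) (b x) (c x)) 2 volume :=
  memLp_dom ((P.mnc.add (P.mnb.const_mul 5)).add (P.mpp.const_mul 4))
    (cont_cT γ κ P.ca P.cb P.cc) fun x => cT_le hγ hκ _ _ _ (P.un x)

lemma maT (P : Prof a b c) {γ κ : ℝ} (hγ : |γ| ≤ 1) (hκ : |κ| ≤ 1) :
    MemLp (fun x => cross3 (a x) (cT γ κ (a x) (b x) (c x))) 2 volume :=
  memLp_dom (P.mT hγ hκ).norm (cont_cross P.ca (cont_cT γ κ P.ca P.cb P.cc)) fun x => by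
    have := norm_cross_le (a x) (cT γ κ (a x) (b x) (c x))
    rwa [P.un, one_mul] at this

lemma mX (P : Prof a b c) {γ : ℝ} (hγ : |γ| ≤ 1) :
    MemLp (fun x => cX γ (a x) (b x) (c x)) 2 volume :=
  memLp_dom ((P.mnc.add (P.mnb.const_mul 2)).add P.mpp)
    (cont_cX γ P.ca P.cb P.cc) fun x => cX_le hγ _ _ _

lemma mM (P : Prof a b c) {α γ : ℝ} (hα : 0 < α) (hγ : |γ| ≤ 1) (h : ℝ) :
    MemLp (fun x => cM α γ h (a x) (b x) (c x)) 2 volume :=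
  memLp_dom (((P.mnc.add (P.mnb.const_mul 2)).add (P.mpp.const_mul (1 + |h|))).const_mul (1 + α))
    (cont_cM α γ continuous_const P.ca P.cb P.cc) fun x => cM_le hα hγ _ _ _ _ (P.un x)

lemma mF (P : Prof a b c) : MemLp (fun x => cF (a x)) 2 volume :=
  memLp_dom P.mpp (cont_cF P.ca) fun x => norm_cF_le _ (P.un x)

lemma mae (P : Prof a b c) : MemLp (fun x => cross3 (a x) e1) 2 volume :=
  memLp_dom P.mpp (cont_cross P.ca continuous_const) fun x => norm_cross_e1_le' _

lemma mbe (P : Prof a b c) : MemLp (fun x => cross3 (b x) e1) 2 volume :=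
  memLp_dom P.mnb (cont_cross P.cb continuous_const) fun x => by
    rw [cross_anti, norm_neg]; exact norm_cross_e1 _

lemma mF' (P : Prof a b c) : MemLp (fun x => -((b x) 0 • a x + a x 0 • b x)) 2 volume := by
  refine memLp_dom (P.mnb.const_mul 2) (by have := P.ca; have := P.cb; fun_prop) fun x => ?_
  rw [norm_neg]
  refine (norm_add_le _ _).trans ?_
  have h1 := abs_comp_le (b x) 0
  have h2 := comp_le1 (P.un x) 0
  rw [norm_smul, norm_smul, P.un, Real.norm_eq_abs, Real.norm_eq_abs]
  nlinarith [norm_nonneg (b x)]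

lemma mN (P : Prof a b c) {γ κ : ℝ} (hγ : |γ| ≤ 1) (hκ : |κ| ≤ 1) :
    MemLp (fun x => cN γ κ (a x) (b x) (c x)) 2 volume := by
  refine memLp_dom (((P.mDx hγ hκ).norm.add (P.mD hγ hκ).norm).const_mul 2)
    (cont_cN γ κ P.ca P.cb P.cc) fun x => ?_
  unfold cN
  simp only [Pi.add_apply]
  set D := cD γ κ (a x) (b x)
  set Dx := cDx γ κ (a x) (b x) (c x)
  have h1 : ‖Dx + γ • cross3 e1 D‖ ≤ ‖Dx‖ + ‖D‖ :=
    (norm_add_le _ _).trans (add_le_add le_rfl ((norm_smul_le1 hγ _).trans (norm_cross_e1 _)))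
  set Z := Dx + γ • cross3 e1 D
  have h2 := abs_real_inner_le_norm (a x) Z
  rw [P.un, one_mul] at h2
  refine (norm_sub_le _ _).trans ?_
  rw [norm_smul, P.un, Real.norm_eq_abs]
  linarith

lemma int1 (P : Prof a b c) {γ κ : ℝ} (hk : γ ^ 2 + κ ^ 2 = 1) (hγ : |γ| ≤ 1) (hκ : |κ| ≤ 1) :
    ∫ x, inner ℝ (cross3 (a x) e1) (cT γ κ (a x) (b x) (c x)) = 0 := by
  simp only [fun x => tot1 hk (a x) (b x) (c x) (P.un x)]
  apply integral_eq_zero_of_hasDerivAt_of_integrable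
    (f := fun x => inner ℝ (cross3 (a x) e1) (cD γ κ (a x) (b x)))
  · intro x
    exact (deriv_cross' (P.da x)).inner ℝ (deriv_cD γ κ (P.da x) (P.db x))
  · exact (inner_int P.mae (P.mDx hγ hκ)).add (inner_int P.mbe (P.mD hγ hκ))
  · exact inner_int P.mae (P.mD hγ hκ)

lemma a0_int (P : Prof a b c) {u : ℝ → E3} (hu : MemLp u 2 volume) :
    Integrable (fun x => a x 0 * ‖u x‖ ^ 2) := by
  refine (sq_int hu).mono' ?_ (Eventually.of_forall fun x => ?_)
  · exact (cont_comp P.ca 0).aestronglyMeasurable.mul (sq_int hu).1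
  · rw [Real.norm_eq_abs, abs_mul, abs_of_nonneg (by positivity : 0 ≤ ‖u x‖ ^ 2)]
    have := comp_le1 (P.un x) 0
    nlinarith [sq_nonneg ‖u x‖]

lemma int2 (P : Prof a b c) {γ κ : ℝ} (hγ : |γ| ≤ 1) (hκ : |κ| ≤ 1) :
    ∫ x, inner ℝ (cF (a x)) (cT γ κ (a x) (b x) (c x)) =
      ∫ x, a x 0 * ‖cD γ κ (a x) (b x)‖ ^ 2 := by
  rw [← sub_eq_zero, ← integral_sub (inner_int P.mF (P.mT hγ hκ)) (P.a0_int (P.mD hγ hκ))]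
  simp only [fun x => tot2 (γ := γ) (κ := κ) (a x) (b x) (c x) (P.un x) (P.orth x)]
  apply integral_eq_zero_of_hasDerivAt_of_integrable
    (f := fun x => inner ℝ (cF (a x)) (cD γ κ (a x) (b x)))
  · intro x
    exact (deriv_cF (P.da x)).inner ℝ (deriv_cD γ κ (P.da x) (P.db x))
  · exact (inner_int P.mF (P.mDx hγ hκ)).add (inner_int P.mF' (P.mD hγ hκ))
  · exact inner_int P.mF (P.mD hγ hκ)

lemma dissip (P : Prof a b c) {α γ κ : ℝ} (h : ℝ) (hk : γ ^ 2 + κ ^ 2 = 1) (hγ : |γ| ≤ 1)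
    (hκ : |κ| ≤ 1) :
    ∫ x, inner ℝ (cM α γ h (a x) (b x) (c x)) (cT γ κ (a x) (b x) (c x)) =
      α * S2 (fun x => cross3 (a x) (cT γ κ (a x) (b x) (c x))) +
        α * h * ∫ x, a x 0 * ‖cD γ κ (a x) (b x)‖ ^ 2 := by
  simp only [fun x => inner_cM_cT (α := α) (h := h) hk (a x) (b x) (c x) (P.un x)]
  have i1 := (sq_int (P.maT hγ hκ)).const_mul α
  have i2 := (inner_int P.mae (P.mT hγ hκ)).const_mul h
  have i3 := (inner_int P.mF (P.mT hγ hκ)).const_mul (α * h)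
  rw [integral_add _ i3, integral_add i1 i2, integral_const_mul, integral_const_mul,
    integral_const_mul, P.int1 hk hγ hκ, P.int2 hγ hκ, S2]
  · ring
  · exact i1.add i2

lemma coer (P : Prof a b c) {γ κ : ℝ} (hγ : |γ| ≤ 1) (hκ : |κ| ≤ 1)
    (hf : S2 (fun x => cD γ κ (a x) (b x)) ≤ κ ^ 2 / 4) :
    κ ^ 2 / 2 * S2 (fun x => cD γ κ (a x) (b x)) ≤
      S2 (fun x => cross3 (a x) (cT γ κ (a x) (b x) (c x))) := by
  set f := S2 (fun x => cD γ κ (a x) (b x)) with hfd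
  set n := S2 (fun x => cN γ κ (a x) (b x) (c x)) with hnd
  have hf0 : 0 ≤ f := S2_nonneg _
  have hn0 : 0 ≤ n := S2_nonneg _
  have hsup : ∀ x, ‖cD γ κ (a x) (b x)‖ ^ 2 ≤ f + n := by
    intro x
    have hd' : ∀ x, HasDerivAt (fun x => ‖cD γ κ (a x) (b x)‖ ^ 2)
        (2 * inner ℝ (cD γ κ (a x) (b x)) (cN γ κ (a x) (b x) (c x))) x := fun x => by
      rw [← inner_D_N _ _ _ (P.un x) (P.orth x)]
      exact (deriv_cD γ κ (P.da x) (P.db x)).norm_sq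
    have i := (inner_int (P.mD hγ hκ) (P.mN hγ hκ)).const_mul 2
    have h := sup_le_int hd' (sq_int (P.mD hγ hκ)) i x
    rw [abs_of_nonneg (by positivity)] at h
    refine h.trans ?_
    rw [hfd, hnd, S2, S2, ← integral_add (sq_int (P.mD hγ hκ)) (sq_int (P.mN hγ hκ))]
    apply integral_mono i.abs ((sq_int (P.mD hγ hκ)).add (sq_int (P.mN hγ hκ)))
    intro y
    have := abs_real_inner_le_norm (cD γ κ (a y) (b y)) (cN γ κ (a y) (b y) (c y))
    simp only [abs_mul, abs_two, Pi.add_apply]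
    nlinarith [sq_nonneg (‖cD γ κ (a y) (b y)‖ - ‖cN γ κ (a y) (b y) (c y)‖)]
  have hbb : ∀ x, ‖b x‖ ^ 2 ≤ S2 b + S2 c := sup_sq_le P.db P.mb P.mc
  have iD := sq_int (P.mD hγ hκ)
  have iN := sq_int (P.mN hγ hκ)
  have ib : Integrable (fun x => b x 0 * ‖cD γ κ (a x) (b x)‖ ^ 2) := by
    refine (iD.const_mul (√(S2 b + S2 c))).mono' ?_ (Eventually.of_forall fun x => ?_)
    · exact (cont_comp P.cb 0).aestronglyMeasurable.mul iD.1
    · rw [Real.norm_eq_abs, abs_mul, abs_of_nonneg (by positivity : 0 ≤ ‖cD γ κ (a x) (b x)‖ ^ 2)]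
      have h1 := (abs_comp_le (b x) 0).trans (Real.le_sqrt_of_sq_le (hbb x))
      gcongr
  have itot : Integrable (fun x => b x 0 * ‖cD γ κ (a x) (b x)‖ ^ 2
      + a x 0 * (2 * inner ℝ (cD γ κ (a x) (b x)) (cDx γ κ (a x) (b x) (c x)))) := by
    refine ib.add ?_
    have i := (inner_int (P.mD hγ hκ) (P.mDx hγ hκ)).const_mul 2
    refine i.abs.mono' ?_ (Eventually.of_forall fun x => ?_)
    · exact (cont_comp P.ca 0).aestronglyMeasurable.mul i.1
    · rw [Real.norm_eq_abs, abs_mul]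
      have := comp_le1 (P.un x) 0
      exact mul_le_of_le_one_left (abs_nonneg _) this
  have ztot : ∫ x, (b x 0 * ‖cD γ κ (a x) (b x)‖ ^ 2
      + a x 0 * (2 * inner ℝ (cD γ κ (a x) (b x)) (cDx γ κ (a x) (b x) (c x)))) = 0 := by
    apply integral_eq_zero_of_hasDerivAt_of_integrable
      (f := fun x => a x 0 * ‖cD γ κ (a x) (b x)‖ ^ 2) _ itot (P.a0_int (P.mD hγ hκ))
    intro x
    exact (deriv_comp3 (P.da x) 0).mul (deriv_cD γ κ (P.da x) (P.db x)).norm_sq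
  have key : ∫ x, (‖cN γ κ (a x) (b x) (c x)‖ ^ 2 +
      (3 * κ ^ 2 / 4 - (f + n)) * ‖cD γ κ (a x) (b x)‖ ^ 2
      - κ * (b x 0 * ‖cD γ κ (a x) (b x)‖ ^ 2
      + a x 0 * (2 * inner ℝ (cD γ κ (a x) (b x)) (cDx γ κ (a x) (b x) (c x)))))
      ≤ S2 (fun x => cross3 (a x) (cT γ κ (a x) (b x) (c x))) := by
    refine integral_mono ((iN.add (iD.const_mul _)).sub (itot.const_mul κ))
      (sq_int (P.maT hγ hκ)) fun x => ?_
    simp only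
    rw [tot3 (γ := γ) (κ := κ) (a x) (b x) (c x) (P.un x) (P.orth x)]
    have h1 := abs_comp_le (cD γ κ (a x) (b x)) 0
    have h2 := hsup x
    generalize cD γ κ (a x) (b x) = D at *
    have h3 : -(κ * D 0) ≤ κ ^ 2 / 4 + ‖D‖ ^ 2 := by
      have := sq_abs (D 0)
      nlinarith [sq_nonneg (κ / 2 + D 0), abs_nonneg (D 0), norm_nonneg D]
    have := mul_le_mul_of_nonneg_right (h3.trans (add_le_add le_rfl h2)) (sq_nonneg ‖D‖)
    linarith
  rw [integral_sub _ (itot.const_mul κ), integral_add iN (iD.const_mul _), integral_const_mul,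
    integral_const_mul, ztot] at key
  · have e1 : ∫ x, ‖cN γ κ (a x) (b x) (c x)‖ ^ 2 = n := rfl
    have e2 : ∫ x, ‖cD γ κ (a x) (b x)‖ ^ 2 = f := rfl
    rw [e1, e2] at key
    have hk1 : κ ^ 2 ≤ 1 := by rw [← sq_abs]; nlinarith [abs_nonneg κ]
    nlinarith [mul_nonneg hn0 hf0]
  · exact iN.add (iD.const_mul _)

lemma a0_le (P : Prof a b c) {u : ℝ → E3} (hu : MemLp u 2 volume) :
    |∫ x, a x 0 * ‖u x‖ ^ 2| ≤ S2 u := by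
  refine abs_integral_le_integral_abs.trans ?_
  refine integral_mono (P.a0_int hu).abs (sq_int hu) fun x => ?_
  simp only
  rw [abs_mul, abs_of_nonneg (by positivity : 0 ≤ ‖u x‖ ^ 2)]
  exact mul_le_of_le_one_left (by positivity) (comp_le1 (P.un x) 0)

end Prof

end

section

/-! ### Time regularity -/

lemma L2n_dom {E : Type*} [NormedAddCommGroup E] {u : ℝ → E} {g : ℝ → ℝ}
    (hg : MemLp g 2 volume) (h : ∀ x, ‖u x‖ ≤ g x) : L2norm u ≤ L2norm g :=
  ENNReal.toReal_mono hg.eLpNorm_ne_top (eLpNorm_mono_real h)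

lemma L2n_add {E : Type*} [NormedAddCommGroup E] {f g : ℝ → E} (hf : MemLp f 2 volume)
    (hg : MemLp g 2 volume) : L2norm (fun x => f x + g x) ≤ L2norm f + L2norm g := by
  unfold L2norm
  rw [← ENNReal.toReal_add hf.eLpNorm_ne_top hg.eLpNorm_ne_top]
  exact ENNReal.toReal_mono (ENNReal.add_ne_top.2 ⟨hf.eLpNorm_ne_top, hg.eLpNorm_ne_top⟩)
    (eLpNorm_add_le hf.1 hg.1 (by norm_num))

lemma L2n_mul (r : ℝ) (f : ℝ → ℝ) : L2norm (fun x => r * f x) = |r| * L2norm f := by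
  unfold L2norm
  have := eLpNorm_const_smul r f 2 volume
  have e : (fun x => r * f x) = r • f := rfl
  rw [e, this, ENNReal.toReal_mul]
  simp

lemma L2n_smul {E : Type*} [NormedAddCommGroup E] [NormedSpace ℝ E] (r : ℝ) (f : ℝ → E) :
    L2norm (fun x => r • f x) = |r| * L2norm f := by
  unfold L2norm
  have := eLpNorm_const_smul r f 2 volume
  have e : (fun x => r • f x) = r • f := rfl
  rw [e, this, ENNReal.toReal_mul]
  simp

lemma L2n_norm {E : Type*} [NormedAddCommGroup E] (u : ℝ → E) :
    L2norm (fun x => ‖u x‖) = L2norm u := by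
  unfold L2norm
  rw [eLpNorm_norm]

lemma L2n_neg {E : Type*} [NormedAddCommGroup E] (u v : ℝ → E) :
    L2norm (fun x => u x - v x) = L2norm (fun x => v x - u x) := by
  unfold L2norm
  rw [← eLpNorm_neg]
  congr 2; ext x; simp

/-- if `‖u‖ ≤ A f + B g` in terms of norms -/
lemma L2n_dom2 {E F G : Type*} [NormedAddCommGroup E] [NormedAddCommGroup F]
    [NormedAddCommGroup G] {u : ℝ → E} {f : ℝ → F} {g : ℝ → G} {A B : ℝ} (hA : 0 ≤ A) (hB : 0 ≤ B)
    (hf : MemLp f 2 volume) (hg : MemLp g 2 volume)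
    (h : ∀ x, ‖u x‖ ≤ A * ‖f x‖ + B * ‖g x‖) : L2norm u ≤ A * L2norm f + B * L2norm g := by
  refine (L2n_dom ((hf.norm.const_mul A).add (hg.norm.const_mul B)) h).trans ?_
  refine (L2n_add (hf.norm.const_mul A) (hg.norm.const_mul B)).trans ?_
  rw [L2n_mul, L2n_mul, L2n_norm, L2n_norm, abs_of_nonneg hA, abs_of_nonneg hB]

/-- if `‖u‖ ≤ A f + B g + C k` in terms of norms -/
lemma L2n_dom3 {E F G K : Type*} [NormedAddCommGroup E] [NormedAddCommGroup F]
    [NormedAddCommGroup G] [NormedAddCommGroup K] {u : ℝ → E} {f : ℝ → F} {g : ℝ → G} {k : ℝ → K}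
    {A B C : ℝ} (hA : 0 ≤ A) (hB : 0 ≤ B) (hC : 0 ≤ C)
    (hf : MemLp f 2 volume) (hg : MemLp g 2 volume) (hk : MemLp k 2 volume)
    (h : ∀ x, ‖u x‖ ≤ A * ‖f x‖ + B * ‖g x‖ + C * ‖k x‖) :
    L2norm u ≤ A * L2norm f + B * L2norm g + C * L2norm k := by
  refine (L2n_dom (((hf.norm.const_mul A).add (hg.norm.const_mul B)).add (hk.norm.const_mul C))
    h).trans ?_
  refine (L2n_add ((hf.norm.const_mul A).add (hg.norm.const_mul B)) (hk.norm.const_mul C)).trans ?_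
  rw [L2n_mul C, L2n_norm, abs_of_nonneg hC]
  gcongr
  refine (L2n_add (hf.norm.const_mul A) (hg.norm.const_mul B)).trans ?_
  rw [L2n_mul, L2n_mul, L2n_norm, L2n_norm, abs_of_nonneg hA, abs_of_nonneg hB]

/-- the solution bundle -/
structure Sol (α γ : ℝ) (h : ℝ → ℝ) (m b c : ℝ → ℝ → E3) : Prop where
  ch : Continuous h
  hh : ∀ t, |h t| ≤ 1
  cm : Continuous (fun p : ℝ × ℝ => m p.1 p.2)
  cb : Continuous (fun p : ℝ × ℝ => b p.1 p.2)
  cc : Continuous (fun p : ℝ × ℝ => c p.1 p.2)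
  dt : ∀ t, 0 ≤ t → ∀ x,
    HasDerivAt (fun τ => m τ x) (cM α γ (h t) (m t x) (b t x) (c t x)) t
  pr : ∀ t, 0 ≤ t → Prof (m t) (b t) (c t)
  cont : ∀ t₀, 0 ≤ t₀ → ∀ ε > (0:ℝ), ∃ δ > (0:ℝ), ∀ t, 0 ≤ t → |t - t₀| < δ →
    L2norm (fun x => m t x - m t₀ x) < ε ∧ L2norm (fun x => b t x - b t₀ x) < ε ∧
    L2norm (fun x => c t x - c t₀ x) < ε

/-- L² continuity at time s from the right half line -/
def L2to {E : Type*} [NormedAddCommGroup E] (u : ℝ → ℝ → E) (s : ℝ) : Prop :=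
  (∀ᶠ t in nhdsWithin s (Set.Ici 0), MemLp (fun x => u t x - u s x) 2 volume) ∧
  Tendsto (fun t => L2norm (fun x => u t x - u s x)) (nhdsWithin s (Set.Ici 0)) (nhds 0)

lemma L2to.S2 {E : Type*} [NormedAddCommGroup E] {u : ℝ → ℝ → E} {s : ℝ} (h : L2to u s) :
    Tendsto (fun t => S2 (fun x => u t x - u s x)) (nhdsWithin s (Set.Ici 0)) (nhds 0) := by
  have := h.2.pow 2
  rw [zero_pow (by norm_num)] at this
  refine this.congr' ?_
  filter_upwards [h.1] with t ht
  rw [L2norm_sq ht]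

lemma L2to.S2_cont {u : ℝ → ℝ → E3} {s : ℝ} (hs : 0 ≤ s) (h : L2to u s)
    (hm : ∀ t, 0 ≤ t → MemLp (u t) 2 volume) :
    Tendsto (fun t => _root_.S2 (u t)) (nhdsWithin s (Set.Ici 0)) (nhds (_root_.S2 (u s))) := by
  have h0 : ∀ᶠ t in nhdsWithin s (Set.Ici 0), MemLp (u t) 2 volume := by
    filter_upwards [self_mem_nhdsWithin] with t ht using hm t ht
  have := tendsto_inner_int h0 h0 (hm s hs) (hm s hs) h.S2 h.S2
  simp only [← inner_self_S2]
  exact this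

namespace Sol
variable {α γ : ℝ} {h : ℝ → ℝ} {m b c : ℝ → ℝ → E3}

lemma slice (S : Sol α γ h m b c) (x : ℝ) : Continuous (fun t => m t x) ∧
    Continuous (fun t => b t x) ∧ Continuous (fun t => c t x) := by
  have e : Continuous (fun t : ℝ => (t, x)) := by fun_prop
  exact ⟨S.cm.comp e, S.cb.comp e, S.cc.comp e⟩

lemma nonneg_ev (s : ℝ) : ∀ᶠ t in nhdsWithin s (Set.Ici (0:ℝ)), 0 ≤ t :=
  eventually_mem_nhdsWithin

lemma tends (S : Sol α γ h m b c) {s : ℝ} (hs : 0 ≤ s) :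
    Tendsto (fun t => L2norm (fun x => m t x - m s x)) (nhdsWithin s (Set.Ici 0)) (nhds 0) ∧
    Tendsto (fun t => L2norm (fun x => b t x - b s x)) (nhdsWithin s (Set.Ici 0)) (nhds 0) ∧
    Tendsto (fun t => L2norm (fun x => c t x - c s x)) (nhdsWithin s (Set.Ici 0)) (nhds 0) := by
  refine ⟨?_, ?_, ?_⟩ <;>
  · rw [Metric.tendsto_nhdsWithin_nhds]
    intro ε hε
    obtain ⟨δ, hδ, H⟩ := S.cont s hs ε hε
    refine ⟨δ, hδ, fun t ht htd => ?_⟩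
    rw [Real.dist_eq] at htd
    obtain ⟨h1, h2, h3⟩ := H t ht htd
    rw [Real.dist_eq, sub_zero, abs_of_nonneg (L2norm_nonneg _)]
    assumption

lemma b2 (S : Sol α γ h m b c) {s : ℝ} (hs : 0 ≤ s) : L2to b s := by
  refine ⟨?_, (S.tends hs).2.1⟩
  filter_upwards [nonneg_ev s] with t ht
  exact (S.pr t ht).mb.sub (S.pr s hs).mb

lemma c2 (S : Sol α γ h m b c) {s : ℝ} (hs : 0 ≤ s) : L2to c s := by
  refine ⟨?_, (S.tends hs).2.2⟩
  filter_upwards [nonneg_ev s] with t ht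
  exact (S.pr t ht).mc.sub (S.pr s hs).mc

lemma contOn_of_L2to {u : ℝ → ℝ → E3} (hu : ∀ s, 0 ≤ s → L2to u s)
    (hm : ∀ t, 0 ≤ t → MemLp (u t) 2 volume) :
    ContinuousOn (fun t => S2 (u t)) (Set.Ici 0) := fun s hs => (hu s hs).S2_cont hs hm

/-- fundamental theorem in time -/
lemma ftc (S : Sol α γ h m b c) {s t : ℝ} (hs : 0 ≤ s) (hst : s ≤ t) (x : ℝ) :
    m t x - m s x = ∫ τ in s..t, cM α γ (h τ) (m τ x) (b τ x) (c τ x) := by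
  obtain ⟨h1, h2, h3⟩ := S.slice x
  symm
  apply intervalIntegral.integral_eq_sub_of_hasDerivAt
  · intro τ hτ
    rw [Set.uIcc_of_le hst] at hτ
    exact S.dt τ (hs.trans hτ.1) x
  · exact (cont_cM α γ S.ch h1 h2 h3).intervalIntegrable _ _

lemma sub_le (S : Sol α γ h m b c) (hα : 0 < α) (hγ : |γ| ≤ 1) {s t : ℝ} (hs : 0 ≤ s)
    (hst : s ≤ t) (hsm : 8 * (1 + α) * (t - s) ≤ 1) (x : ℝ) :
    ‖m t x - m s x‖ ≤ 2 * (1 + α) * (∫ τ in s..t, (‖c τ x‖ + 2 * ‖b τ x‖)) + pp (m s x) := by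
  obtain ⟨h1, h2, h3⟩ := S.slice x
  have hcμ : ContinuousOn (fun τ => ‖m τ x - m s x‖) (Set.Icc s t) := by fun_prop
  obtain ⟨r, hr, hmax⟩ := isCompact_Icc.exists_isMaxOn (Set.nonempty_Icc.2 hst) hcμ
  set μ := ‖m r x - m s x‖ with hμ
  have hle : ∀ τ ∈ Set.Icc s t, ‖m τ x - m s x‖ ≤ μ := fun τ hτ => hmax hτ
  have ht := hle t (Set.right_mem_Icc.2 hst)
  have hc1 : Continuous fun τ => ‖c τ x‖ + 2 * ‖b τ x‖ := by fun_prop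
  have hb1 : μ ≤ (1 + α) * (∫ τ in s..t, (‖c τ x‖ + 2 * ‖b τ x‖))
      + (1 + α) * (2 * (pp (m s x) + 2 * μ)) * (t - s) := by
    have hc2 : Continuous fun τ => ‖cM α γ (h τ) (m τ x) (b τ x) (c τ x)‖ :=
      (cont_cM α γ S.ch h1 h2 h3).norm
    calc μ = ‖∫ τ in s..r, cM α γ (h τ) (m τ x) (b τ x) (c τ x)‖ := by rw [hμ, S.ftc hs hr.1 x]
      _ ≤ ∫ τ in s..r, ‖cM α γ (h τ) (m τ x) (b τ x) (c τ x)‖ :=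
          intervalIntegral.norm_integral_le_integral_norm hr.1
      _ ≤ ∫ τ in s..t, ‖cM α γ (h τ) (m τ x) (b τ x) (c τ x)‖ := by
          apply intervalIntegral.integral_mono_interval le_rfl hr.1 hr.2
          · exact Eventually.of_forall fun τ => norm_nonneg _
          · exact hc2.intervalIntegrable _ _
      _ ≤ ∫ τ in s..t, ((1 + α) * (‖c τ x‖ + 2 * ‖b τ x‖) + (1 + α) * (2 * (pp (m s x) + 2 * μ))) := by
          apply intervalIntegral.integral_mono_on hst
          · exact hc2.intervalIntegrable _ _
          · apply Continuous.intervalIntegrable; fun_prop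
          · intro τ hτ
            have e1 := cM_le hα hγ (h τ) (m τ x) (b τ x) (c τ x) ((S.pr τ (hs.trans hτ.1)).un x)
            have e2 := pp_lip (m τ x) (m s x)
            have e3 := hle τ hτ
            have e4 := S.hh τ
            have e5 := pp_nonneg (m τ x)
            refine e1.trans ?_
            rw [← mul_add]
            have : (1 + |h τ|) * pp (m τ x) ≤ 2 * pp (m τ x) := by gcongr; linarith
            refine mul_le_mul_of_nonneg_left ?_ (by linarith)
            linarith
      _ = _ := by
          rw [intervalIntegral.integral_add, intervalIntegral.integral_const_mul,
            intervalIntegral.integral_const, smul_eq_mul, mul_comm (t - s)]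
          all_goals apply Continuous.intervalIntegrable; fun_prop
  have h5 := pp_nonneg (m s x)
  have h6 : 0 ≤ μ := norm_nonneg _
  nlinarith [mul_le_mul_of_nonneg_right hsm h6, mul_le_mul_of_nonneg_right hsm h5]

lemma S2_cont_b (S : Sol α γ h m b c) : ContinuousOn (fun t => S2 (b t)) (Set.Ici 0) :=
  contOn_of_L2to (fun _ hs => S.b2 hs) fun t ht => (S.pr t ht).mb
lemma S2_cont_c (S : Sol α γ h m b c) : ContinuousOn (fun t => S2 (c t)) (Set.Ici 0) :=
  contOn_of_L2to (fun _ hs => S.c2 hs) fun t ht => (S.pr t ht).mc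

lemma ii_of_contOn {β : ℝ → ℝ} (hβ : ContinuousOn β (Set.Ici 0)) {s t : ℝ} (hs : 0 ≤ s)
    (hst : s ≤ t) : IntervalIntegrable β volume s t := by
  apply ContinuousOn.intervalIntegrable
  rw [Set.uIcc_of_le hst]
  exact hβ.mono fun τ hτ => hs.trans hτ.1

lemma sub_mem (S : Sol α γ h m b c) (hα : 0 < α) (hγ : |γ| ≤ 1) {s t : ℝ} (hs : 0 ≤ s)
    (hst : s < t) (hsm : 8 * (1 + α) * (t - s) ≤ 1) :
    MemLp (fun x => m t x - m s x) 2 volume := by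
  have ht : 0 ≤ t := hs.trans hst.le
  have hT := (tonelli hst (g := fun τ x => (‖c τ x‖ + 2 * ‖b τ x‖) • e1) (ω := fun _ => 1)
    (β := fun τ => 2 * S2 (c τ) + 8 * S2 (b τ)) (by
      have := S.cb; have := S.cc; fun_prop) continuous_const (fun _ => one_pos)
    (ii_of_contOn (by have := S.S2_cont_b; have := S.S2_cont_c; fun_prop) hs hst.le)
    (fun τ hτ => by
      have P := S.pr τ (hs.trans hτ.1.le)
      refine memLp_dom (P.mnc.add (P.mnb.const_mul 2)) (by have := P.cb; have := P.cc; fun_prop)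
        fun x => ?_
      rw [norm_smul, norm_e1, mul_one, Real.norm_eq_abs, abs_of_nonneg (by positivity)]; rfl)
    (fun τ hτ => by
      have P := S.pr τ (hs.trans hτ.1.le)
      simp only [inv_one, one_mul]
      refine S2_le_sum2 P.mc P.mb fun x => ?_
      rw [norm_smul, norm_e1, mul_one, Real.norm_eq_abs, sq_abs]
      nlinarith [sq_nonneg (‖c τ x‖ - 2 * ‖b τ x‖)])).1
  refine memLp_dom ((hT.norm.const_mul (2 * (1 + α))).add (S.pr s hs).mpp)
    ((S.pr t ht).ca.sub (S.pr s hs).ca) fun x => ?_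
  refine (S.sub_le hα hγ hs hst.le hsm x).trans (le_of_eq ?_)
  simp only [Pi.add_apply]
  rw [intervalIntegral.integral_smul_const, norm_smul, norm_e1, mul_one, Real.norm_eq_abs,
    abs_of_nonneg]
  exact intervalIntegral.integral_nonneg hst.le fun τ _ => by positivity

lemma m2 (S : Sol α γ h m b c) (hα : 0 < α) (hγ : |γ| ≤ 1) {s : ℝ} (hs : 0 ≤ s) : L2to m s := by
  refine ⟨?_, (S.tends hs).1⟩
  have hη : 0 < 1 / (8 * (1 + α)) := by positivity
  filter_upwards [nonneg_ev s, nhdsWithin_le_nhds (Metric.ball_mem_nhds s hη)] with t ht hd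
  rw [Metric.mem_ball, Real.dist_eq, lt_div_iff₀ (by positivity)] at hd
  have hd1 : 8 * (1 + α) * |t - s| ≤ 1 := by linarith
  rcases lt_trichotomy s t with h1 | h1 | h1
  · rw [abs_of_pos (by linarith)] at hd1
    exact S.sub_mem hα hγ hs h1 hd1
  · subst h1; simp
  · rw [abs_of_neg (by linarith), neg_sub] at hd1
    have := (S.sub_mem hα hγ ht h1 hd1).neg
    refine this.ae_eq (Eventually.of_forall fun x => ?_)
    simp

end Sol

end

section

namespace Sol
variable {α γ : ℝ} {h : ℝ → ℝ} {m b c : ℝ → ℝ → E3}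

/-- uniform distance control -/
def dd (m b : ℝ → ℝ → E3) (s t : ℝ) : ℝ :=
  L2norm (fun x => m t x - m s x) + L2norm (fun x => b t x - b s x)

lemma dd_nonneg (s t : ℝ) : 0 ≤ dd m b s t := add_nonneg (L2norm_nonneg _) (L2norm_nonneg _)

lemma dd_tends (S : Sol α γ h m b c) {s : ℝ} (hs : 0 ≤ s) :
    Tendsto (dd m b s) (nhdsWithin s (Set.Ici 0)) (nhds 0) := by
  have := (S.tends hs).1.add (S.tends hs).2.1
  rwa [add_zero] at this

lemma dd_sup (S : Sol α γ h m b c) (hα : 0 < α) (hγ : |γ| ≤ 1) {s : ℝ} (hs : 0 ≤ s) :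
    ∀ᶠ t in nhdsWithin s (Set.Ici 0), ∀ x, ‖m t x - m s x‖ ≤ dd m b s t := by
  filter_upwards [nonneg_ev s, (S.m2 hα hγ hs).1, (S.b2 hs).1] with t ht h1 h2
  intro x
  have h3 := sup_sq_le (fun x => ((S.pr t ht).da x).sub ((S.pr s hs).da x)) h1 h2 x
  simp only [Pi.sub_apply] at h3
  have h4 : S2 (fun x => m t x - m s x) = _ := L2norm_sq h1
  have h5 : S2 (fun x => b t x - b s x) = _ := L2norm_sq h2
  refine abs_le_of_sq_le_sq' ?_ (dd_nonneg s t) |>.2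
  unfold dd
  have := L2norm_nonneg (fun x => m t x - m s x)
  have := L2norm_nonneg (fun x => b t x - b s x)
  have h3' : ‖m t x - m s x‖ ^ 2 ≤ S2 (fun x => m t x - m s x) + S2 (fun x => b t x - b s x) := h3
  nlinarith

lemma D2 (S : Sol α γ h m b c) (hα : 0 < α) (hγ : |γ| ≤ 1) {κ : ℝ} (hκ : |κ| ≤ 1) {s : ℝ}
    (hs : 0 ≤ s) : L2to (fun t x => cD γ κ (m t x) (b t x)) s := by
  constructor
  · filter_upwards [nonneg_ev s] with t ht
    exact ((S.pr t ht).mD hγ hκ).sub ((S.pr s hs).mD hγ hκ)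
  · have hb := ((S.b2 hs).2.const_mul 1).add ((S.m2 hα hγ hs).2.const_mul 3)
    simp only [mul_zero, add_zero] at hb
    refine squeeze_zero' (Eventually.of_forall fun t => L2norm_nonneg _) ?_ hb
    filter_upwards [nonneg_ev s, (S.m2 hα hγ hs).1, (S.b2 hs).1] with t ht h1 h2
    refine L2n_dom2 zero_le_one (by norm_num) h2 h1 fun x => ?_
    rw [one_mul]
    exact cD_lip hγ hκ _ _ _ _ ((S.pr t ht).un x) ((S.pr s hs).un x)

lemma Dx2 (S : Sol α γ h m b c) (hα : 0 < α) (hγ : |γ| ≤ 1) {κ : ℝ} (hκ : |κ| ≤ 1) {s : ℝ}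
    (hs : 0 ≤ s) : L2to (fun t x => cDx γ κ (m t x) (b t x) (c t x)) s := by
  constructor
  · filter_upwards [nonneg_ev s] with t ht
    exact ((S.pr t ht).mDx hγ hκ).sub ((S.pr s hs).mDx hγ hκ)
  · have hb := (((S.c2 hs).2.const_mul 1).add ((S.b2 hs).2.const_mul 3)).add
      (((S.dd_tends hs).const_mul 2).mul_const (L2norm (b s)))
    simp only [mul_zero, add_zero, zero_mul] at hb
    refine squeeze_zero' (Eventually.of_forall fun t => L2norm_nonneg _) ?_ hb
    filter_upwards [nonneg_ev s, (S.c2 hs).1, (S.b2 hs).1, S.dd_sup hα hγ hs] with t ht h1 h2 h3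
    refine L2n_dom3 zero_le_one (by norm_num) (by have := dd_nonneg (m := m) (b := b) s t; positivity)
      h1 h2 (S.pr s hs).mb fun x => ?_
    rw [one_mul]
    refine (cDx_lip hγ hκ _ _ _ _ _ _ ((S.pr t ht).un x) ((S.pr s hs).un x)).trans ?_
    rw [mul_assoc 2]
    gcongr
    exact h3 x

lemma X2 (S : Sol α γ h m b c) (hα : 0 < α) (hγ : |γ| ≤ 1) {s : ℝ}
    (hs : 0 ≤ s) : L2to (fun t x => cX γ (m t x) (b t x) (c t x)) s := by
  constructor
  · filter_upwards [nonneg_ev s] with t ht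
    exact ((S.pr t ht).mX hγ).sub ((S.pr s hs).mX hγ)
  · have hb := (((S.c2 hs).2.const_mul 1).add ((S.b2 hs).2.const_mul 2)).add
      ((S.m2 hα hγ hs).2.const_mul 1)
    simp only [mul_zero, add_zero] at hb
    refine squeeze_zero' (Eventually.of_forall fun t => L2norm_nonneg _) ?_ hb
    filter_upwards [nonneg_ev s, (S.c2 hs).1, (S.b2 hs).1, (S.m2 hα hγ hs).1] with t ht h1 h2 h3
    refine L2n_dom3 zero_le_one (by norm_num) (by norm_num) h1 h2 h3 fun x => ?_
    rw [one_mul, one_mul]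
    exact cX_lip hγ _ _ _ _ _ _

lemma aT2 (S : Sol α γ h m b c) (hα : 0 < α) (hγ : |γ| ≤ 1) {κ : ℝ} (hκ : |κ| ≤ 1)
    (hk : γ ^ 2 + κ ^ 2 = 1) {s : ℝ}
    (hs : 0 ≤ s) : L2to (fun t x => cross3 (m t x) (cT γ κ (m t x) (b t x) (c t x))) s := by
  constructor
  · filter_upwards [nonneg_ev s] with t ht
    exact ((S.pr t ht).maT hγ hκ).sub ((S.pr s hs).maT hγ hκ)
  · have hb := ((S.X2 hα hγ hs).2.const_mul 1).add
      ((S.dd_tends hs).mul_const (L2norm (fun x => cX γ (m s x) (b s x) (c s x))))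
    simp only [mul_zero, add_zero, zero_mul] at hb
    refine squeeze_zero' (Eventually.of_forall fun t => L2norm_nonneg _) ?_ hb
    filter_upwards [nonneg_ev s, (S.X2 hα hγ hs).1, S.dd_sup hα hγ hs] with t ht h1 h3
    refine L2n_dom2 zero_le_one (dd_nonneg s t) h1 ((S.pr s hs).mX hγ) fun x => ?_
    rw [one_mul, cross_cT hk _ _ _ ((S.pr t ht).un x), cross_cT hk _ _ _ ((S.pr s hs).un x)]
    refine (cross_lip _ _ _ _ ((S.pr t ht).un x)).trans ?_
    gcongr
    exact h3 x

lemma M2 (S : Sol α γ h m b c) (hα : 0 < α) (hγ : |γ| ≤ 1) {s : ℝ} (hs : 0 ≤ s) :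
    L2to (fun t x => cM α γ (h t) (m t x) (b t x) (c t x)) s := by
  constructor
  · filter_upwards [nonneg_ev s] with t ht
    exact ((S.pr t ht).mM hα hγ _).sub ((S.pr s hs).mM hα hγ _)
  · set G : ℝ → ℝ := fun x => ‖c s x‖ + 2 * ‖b s x‖ + pp (m s x) with hG
    have mG : MemLp G 2 volume :=
      ((S.pr s hs).mnc.add ((S.pr s hs).mnb.const_mul 2)).add (S.pr s hs).mpp
    have hhs : Tendsto (fun t => |h t - h s|) (nhdsWithin s (Set.Ici 0)) (nhds 0) := by
      have : Continuous fun t => |h t - h s| := by have := S.ch; fun_prop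
      have := (this.tendsto s).mono_left (nhdsWithin_le_nhds (s := Set.Ici 0))
      simpa using this
    have hb := (((S.c2 hs).2.const_mul (1 + 2 * α)).add
      ((S.b2 hs).2.const_mul ((1 + 2 * α) * 2))).add
      (((((S.m2 hα hγ hs).2.const_mul 2).add ((S.dd_tends hs).mul_const (L2norm G))).add
        (hhs.mul_const (L2norm G))).const_mul (1 + 2 * α))
    simp only [mul_zero, add_zero, zero_mul] at hb
    refine squeeze_zero' (Eventually.of_forall fun t => L2norm_nonneg _) ?_ hb
    filter_upwards [nonneg_ev s, (S.c2 hs).1, (S.b2 hs).1, (S.m2 hα hγ hs).1,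
      S.dd_sup hα hγ hs] with t ht h1 h2 h3 h4
    have hd0 := dd_nonneg (m := m) (b := b) s t
    have mK : MemLp (fun x => 2 * ‖m t x - m s x‖ + dd m b s t * ‖G x‖ + |h t - h s| * ‖G x‖)
        2 volume := ((h3.norm.const_mul 2).add (mG.norm.const_mul _)).add (mG.norm.const_mul _)
    have nK : L2norm (fun x => 2 * ‖m t x - m s x‖ + dd m b s t * ‖G x‖ + |h t - h s| * ‖G x‖) ≤
        2 * L2norm (fun x => m t x - m s x) + dd m b s t * L2norm G + |h t - h s| * L2norm G := by
      refine L2n_dom3 (by norm_num) hd0 (abs_nonneg _) h3 mG mG fun x => ?_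
      rw [Real.norm_eq_abs, abs_of_nonneg]
      positivity
    refine (L2n_dom3 (A := 1 + 2 * α) (B := (1 + 2 * α) * 2) (C := 1 + 2 * α)
      (by positivity) (by positivity) (by positivity)
      h1 h2 mK fun x => ?_).trans ?_
    · refine (cM_lip hα hγ (h t) (h s) (m t x) (m s x) (b t x) (b s x) (c t x) (c s x)
        ((S.pr t ht).un x) ((S.pr s hs).un x)).trans ?_
      have e0 : 0 ≤ G x := by
        have := pp_nonneg (m s x)
        simp only [hG]; positivity
      have e7 : ‖2 * ‖m t x - m s x‖ + dd m b s t * ‖G x‖ + |h t - h s| * ‖G x‖‖ =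
          2 * ‖m t x - m s x‖ + dd m b s t * G x + |h t - h s| * G x := by
        have e8 : ‖G x‖ = G x := by rw [Real.norm_eq_abs, abs_of_nonneg e0]
        rw [e8, Real.norm_eq_abs, abs_of_nonneg (by positivity)]
      rw [e7]
      have e1 := h4 x
      have e2 := S.hh t
      have e3 : (1 + |h t|) * ‖m t x - m s x‖ ≤ 2 * ‖m t x - m s x‖ := by gcongr; linarith
      have e4 : ‖m t x - m s x‖ * (‖c s x‖ + 2 * ‖b s x‖ + pp (m s x)) ≤ dd m b s t * G x := by
        simp only [hG]
        have := pp_nonneg (m s x)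
        gcongr
      have e5 : |h t - h s| * pp (m s x) ≤ |h t - h s| * G x := by
        gcongr; simp only [hG]; linarith [norm_nonneg (c s x), norm_nonneg (b s x)]
      have e6 := mul_le_mul_of_nonneg_left (add_le_add (add_le_add e3 e4) e5)
        (by positivity : 0 ≤ 1 + 2 * α)
      linarith
    · gcongr

/-- difference quotients converge in L² -/
lemma quot (S : Sol α γ h m b c) (hα : 0 < α) (hγ : |γ| ≤ 1) {s : ℝ} (hs : 0 ≤ s) :
    (∀ᶠ t in nhdsWithin s (Set.Ioi s), MemLp (fun x => (t - s)⁻¹ • (m t x - m s x)) 2 volume) ∧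
    Tendsto (fun t => S2 (fun x => (t - s)⁻¹ • (m t x - m s x) -
      cM α γ (h s) (m s x) (b s x) (c s x))) (nhdsWithin s (Set.Ioi s)) (nhds 0) := by
  have hle : nhdsWithin s (Set.Ioi s) ≤ nhdsWithin s (Set.Ici 0) :=
    nhdsWithin_mono s fun t (ht : s < t) => hs.trans ht.le
  have hM := S.M2 hα hγ hs
  have hmem : ∀ᶠ t in nhdsWithin s (Set.Ioi s), MemLp (fun x => (t - s)⁻¹ • (m t x - m s x)) 2 volume := by
    filter_upwards [hle (S.m2 hα hγ hs).1] with t ht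
    exact ht.const_smul ((t - s)⁻¹)
  refine ⟨hmem, ?_⟩
  rw [Metric.tendsto_nhds]
  intro ε hε
  have hS := hM.S2
  rw [Metric.tendsto_nhdsWithin_nhds] at hS
  obtain ⟨δ, hδ, H⟩ := hS (ε / 2) (by positivity)
  have hball : ∀ᶠ t in nhdsWithin s (Set.Ioi s), dist t s < δ :=
    nhdsWithin_le_nhds (Metric.ball_mem_nhds s hδ)
  filter_upwards [hball, self_mem_nhdsWithin] with t htd hst
  have hst : s < t := hst
  rw [Real.dist_eq, sub_zero, abs_of_nonneg (S2_nonneg _)]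
  have hT := (tonelli hst (g := fun τ x => cM α γ (h τ) (m τ x) (b τ x) (c τ x)
      - cM α γ (h s) (m s x) (b s x) (c s x)) (ω := fun _ => 1) (β := fun _ => ε / 2)
    (by
      refine (cont_cM α γ (S.ch.comp continuous_fst) S.cm S.cb S.cc).sub ?_
      exact (cont_cM α γ continuous_const (S.pr s hs).ca (S.pr s hs).cb (S.pr s hs).cc).comp
        continuous_snd)
    continuous_const (fun _ => one_pos) intervalIntegrable_const
    (fun τ hτ => ((S.pr τ (hs.trans hτ.1.le)).mM hα hγ _).sub ((S.pr s hs).mM hα hγ _))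
    (fun τ hτ => by
      simp only [inv_one, one_mul]
      have := H (Set.mem_Ici.2 (hs.trans hτ.1.le)) (by
        rw [Real.dist_eq, abs_of_pos (by linarith)] at htd
        rw [Real.dist_eq, abs_of_pos (by linarith [hτ.1])]
        linarith [hτ.2])
      rw [Real.dist_eq, sub_zero, abs_of_nonneg (S2_nonneg _)] at this
      exact this.le)).2
  rw [intervalIntegral.integral_const, intervalIntegral.integral_const, smul_eq_mul,
    smul_eq_mul] at hT
  have e : (fun x => (t - s)⁻¹ • (m t x - m s x) - cM α γ (h s) (m s x) (b s x) (c s x)) =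
      fun x => (t - s)⁻¹ • ∫ τ in s..t, (cM α γ (h τ) (m τ x) (b τ x) (c τ x)
      - cM α γ (h s) (m s x) (b s x) (c s x)) := by
    ext1 x
    obtain ⟨h1, h2, h3⟩ := S.slice x
    rw [intervalIntegral.integral_sub, intervalIntegral.integral_const, ← S.ftc hs hst.le,
      smul_sub, smul_sub, smul_sub, smul_smul, inv_mul_cancel₀ (by linarith), one_smul]
    · exact (cont_cM α γ S.ch h1 h2 h3).intervalIntegrable _ _
    · exact intervalIntegrable_const
  rw [e]
  have e2 : ∀ u : ℝ → E3, S2 (fun x => (t - s)⁻¹ • u x) = ((t - s)⁻¹) ^ 2 * S2 u := by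
    intro u
    unfold S2
    rw [← integral_const_mul]
    congr 1; ext x
    rw [norm_smul, mul_pow, Real.norm_eq_abs, sq_abs]
  rw [e2]
  have h0 : 0 < t - s := by linarith
  calc _ ≤ ((t - s)⁻¹) ^ 2 * ((t - s) * 1 * ((t - s) * (ε / 2))) := by gcongr
    _ = ε / 2 := by field_simp
    _ < ε := by linarith

/-- adjoint of the linearised defect between two times -/
def cZ (γ κ : ℝ) (a a' D D' Dx Dx' : E3) : E3 :=
  -(Dx + Dx') - γ • cross3 e1 (D + D')
    + (κ / 2) • ((inner ℝ (a + a') (D + D')) • e1 + ((a + a') 0) • (D + D'))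

lemma Z_pt {γ κ : ℝ} (a a' b b' Dx Dx' : E3) :
    ‖cD γ κ a b‖ ^ 2 - ‖cD γ κ a' b'‖ ^ 2 =
      (inner ℝ (a - a') (Dx + Dx') + inner ℝ (b - b') (cD γ κ a b + cD γ κ a' b'))
      + inner ℝ (a - a') (cZ γ κ a a' (cD γ κ a b) (cD γ κ a' b') Dx Dx') := by
  simp only [nsq, inner3, cZ]
  simp [cD, cF]
  ring

lemma Z_lip {γ κ : ℝ} (hγ : |γ| ≤ 1) (hκ : |κ| ≤ 1) (a a' b b' c c' : E3)
    (ha : ‖a‖ = 1) (ha' : ‖a'‖ = 1) (hab : inner ℝ a b = 0) (hab' : inner ℝ a' b' = 0) :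
    ‖cZ γ κ a a' (cD γ κ a b) (cD γ κ a' b') (cDx γ κ a b c) (cDx γ κ a' b' c')
      - (-2 : ℝ) • cT γ κ a' b' c'‖ ≤ ‖cDx γ κ a b c - cDx γ κ a' b' c'‖ +
      3 * ‖cD γ κ a b - cD γ κ a' b'‖ + 2 * (‖a - a'‖ * ‖cD γ κ a' b'‖) := by
  have i1 := inner_cD (γ := γ) (κ := κ) a b ha hab
  have i2 := inner_cD (γ := γ) (κ := κ) a' b' ha' hab'
  unfold cT
  generalize cDx γ κ a b c = Dx
  generalize cDx γ κ a' b' c' = Dx'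
  generalize cD γ κ a b = D at *
  generalize cD γ κ a' b' = D' at *
  have ei : inner ℝ (a + a') (D + D') = inner ℝ (a - a') D' + inner ℝ a' (D - D') := by
    simp only [inner_add_left, inner_add_right, inner_sub_left, inner_sub_right, i1, i2]
    ring
  have e : cZ γ κ a a' D D' Dx Dx' - (-2 : ℝ) • (Dx' + γ • cross3 e1 D' - (κ * a' 0) • D') =
      -(Dx - Dx') - γ • cross3 e1 (D - D') + κ • ((1 / 2 : ℝ) • ((inner ℝ (a - a') D') • e1
       + (inner ℝ a' (D - D')) • e1) + ((1 / 2 * (a + a') 0) • (D - D') + ((a - a') 0) • D')) := by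
    unfold cZ
    rw [ei]
    apply ext3 <;> simp <;> ring
  rw [e]
  have n1 : ‖γ • cross3 e1 (D - D')‖ ≤ ‖D - D'‖ := (norm_smul_le1 hγ _).trans (norm_cross_e1 _)
  have n2 : ‖(inner ℝ (a - a') D') • e1‖ ≤ ‖a - a'‖ * ‖D'‖ := by
    rw [norm_smul, norm_e1, mul_one]; exact norm_inner_le_norm _ _
  have n3 : ‖(inner ℝ a' (D - D')) • e1‖ ≤ ‖D - D'‖ := by
    rw [norm_smul, norm_e1, mul_one]
    refine (norm_inner_le_norm _ _).trans ?_
    rw [ha', one_mul]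
  have n4 : ‖(1 / 2 * (a + a') 0) • (D - D')‖ ≤ ‖D - D'‖ := by
    apply norm_smul_le1
    have h1 := comp_le1 ha 0
    have h2 := comp_le1 ha' 0
    rw [abs_le] at *
    simp only [PiLp.add_apply]
    constructor <;> linarith
  have n5 : ‖((a - a') 0) • D'‖ ≤ ‖a - a'‖ * ‖D'‖ := by
    rw [norm_smul, Real.norm_eq_abs]
    gcongr
    exact abs_comp_le _ _
  have n6 : ‖(1 / 2 : ℝ) • ((inner ℝ (a - a') D') • e1 + (inner ℝ a' (D - D')) • e1)‖ ≤
      ‖a - a'‖ * ‖D'‖ + ‖D - D'‖ :=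
    (norm_smul_le1 (by norm_num [abs_of_pos]) _).trans ((norm_add_le _ _).trans (add_le_add n2 n3))
  have n7 := (norm_add_le _ _).trans (add_le_add n6 ((norm_add_le _ _).trans (add_le_add n4 n5)))
  have n8 := (norm_smul_le1 hκ _).trans n7
  refine (norm_add_le _ _).trans ((add_le_add (norm_sub_le _ _) n8).trans ?_)
  rw [norm_neg]
  linarith

end Sol

end

section

namespace Sol
variable {α γ : ℝ} {h : ℝ → ℝ} {m b c : ℝ → ℝ → E3}

/-- squared norm of the defect -/
def ff (γ κ : ℝ) (m b : ℝ → ℝ → E3) (t : ℝ) : ℝ := S2 (fun x => cD γ κ (m t x) (b t x))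

/-- dissipation -/
def QQ (γ κ : ℝ) (m b c : ℝ → ℝ → E3) (t : ℝ) : ℝ :=
  S2 (fun x => cross3 (m t x) (cT γ κ (m t x) (b t x) (c t x)))

lemma ff_cont (S : Sol α γ h m b c) (hα : 0 < α) (hγ : |γ| ≤ 1) {κ : ℝ} (hκ : |κ| ≤ 1) :
    ContinuousOn (ff γ κ m b) (Set.Ici 0) :=
  contOn_of_L2to (u := fun t x => cD γ κ (m t x) (b t x)) (fun _ hs => S.D2 hα hγ hκ hs)
    fun t ht => (S.pr t ht).mD hγ hκ

lemma QQ_cont (S : Sol α γ h m b c) (hα : 0 < α) (hγ : |γ| ≤ 1) {κ : ℝ} (hκ : |κ| ≤ 1)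
    (hk : γ ^ 2 + κ ^ 2 = 1) :
    ContinuousOn (QQ γ κ m b c) (Set.Ici 0) :=
  contOn_of_L2to (u := fun t x => cross3 (m t x) (cT γ κ (m t x) (b t x) (c t x)))
    (fun _ hs => S.aT2 hα hγ hκ hk hs) fun t ht => (S.pr t ht).maT hγ hκ

/-- Z field -/
def ZZ (γ κ : ℝ) (m b c : ℝ → ℝ → E3) (s t x : ℝ) : E3 :=
  cZ γ κ (m t x) (m s x) (cD γ κ (m t x) (b t x)) (cD γ κ (m s x) (b s x))
    (cDx γ κ (m t x) (b t x) (c t x)) (cDx γ κ (m s x) (b s x) (c s x))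

lemma ZZ_cont (S : Sol α γ h m b c) {s t : ℝ} (hs : 0 ≤ s) (ht : 0 ≤ t) (κ : ℝ) :
    Continuous (ZZ γ κ m b c s t) := by
  unfold ZZ cZ
  have P := S.pr s hs
  have P' := S.pr t ht
  have a1 := P.ca
  have a2 := P'.ca
  have h1 := cont_cD γ κ P.ca P.cb
  have h2 := cont_cD γ κ P'.ca P'.cb
  have h3 := cont_cDx γ κ P.ca P.cb P.cc
  have h4 := cont_cDx γ κ P'.ca P'.cb P'.cc
  have h5 := cont_cross (continuous_const (y := e1)) (h2.add h1)
  simp only [Pi.add_apply] at h5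
  fun_prop

lemma ZZ_bound (S : Sol α γ h m b c) (hα : 0 < α) (hγ : |γ| ≤ 1) {κ : ℝ} (hκ : |κ| ≤ 1)
    {s : ℝ} (hs : 0 ≤ s) :
    (∀ᶠ t in nhdsWithin s (Set.Ici 0), MemLp (ZZ γ κ m b c s t) 2 volume) ∧
    Tendsto (fun t => S2 (fun x => ZZ γ κ m b c s t x -
      (-2 : ℝ) • cT γ κ (m s x) (b s x) (c s x))) (nhdsWithin s (Set.Ici 0)) (nhds 0) := by
  have mT2 : MemLp (fun x => (-2 : ℝ) • cT γ κ (m s x) (b s x) (c s x)) 2 volume :=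
    ((S.pr s hs).mT hγ hκ).const_smul (-2 : ℝ)
  have hpt : ∀ᶠ t in nhdsWithin s (Set.Ici 0), ∀ x, ‖ZZ γ κ m b c s t x -
      (-2 : ℝ) • cT γ κ (m s x) (b s x) (c s x)‖ ≤
      1 * ‖cDx γ κ (m t x) (b t x) (c t x) - cDx γ κ (m s x) (b s x) (c s x)‖ +
      3 * ‖cD γ κ (m t x) (b t x) - cD γ κ (m s x) (b s x)‖ +
      (2 * dd m b s t) * ‖cD γ κ (m s x) (b s x)‖ := by
    filter_upwards [nonneg_ev s, S.dd_sup hα hγ hs] with t ht h3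
    intro x
    refine (Z_lip hγ hκ _ _ _ _ _ _ ((S.pr t ht).un x) ((S.pr s hs).un x)
      ((S.pr t ht).orth x) ((S.pr s hs).orth x)).trans ?_
    rw [one_mul, mul_assoc 2]
    gcongr
    exact h3 x
  have hmem : ∀ᶠ t in nhdsWithin s (Set.Ici 0), MemLp (fun x => ZZ γ κ m b c s t x -
      (-2 : ℝ) • cT γ κ (m s x) (b s x) (c s x)) 2 volume := by
    filter_upwards [nonneg_ev s, hpt, (S.D2 hα hγ hκ hs).1, (S.Dx2 hα hγ hκ hs).1]
      with t ht h1 h2 h3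
    refine memLp_dom (((h3.norm.const_mul 1).add (h2.norm.const_mul 3)).add
      (((S.pr s hs).mD hγ hκ).norm.const_mul (2 * dd m b s t))) ?_ h1
    exact (S.ZZ_cont hs ht κ).sub
      ((cont_cT γ κ (S.pr s hs).ca (S.pr s hs).cb (S.pr s hs).cc).const_smul (-2 : ℝ))
  constructor
  · filter_upwards [hmem] with t ht
    refine (ht.add mT2).ae_eq (Eventually.of_forall fun x => ?_)
    simp
  · have hb := (((S.Dx2 hα hγ hκ hs).2.const_mul 1).add ((S.D2 hα hγ hκ hs).2.const_mul 3)).add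
      (((S.dd_tends hs).const_mul 2).mul_const (L2norm (fun x => cD γ κ (m s x) (b s x))))
    simp only [mul_zero, add_zero, zero_mul] at hb
    have hb2 := hb.pow 2
    rw [zero_pow (by norm_num)] at hb2
    refine squeeze_zero' (Eventually.of_forall fun t => S2_nonneg _) ?_ hb2
    filter_upwards [hmem, hpt, (S.D2 hα hγ hκ hs).1, (S.Dx2 hα hγ hκ hs).1]
      with t h1 h2 h3 h4
    rw [L2norm_sq h1]
    have := dd_nonneg (m := m) (b := b) s t
    refine pow_le_pow_left₀ (L2norm_nonneg _) ?_ 2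
    exact L2n_dom3 zero_le_one (by norm_num) (by positivity) h4 h3 ((S.pr s hs).mD hγ hκ) h2

lemma ff_diff (S : Sol α γ h m b c) (hγ : |γ| ≤ 1) {κ : ℝ} (hκ : |κ| ≤ 1)
    {s t : ℝ} (hs : 0 ≤ s) (ht : 0 ≤ t) (hq : MemLp (fun x => m t x - m s x) 2 volume)
    (hZ : MemLp (ZZ γ κ m b c s t) 2 volume) :
    ff γ κ m b t - ff γ κ m b s = ∫ x, inner ℝ (m t x - m s x) (ZZ γ κ m b c s t x) := by
  have P := S.pr s hs
  have P' := S.pr t ht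
  have mS : MemLp (fun x => cD γ κ (m t x) (b t x) + cD γ κ (m s x) (b s x)) 2 volume :=
    (P'.mD hγ hκ).add (P.mD hγ hκ)
  have mSx : MemLp (fun x => cDx γ κ (m t x) (b t x) (c t x) + cDx γ κ (m s x) (b s x) (c s x))
    2 volume := (P'.mDx hγ hκ).add (P.mDx hγ hκ)
  have mb : MemLp (fun x => b t x - b s x) 2 volume := P'.mb.sub P.mb
  have i1 := (inner_int hq mSx).add (inner_int mb mS)
  have z : ∫ x, (inner ℝ (m t x - m s x)
      (cDx γ κ (m t x) (b t x) (c t x) + cDx γ κ (m s x) (b s x) (c s x)) +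
      inner ℝ (b t x - b s x) (cD γ κ (m t x) (b t x) + cD γ κ (m s x) (b s x))) = 0 := by
    apply integral_eq_zero_of_hasDerivAt_of_integrable (f := fun x => inner ℝ (m t x - m s x)
      (cD γ κ (m t x) (b t x) + cD γ κ (m s x) (b s x))) _ i1 (inner_int hq mS)
    intro x
    exact ((P'.da x).sub (P.da x)).inner ℝ
      ((deriv_cD γ κ (P'.da x) (P'.db x)).add (deriv_cD γ κ (P.da x) (P.db x)))
  unfold ff S2
  rw [← integral_sub (sq_int (P'.mD hγ hκ)) (sq_int (P.mD hγ hκ))]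
  simp only [fun x => Z_pt (γ := γ) (κ := κ) (m t x) (m s x) (b t x) (b s x)
    (cDx γ κ (m t x) (b t x) (c t x)) (cDx γ κ (m s x) (b s x) (c s x))]
  have e := integral_add i1 (inner_int hq hZ)
  simp only [Pi.add_apply] at e
  rw [z, zero_add] at e
  exact e

lemma ff_deriv (S : Sol α γ h m b c) (hα : 0 < α) (hγ : |γ| ≤ 1) {κ : ℝ} (hκ : |κ| ≤ 1)
    (hk : γ ^ 2 + κ ^ 2 = 1) {s : ℝ} (hs : 0 ≤ s) :
    HasDerivWithinAt (ff γ κ m b) (-2 * (α * QQ γ κ m b c s +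
      α * h s * ∫ x, m s x 0 * ‖cD γ κ (m s x) (b s x)‖ ^ 2)) (Set.Ici s) s := by
  have hle : nhdsWithin s (Set.Ioi s) ≤ nhdsWithin s (Set.Ici 0) :=
    nhdsWithin_mono s fun t (ht : s < t) => hs.trans ht.le
  rw [hasDerivWithinAt_iff_tendsto_slope, Set.Ici_sdiff_left]
  obtain ⟨q1, q2⟩ := S.quot hα hγ hs
  obtain ⟨z1, z2⟩ := S.ZZ_bound hα hγ hκ hs
  have mT2 : MemLp (fun x => (-2 : ℝ) • cT γ κ (m s x) (b s x) (c s x)) 2 volume :=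
    ((S.pr s hs).mT hγ hκ).const_smul (-2 : ℝ)
  have hl := tendsto_inner_int q1 (hle z1) ((S.pr s hs).mM hα hγ (h s)) mT2 q2 (z2.mono_left hle)
  have e := (S.pr s hs).dissip (α := α) (h s) hk hγ hκ
  simp only [inner_smul_right] at hl
  rw [integral_const_mul, e] at hl
  refine hl.congr' ?_
  filter_upwards [hle z1, hle (S.m2 hα hγ hs).1, self_mem_nhdsWithin] with t h1 h2 h3
  rw [slope_def_field, S.ff_diff hγ hκ hs (hs.trans (le_of_lt h3)) h2 h1]
  simp only [real_inner_smul_left]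
  rw [integral_const_mul, div_eq_inv_mul]

lemma ff_nonneg (κ t : ℝ) : 0 ≤ ff γ κ m b t := S2_nonneg _

lemma ff_rate (S : Sol α γ h m b c) (hα : 0 < α) (hγ : |γ| ≤ 1) {κ : ℝ} (hκ : |κ| ≤ 1)
    (hh : ∀ t, |h t| ≤ κ ^ 2 / 8) {s : ℝ} (hs : 0 ≤ s) (hf : ff γ κ m b s ≤ κ ^ 2 / 4) :
    -2 * (α * QQ γ κ m b c s + α * h s * ∫ x, m s x 0 * ‖cD γ κ (m s x) (b s x)‖ ^ 2) ≤
      -(α * QQ γ κ m b c s) - 2 * (α * κ ^ 2 / 8) * ff γ κ m b s := by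
  have P := S.pr s hs
  have h1 : κ ^ 2 / 2 * ff γ κ m b s ≤ QQ γ κ m b c s := P.coer hγ hκ hf
  have h2 : |∫ x, m s x 0 * ‖cD γ κ (m s x) (b s x)‖ ^ 2| ≤ ff γ κ m b s := P.a0_le (P.mD hγ hκ)
  have h3 := ff_nonneg (γ := γ) (m := m) (b := b) κ s
  generalize (∫ x, m s x 0 * ‖cD γ κ (m s x) (b s x)‖ ^ 2) = I at *
  have h4 : -(h s * I) ≤ κ ^ 2 / 8 * ff γ κ m b s := by
    refine (neg_le_abs _).trans ?_
    rw [abs_mul]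
    exact mul_le_mul (hh s) h2 (abs_nonneg _) (by positivity)
  have h5 := mul_le_mul_of_nonneg_left h1 hα.le
  have h6 := mul_le_mul_of_nonneg_left h4 hα.le
  linarith

/-- exponential decay of the defect, with λ = α κ² / 8 -/
lemma ff_decay (S : Sol α γ h m b c) (hα : 0 < α) (hγ : |γ| ≤ 1) {κ : ℝ} (hκ : |κ| ≤ 1)
    (hκ0 : 0 < κ) (hk : γ ^ 2 + κ ^ 2 = 1) (hh : ∀ t, |h t| ≤ κ ^ 2 / 8)
    (h0 : ff γ κ m b 0 ≤ κ ^ 2 / 8) {t : ℝ} (ht : 0 ≤ t) :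
    ff γ κ m b t ≤ ff γ κ m b 0 * Real.exp (-(α * κ ^ 2 / 8) * t) := by
  set l := α * κ ^ 2 / 8 with hl
  have hl0 : 0 < l := by positivity
  have hf0 := ff_nonneg (γ := γ) (m := m) (b := b) κ 0
  have key : ∀ ε ∈ Set.Ioo 0 (κ ^ 2 / 8), ff γ κ m b t ≤
      (ff γ κ m b 0 + ε) * Real.exp (-l * t) := by
    intro ε hε
    have hB : ∀ x, HasDerivAt (fun x => (ff γ κ m b 0 + ε) * Real.exp (-l * x))
        ((ff γ κ m b 0 + ε) * (Real.exp (-l * x) * -l)) x := fun x => by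
      have := ((hasDerivAt_id x).const_mul (-l)).exp.const_mul (ff γ κ m b 0 + ε)
      simpa using this
    refine image_le_of_deriv_right_lt_deriv_boundary' (a := 0) (b := t)
      ((S.ff_cont hα hγ hκ).mono Set.Icc_subset_Ici_self)
      (fun x hx => S.ff_deriv hα hγ hκ hk hx.1) ?_
      (fun x _ => (hB x).continuousAt.continuousWithinAt)
      (fun x _ => (hB x).hasDerivWithinAt) ?_ (Set.right_mem_Icc.2 ht)
    · simp only [mul_zero, Real.exp_zero, mul_one]; linarith [hε.1]
    · intro x hx hfx
      have hexp : Real.exp (-l * x) ≤ 1 := by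
        rw [Real.exp_le_one_iff]; nlinarith [hx.1]
      have hep := Real.exp_pos (-l * x)
      have h1 : ff γ κ m b x ≤ κ ^ 2 / 4 := by
        rw [hfx]
        calc _ ≤ (ff γ κ m b 0 + ε) * 1 := by gcongr; linarith [hε.1]
          _ ≤ _ := by linarith [hε.2]
      refine (S.ff_rate hα hγ hκ hh hx.1 h1).trans_lt ?_
      have hQ : 0 ≤ QQ γ κ m b c x := S2_nonneg _
      have hpos : 0 < ff γ κ m b x := by
        rw [hfx]; exact mul_pos (by linarith [hε.1]) hep
      have e : (ff γ κ m b 0 + ε) * (Real.exp (-l * x) * -l) = -l * ff γ κ m b x := by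
        rw [hfx]; ring
      rw [e]
      nlinarith [mul_pos hl0 hpos, mul_nonneg hα.le hQ]
  have hlim : Tendsto (fun ε => (ff γ κ m b 0 + ε) * Real.exp (-l * t)) (nhdsWithin 0 (Set.Ioi 0))
      (nhds (ff γ κ m b 0 * Real.exp (-l * t))) := by
    have : Continuous fun ε : ℝ => (ff γ κ m b 0 + ε) * Real.exp (-l * t) := by fun_prop
    have := (this.tendsto 0).mono_left (nhdsWithin_le_nhds (s := Set.Ioi 0))
    simpa using this
  refine ge_of_tendsto hlim ?_
  filter_upwards [Ioo_mem_nhdsGT (show (0:ℝ) < κ ^ 2 / 8 by positivity)] with ε hε using key ε hε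

/-- integrated dissipation -/
lemma int_decay (S : Sol α γ h m b c) (hα : 0 < α) (hγ : |γ| ≤ 1) {κ : ℝ} (hκ : |κ| ≤ 1)
    (hκ0 : 0 < κ) (hk : γ ^ 2 + κ ^ 2 = 1) (hh : ∀ t, |h t| ≤ κ ^ 2 / 8)
    (h0 : ff γ κ m b 0 ≤ κ ^ 2 / 8) {s t : ℝ} (hs : 0 ≤ s) (hst : s ≤ t) :
    ∫ τ in s..t, Real.exp ((α * κ ^ 2 / 8) * τ) *
      (α * QQ γ κ m b c τ + (α * κ ^ 2 / 8) * ff γ κ m b τ) ≤ ff γ κ m b 0 := by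
  set l := α * κ ^ 2 / 8 with hl
  have hl0 : 0 < l := by positivity
  have cf := (S.ff_cont hα hγ hκ)
  have cQ := (S.QQ_cont hα hγ hκ hk)
  have hsub : Set.Icc s t ⊆ Set.Ici 0 := fun x hx => hs.trans hx.1
  have hdec : ∀ x, 0 ≤ x → Real.exp (l * x) * ff γ κ m b x ≤ ff γ κ m b 0 := by
    intro x hx
    have := S.ff_decay hα hγ hκ hκ0 hk hh h0 hx
    have h2 := mul_le_mul_of_nonneg_left this (Real.exp_pos (l * x)).le
    refine h2.trans (le_of_eq ?_)
    rw [mul_left_comm, ← Real.exp_add]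
    simp [hl]
  have hE : ∀ x, HasDerivAt (fun x => Real.exp (l * x)) (Real.exp (l * x) * l) x := fun x => by
    have := ((hasDerivAt_id x).const_mul l).exp
    simpa using this
  have key := intervalIntegral.sub_le_integral_of_hasDeriv_right_of_le hst
    (g := fun x => Real.exp (l * x) * ff γ κ m b x)
    (g' := fun x => Real.exp (l * x) * l * ff γ κ m b x + Real.exp (l * x) *
      (-2 * (α * QQ γ κ m b c x + α * h x * ∫ y, m x y 0 * ‖cD γ κ (m x y) (b x y)‖ ^ 2)))
    (φ := fun x => -(Real.exp (l * x) * (α * QQ γ κ m b c x + l * ff γ κ m b x)))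
    (by have := cf.mono hsub; fun_prop)
    (fun x hx => (hE x).hasDerivWithinAt.mul
      ((S.ff_deriv hα hγ hκ hk (hs.trans hx.1.le)).mono Set.Ioi_subset_Ici_self))
    (by
      apply ContinuousOn.integrableOn_Icc
      have := cf.mono hsub; have := cQ.mono hsub; fun_prop)
    (fun x hx => by
      have hx0 : 0 ≤ x := hs.trans hx.1.le
      have hfx : ff γ κ m b x ≤ κ ^ 2 / 4 := by
        have h1 := hdec x hx0
        have h2 : 1 ≤ Real.exp (l * x) := Real.one_le_exp (by positivity)
        have h3 := ff_nonneg (γ := γ) (m := m) (b := b) κ x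
        nlinarith
      have := mul_le_mul_of_nonneg_left (S.ff_rate hα hγ hκ hh hx0 hfx) (Real.exp_pos (l * x)).le
      rw [← hl] at this
      simp only
      generalize (∫ y, m x y 0 * ‖cD γ κ (m x y) (b x y)‖ ^ 2) = I at *
      nlinarith [this])
  rw [intervalIntegral.integral_neg] at key
  have h1 := hdec s hs
  have h2 : 0 ≤ Real.exp (l * t) * ff γ κ m b t := mul_nonneg (Real.exp_pos _).le (ff_nonneg κ t)
  linarith

end Sol

end

section

lemma rot_eq (φ : ℝ) (v : E3) :
    rot φ v = Real.cos φ • v + ((1 - Real.cos φ) * v 0) • e1 + Real.sin φ • cross3 e1 v := by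
  apply ext3 <;> simp <;> ring

lemma rot_sub (φ : ℝ) (v w : E3) : rot φ (v - w) = rot φ v - rot φ w := by
  apply ext3 <;> simp <;> ring
lemma rot_add (φ : ℝ) (v w : E3) : rot φ (v + w) = rot φ v + rot φ w := by
  apply ext3 <;> simp <;> ring
lemma rot_smul (φ r : ℝ) (v : E3) : rot φ (r • v) = r • rot φ v := by
  apply ext3 <;> simp <;> ring
lemma rot_rot (φ ψ : ℝ) (v : E3) : rot φ (rot ψ v) = rot (φ + ψ) v := by
  apply ext3 <;> simp [Real.cos_add, Real.sin_add] <;> ring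
lemma rot_zero (v : E3) : rot 0 v = v := by
  apply ext3 <;> simp
lemma norm_rot (φ : ℝ) (v : E3) : ‖rot φ v‖ = ‖v‖ := by
  have h : ‖rot φ v‖ ^ 2 = ‖v‖ ^ 2 := by
    rw [nsq, nsq]
    simp
    linear_combination (v 1 ^ 2 + v 2 ^ 2) * Real.sin_sq_add_cos_sq φ
  exact (pow_left_inj₀ (norm_nonneg _) (norm_nonneg _) two_ne_zero).1 h
lemma rot_e1 (φ : ℝ) : rot φ e1 = e1 := by
  apply ext3 <;> simp
lemma rot_cF (φ : ℝ) (v : E3) : rot φ (cF v) = cF (rot φ v) := by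
  simp only [cF, rot_sub, rot_smul, rot_e1, rot_0]
lemma rot_cross (φ : ℝ) (v : E3) : rot φ (cross3 e1 v) = cross3 e1 (rot φ v) := by
  apply ext3 <;> simp <;> ring
lemma rot_cD (γ κ φ : ℝ) (a b : E3) : rot φ (cD γ κ a b) = cD γ κ (rot φ a) (rot φ b) := by
  simp only [cD, rot_sub, rot_add, rot_smul, rot_cF, rot_cross]

lemma cont_rot {X : Type*} [TopologicalSpace X] {f : X → ℝ} {g : X → E3} (hf : Continuous f)
    (hg : Continuous g) : Continuous fun p => rot (f p) (g p) := by
  unfold rot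
  fun_prop

lemma deriv_rot {f : ℝ → ℝ} {f' : ℝ} {g : ℝ → E3} {g' : E3} {x : ℝ} (hf : HasDerivAt f f' x)
    (hg : HasDerivAt g g' x) :
    HasDerivAt (fun p => rot (f p) (g p)) (rot (f x) (g' + f' • cross3 e1 (g x))) x := by
  simp only [rot_eq]
  have h := ((hf.cos.smul hg).add (((hf.cos.const_sub 1).mul (deriv_comp3 hg 0)).smul_const e1)).add
    (hf.sin.smul (deriv_cross hg))
  refine h.congr_deriv ?_
  apply ext3 <;> simp <;> ring

lemma deriv_rot' (φ : ℝ) {g : ℝ → E3} {g' : E3} {x : ℝ} 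
    (hg : HasDerivAt g g' x) :
    HasDerivAt (fun p => rot φ (g p)) (rot φ g') x := by
  have := deriv_rot (hasDerivAt_const x φ) hg
  simpa using this

/-- translation and rotation invariance -/
lemma S2_trans {E : Type*} [NormedAddCommGroup E] (u : ℝ → E) (y : ℝ) :
    S2 (fun x => u (x + y)) = S2 u :=
  integral_add_right_eq_self (fun x => ‖u x‖ ^ 2) y

lemma mem_trans {E : Type*} [NormedAddCommGroup E] {u : ℝ → E} (hu : MemLp u 2 volume) (y : ℝ) :
    MemLp (fun x => u (x + y)) 2 volume :=
  hu.comp_measurePreserving (measurePreserving_add_right volume y)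

lemma S2_rot (φ : ℝ) (u : ℝ → E3) : S2 (fun x => rot φ (u x)) = S2 u := by
  simp only [S2, norm_rot]

lemma mem_rot (φ : ℝ) {u : ℝ → E3} (hu : MemLp u 2 volume) :
    MemLp (fun x => rot φ (u x)) 2 volume := by
  refine hu.of_le ((cont_rot continuous_const continuous_id).comp_aestronglyMeasurable hu.1) ?_
  exact Eventually.of_forall fun x => (norm_rot φ _).le

namespace Sol
variable {α γ : ℝ} {h : ℝ → ℝ} {m b c : ℝ → ℝ → E3}

/-- position of the wall -/
def YY (α κ : ℝ) (h : ℝ → ℝ) (t : ℝ) : ℝ := -(α / κ) * ∫ τ in (0:ℝ)..t, h τ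
/-- angle of the wall -/
def PH (α γ κ : ℝ) (h : ℝ → ℝ) (t : ℝ) : ℝ := (-1 + α * γ / κ) * ∫ τ in (0:ℝ)..t, h τ

lemma YY_deriv (S : Sol α γ h m b c) (κ t : ℝ) : HasDerivAt (YY α κ h) (-(α / κ) * h t) t :=
  (S.ch.integral_hasStrictDerivAt 0 t).hasDerivAt.const_mul _
lemma PH_deriv (S : Sol α γ h m b c) (κ t : ℝ) :
    HasDerivAt (PH α γ κ h) ((-1 + α * γ / κ) * h t) t :=
  (S.ch.integral_hasStrictDerivAt 0 t).hasDerivAt.const_mul _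
lemma YY_cont (S : Sol α γ h m b c) (κ : ℝ) : Continuous (YY α κ h) :=
  continuous_iff_continuousAt.2 fun t => (S.YY_deriv κ t).continuousAt
lemma PH_cont (S : Sol α γ h m b c) (κ : ℝ) : Continuous (PH α γ κ h) :=
  continuous_iff_continuousAt.2 fun t => (S.PH_deriv κ t).continuousAt

lemma strict (S : Sol α γ h m b c) {t : ℝ} (ht : 0 < t) {y : ℝ → ℝ} {y' : ℝ}
    (hy : HasDerivAt y y' t) :
    HasDerivAt (fun τ => m τ (y τ))
      (cM α γ (h t) (m t (y t)) (b t (y t)) (c t (y t)) + y' • b t (y t)) t := by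
  have cM' : Continuous (fun p : ℝ × ℝ => cM α γ (h p.1) (m p.1 p.2) (b p.1 p.2) (c p.1 p.2)) :=
    cont_cM α γ (S.ch.comp continuous_fst) S.cm S.cb S.cc
  have hev : ∀ᶠ v : ℝ × ℝ in nhds (t, y t), 0 < v.1 :=
    continuous_fst.continuousAt.eventually (lt_mem_nhds ht)
  have key := hasStrictFDerivAt_uncurry_coprod (𝕜 := ℝ) (u := (t, y t)) (f := m)
    (f₁ := fun t x => ContinuousLinearMap.toSpanSingleton ℝ (cM α γ (h t) (m t x) (b t x) (c t x)))
    (f₂ := fun t x => ContinuousLinearMap.toSpanSingleton ℝ (b t x))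
    (by filter_upwards [hev] with v hv using (S.dt v.1 hv.le v.2).hasFDerivAt)
    (by filter_upwards [hev] with v hv using ((S.pr v.1 hv.le).da v.2).hasFDerivAt)
    (by
      refine Continuous.continuousAt ?_
      exact (ContinuousLinearMap.toSpanSingletonCLE (𝕜 := ℝ) (E := E3)).continuous.comp cM')
    (by
      refine Continuous.continuousAt ?_
      exact (ContinuousLinearMap.toSpanSingletonCLE (𝕜 := ℝ) (E := E3)).continuous.comp S.cb)
  have h2 := key.hasFDerivAt.comp_hasDerivAt t ((hasDerivAt_id t).prodMk hy)
  refine h2.congr_deriv ?_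
  simp [Function.HasUncurry.uncurry]

/-- moving frame -/
def VV (α γ κ : ℝ) (h : ℝ → ℝ) (m : ℝ → ℝ → E3) (t x : ℝ) : E3 :=
  rot (-PH α γ κ h t) (m t (x + YY α κ h t))

/-- velocity in the moving frame -/
def GG (α γ κ : ℝ) (h : ℝ → ℝ) (m b c : ℝ → ℝ → E3) (t x : ℝ) : E3 :=
  rot (-PH α γ κ h t) (cG α γ κ (h t) (m t (x + YY α κ h t)) (b t (x + YY α κ h t))
    (c t (x + YY α κ h t)))

lemma VV_deriv (S : Sol α γ h m b c) {κ : ℝ} (hκ0 : κ ≠ 0) (hk : γ ^ 2 + κ ^ 2 = 1) {t : ℝ}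
    (ht : 0 < t) (x : ℝ) :
    HasDerivAt (fun τ => VV α γ κ h m τ x) (GG α γ κ h m b c t x) t := by
  have h1 := S.strict ht (y := fun τ => x + YY α κ h τ) ((S.YY_deriv κ t).const_add x)
  have h2 := deriv_rot (S.PH_deriv κ t).neg h1
  refine h2.congr_deriv ?_
  unfold GG
  congr 1
  rw [cM_eq hκ0 hk _ _ _ ((S.pr t ht.le).un _)]
  have : α * h t / κ = α / κ * h t := by ring
  rw [this]
  module

lemma shift_cont (S : Sol α γ h m b c) {u : ℝ → ℝ → E3}
    (hu : Continuous (fun p : ℝ × ℝ => u p.1 p.2)) (κ : ℝ) :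
    Continuous (fun p : ℝ × ℝ => u p.1 (p.2 + YY α κ h p.1)) := by
  have := S.YY_cont κ
  exact hu.comp (by fun_prop : Continuous fun p : ℝ × ℝ => (p.1, p.2 + YY α κ h p.1))

lemma VV_cont (S : Sol α γ h m b c) (κ : ℝ) :
    Continuous (fun p : ℝ × ℝ => VV α γ κ h m p.1 p.2) :=
  cont_rot ((S.PH_cont κ).comp continuous_fst).neg (S.shift_cont S.cm κ)

lemma GG_cont (S : Sol α γ h m b c) (κ : ℝ) :
    Continuous (fun p : ℝ × ℝ => GG α γ κ h m b c p.1 p.2) :=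
  cont_rot ((S.PH_cont κ).comp continuous_fst).neg
    (cont_cG α γ κ (S.ch.comp continuous_fst) (S.shift_cont S.cm κ)
      (S.shift_cont S.cb κ) (S.shift_cont S.cc κ))

lemma VV_ftc (S : Sol α γ h m b c) {κ : ℝ} (hκ0 : κ ≠ 0) (hk : γ ^ 2 + κ ^ 2 = 1) {s t : ℝ}
    (hs : 0 ≤ s) (hst : s ≤ t) (x : ℝ) :
    VV α γ κ h m t x - VV α γ κ h m s x = ∫ τ in s..t, GG α γ κ h m b c τ x := by
  have e : Continuous (fun t : ℝ => (t, x)) := by fun_prop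
  symm
  apply intervalIntegral.integral_eq_sub_of_hasDerivAt_of_le hst
  · exact ((S.VV_cont κ).comp e).continuousOn
  · intro τ hτ
    exact S.VV_deriv hκ0 hk (hs.trans_lt hτ.1) x
  · exact ((S.GG_cont κ).comp e).intervalIntegrable _ _

lemma cG_bound (S : Sol α γ h m b c) (hα : 0 < α) (hγ : |γ| ≤ 1) {κ : ℝ} (hκ : |κ| ≤ 1)
    (hκ0 : 0 < κ) (hh : ∀ t, |h t| ≤ κ ^ 2 / 8) {t : ℝ} (ht : 0 ≤ t) :
    MemLp (GG α γ κ h m b c t) 2 volume ∧ S2 (GG α γ κ h m b c t) ≤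
      (2 * (1 + α ^ 2) / α + α) * (α * QQ γ κ m b c t + (α * κ ^ 2 / 8) * ff γ κ m b t) := by
  have P := S.pr t ht
  have mT := P.maT hγ hκ (κ := κ)
  have mD := P.mD hγ hκ (κ := κ)
  set u : ℝ → E3 := fun x => cG α γ κ (h t) (m t x) (b t x) (c t x) with hu
  have hb : ∀ x, ‖u x‖ ^ 2 ≤ 2 * (1 + α ^ 2) * ‖cross3 (m t x) (cT γ κ (m t x) (b t x) (c t x))‖ ^ 2
      + 2 * (α * h t / κ) ^ 2 * ‖cD γ κ (m t x) (b t x)‖ ^ 2 := fun x => cG_sq _ _ _ _ _ _ _ (P.un x)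
  have cu : Continuous u := cont_cG α γ κ continuous_const P.ca P.cb P.cc
  have mu : MemLp u 2 volume := by
    rw [memLp_two_iff_integrable_sq_norm cu.aestronglyMeasurable]
    refine (((sq_int mT).const_mul (2 * (1 + α ^ 2))).add
      ((sq_int mD).const_mul (2 * (α * h t / κ) ^ 2))).mono' (by fun_prop) ?_
    refine Eventually.of_forall fun x => ?_
    rw [Real.norm_of_nonneg (by positivity)]
    exact hb x
  have e1 : GG α γ κ h m b c t = fun x => rot (-PH α γ κ h t) (u (x + YY α κ h t)) := rfl
  refine ⟨e1 ▸ mem_rot _ (mem_trans mu _), ?_⟩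
  rw [e1, S2_rot (-PH α γ κ h t) (fun x => u (x + YY α κ h t)), S2_trans]
  refine (S2_le_sum2 mT mD hb).trans ?_
  have hQ : 0 ≤ QQ γ κ m b c t := S2_nonneg _
  have hf := ff_nonneg (γ := γ) (m := m) (b := b) κ t
  have e2 : (α * h t / κ) ^ 2 ≤ α ^ 2 * κ ^ 2 / 64 := by
    have : (h t) ^ 2 ≤ (κ ^ 2 / 8) ^ 2 := sq_le_sq' (abs_le.1 (hh t)).1 (abs_le.1 (hh t)).2
    rw [div_pow, mul_pow, div_le_iff₀ (by positivity)]
    calc _ ≤ α ^ 2 * (κ ^ 2 / 8) ^ 2 := by gcongr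
      _ = _ := by ring
  change 2 * (1 + α ^ 2) * QQ γ κ m b c t + 2 * (α * h t / κ) ^ 2 * ff γ κ m b t ≤ _
  have e3 : (2 * (1 + α ^ 2) / α + α) * (α * QQ γ κ m b c t + (α * κ ^ 2 / 8) * ff γ κ m b t)
    = 2 * (1 + α ^ 2) * QQ γ κ m b c t + α ^ 2 * QQ γ κ m b c t +
      (2 * (1 + α ^ 2) * (κ ^ 2 / 8) + α ^ 2 * κ ^ 2 / 8) * ff γ κ m b t := by
    field_simp
  rw [e3]
  have e4 : 2 * (α * h t / κ) ^ 2 * ff γ κ m b t ≤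
      (2 * (1 + α ^ 2) * (κ ^ 2 / 8) + α ^ 2 * κ ^ 2 / 8) * ff γ κ m b t := by
    gcongr
    nlinarith [sq_nonneg κ, mul_nonneg (sq_nonneg α) (sq_nonneg κ)]
  have := mul_nonneg (sq_nonneg α) hQ
  linarith

/-- constant for the L² Cauchy estimate -/
def KA (α κ : ℝ) : ℝ := (2 * (1 + α ^ 2) / α + α) / (α * κ ^ 2 / 8)

lemma VV_cauchy (S : Sol α γ h m b c) (hα : 0 < α) (hγ : |γ| ≤ 1) {κ : ℝ} (hκ : |κ| ≤ 1)
    (hκ0 : 0 < κ) (hk : γ ^ 2 + κ ^ 2 = 1) (hh : ∀ t, |h t| ≤ κ ^ 2 / 8)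
    (h0 : ff γ κ m b 0 ≤ κ ^ 2 / 8) {s t : ℝ} (hs : 0 ≤ s) (hst : s < t) :
    MemLp (fun x => VV α γ κ h m t x - VV α γ κ h m s x) 2 volume ∧
    S2 (fun x => VV α γ κ h m t x - VV α γ κ h m s x) ≤
      KA α κ * (ff γ κ m b 0 * Real.exp (-(α * κ ^ 2 / 8) * s)) := by
  simp only [S.VV_ftc hκ0.ne' hk hs hst.le]
  set l := α * κ ^ 2 / 8 with hl
  have hl0 : 0 < l := by positivity
  set K := 2 * (1 + α ^ 2) / α + α with hK
  have hK0 : 0 < K := by positivity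
  have hsub : Set.uIcc s t ⊆ Set.Ici 0 := by
    rw [Set.uIcc_of_le hst.le]; exact fun x hx => hs.trans hx.1
  have key := tonelli hst (g := GG α γ κ h m b c) (ω := fun τ => Real.exp (-l * τ))
    (β := fun τ => K * (Real.exp (l * τ) * (α * QQ γ κ m b c τ + l * ff γ κ m b τ)))
    (S.GG_cont κ) (by fun_prop) (fun τ => Real.exp_pos _)
    (by
      apply ContinuousOn.intervalIntegrable
      have := (S.ff_cont hα hγ hκ).mono hsub
      have := (S.QQ_cont hα hγ hκ hk).mono hsub
      fun_prop)
    (fun τ hτ => (S.cG_bound hα hγ hκ hκ0 hh (hs.trans hτ.1.le)).1)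
    (fun τ hτ => by
      have := (S.cG_bound hα hγ hκ hκ0 hh (hs.trans hτ.1.le)).2
      rw [← Real.exp_neg, neg_mul, neg_neg]
      have h2 := mul_le_mul_of_nonneg_left this (Real.exp_pos (l * τ)).le
      refine h2.trans (le_of_eq ?_)
      ring)
  refine ⟨key.1, key.2.trans ?_⟩
  rw [intervalIntegral.integral_const_mul]
  have h1 := S.int_decay hα hγ hκ hκ0 hk hh h0 hs hst.le
  rw [← hl] at h1
  have h2 : ∫ τ in s..t, Real.exp (-l * τ) ≤ Real.exp (-l * s) / l := by
    have hd : ∀ x ∈ Set.uIcc s t, HasDerivAt (fun τ => -(Real.exp (-l * τ) / l)) (Real.exp (-l * x)) x := by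
      intro x _
      have := (((hasDerivAt_id x).const_mul (-l)).exp.div_const l).neg
      refine this.congr_deriv ?_
      simp
      field_simp
    rw [intervalIntegral.integral_eq_sub_of_hasDerivAt hd
      (Continuous.intervalIntegrable (by fun_prop) _ _), sub_neg_eq_add, neg_add_eq_sub, ← sub_div]
    rw [div_le_div_iff_of_pos_right hl0]
    linarith [Real.exp_pos (-l * t)]
  have h3 : 0 ≤ ∫ τ in s..t, Real.exp (-l * τ) :=
    intervalIntegral.integral_nonneg hst.le fun _ _ => (Real.exp_pos _).le
  have hf := ff_nonneg (γ := γ) (m := m) (b := b) κ 0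
  calc _ ≤ (∫ τ in s..t, Real.exp (-l * τ)) * (K * ff γ κ m b 0) := by gcongr
    _ ≤ (Real.exp (-l * s) / l) * (K * ff γ κ m b 0) := by gcongr
    _ = _ := by rw [KA]; ring

end Sol

end

section

lemma deriv_diff {γ κ : ℝ} (hγ : |γ| ≤ 1) (hκ : |κ| ≤ 1) (a a' b b' : E3) (ha : ‖a‖ = 1)
    (ha' : ‖a'‖ = 1) :
    ‖b - b'‖ ≤ 3 * ‖a - a'‖ + ‖cD γ κ a b - cD γ κ a' b'‖ := by
  have e : b - b' = (cD γ κ a b - cD γ κ a' b') - γ • cross3 e1 (a - a') + κ • (cF a - cF a') := by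
    simp only [cD, cross3_sub_right, smul_sub]; abel
  have h1 : ‖γ • cross3 e1 (a - a')‖ ≤ ‖a - a'‖ :=
    (norm_smul_le1 hγ _).trans (norm_cross_e1 _)
  have h2 : ‖κ • (cF a - cF a')‖ ≤ 2 * ‖a - a'‖ :=
    (norm_smul_le1 hκ _).trans (cF_lip a a' ha ha')
  rw [e]
  refine (norm_add_le _ _).trans ?_
  have := norm_sub_le (cD γ κ a b - cD γ κ a' b') (γ • cross3 e1 (a - a'))
  linarith

/-- monotone weighted Gronwall -/
lemma gron {ψ ψ' d : ℝ → ℝ} (hd : ∀ x, HasDerivAt ψ (ψ' x) x) (hdc : Continuous d)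
    (hd0 : ∀ x, 0 ≤ d x)
    (hψ : ∀ x, 0 ≤ ψ x)
    (hdi : Integrable d) (hb : ∀ x, |ψ' x| ≤ 7 * ψ x + d x) {x : ℝ} (hx : 0 ≤ x) :
    ψ x ≤ Real.exp (7 * x) * (ψ 0 + ∫ y, d y) := by
  have hI : ∀ x, HasDerivAt (fun x => ∫ y in (0:ℝ)..x, d y) (d x) x := fun x =>
    (hdc.integral_hasStrictDerivAt 0 x).hasDerivAt
  have hE : ∀ x, HasDerivAt (fun x => Real.exp (-7 * x)) (Real.exp (-7 * x) * -7) x := fun x => by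
    have := ((hasDerivAt_id x).const_mul (-7)).exp
    simpa using this
  have hG : ∀ x, HasDerivAt (fun x => Real.exp (-7 * x) * ψ x - ∫ y in (0:ℝ)..x, d y)
      (Real.exp (-7 * x) * -7 * ψ x + Real.exp (-7 * x) * ψ' x - d x) x := fun x =>
    ((hE x).mul (hd x)).sub (hI x)
  have hA : AntitoneOn (fun x => Real.exp (-7 * x) * ψ x - ∫ y in (0:ℝ)..x, d y) (Set.Ici 0) := by
    apply antitoneOn_of_deriv_nonpos (convex_Ici 0)
    · exact fun x _ => (hG x).continuousAt.continuousWithinAt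
    · exact fun x _ => (hG x).differentiableAt.differentiableWithinAt
    · intro x hx
      rw [interior_Ici] at hx
      rw [(hG x).deriv]
      have h1 := (le_abs_self _).trans (hb x)
      have h2 : Real.exp (-7 * x) ≤ 1 := by
        rw [Real.exp_le_one_iff]; linarith [Set.mem_Ioi.1 hx]
      have h3 := Real.exp_pos (-7 * x)
      nlinarith [hd0 x]
  have h := hA (Set.mem_Ici.2 le_rfl) hx hx
  simp only [mul_zero, Real.exp_zero, one_mul, intervalIntegral.integral_same, sub_zero] at h
  have hdint : ∫ y in (0:ℝ)..x, d y ≤ ∫ y, d y := by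
    rw [intervalIntegral.integral_of_le hx]
    exact setIntegral_le_integral hdi (Eventually.of_forall hd0)
  have e : Real.exp (7 * x) * Real.exp (-7 * x) = 1 := by rw [← Real.exp_add]; simp
  calc ψ x = Real.exp (7 * x) * (Real.exp (-7 * x) * ψ x) := by rw [← mul_assoc, e, one_mul]
    _ ≤ _ := by gcongr; linarith

lemma gron2 {ψ ψ' d : ℝ → ℝ} (hd : ∀ x, HasDerivAt ψ (ψ' x) x) (hdc : Continuous d)
    (hd0 : ∀ x, 0 ≤ d x)
    (hψ : ∀ x, 0 ≤ ψ x)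
    (hdi : Integrable d) (hb : ∀ x, |ψ' x| ≤ 7 * ψ x + d x) (x : ℝ) :
    ψ x ≤ Real.exp (7 * |x|) * (ψ 0 + ∫ y, d y) := by
  rcases le_total 0 x with hx | hx
  · rw [abs_of_nonneg hx]; exact gron hd hdc hd0 hψ hdi hb hx
  · rw [abs_of_nonpos hx]
    have h1 : ∀ x, HasDerivAt (fun x => ψ (-x)) (-ψ' (-x)) x := fun x => by
      have := (hd (-x)).scomp x (hasDerivAt_neg x)
      simpa [Function.comp_def] using this
    have := gron h1 (hdc.comp continuous_neg) (fun x => hd0 (-x)) (fun x => hψ (-x)) hdi.comp_neg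
      (fun x => by rw [abs_neg]; exact hb (-x)) (x := -x) (by linarith)
    simp only [neg_neg, neg_zero, Function.comp_def] at this
    rwa [integral_neg_eq_self] at this

/-- a trajectory in the moving frame -/
structure Fr (γ κ l A F : ℝ) (V Vx : ℝ → ℝ → E3) : Prop where
  un : ∀ t, 0 ≤ t → ∀ x, ‖V t x‖ = 1
  dx : ∀ t, 0 ≤ t → ∀ x, HasDerivAt (V t) (Vx t x) x
  cx : ∀ t, 0 ≤ t → Continuous (Vx t)
  mD : ∀ t, 0 ≤ t → MemLp (fun x => cD γ κ (V t x) (Vx t x)) 2 volume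
  sD : ∀ t, 0 ≤ t → S2 (fun x => cD γ κ (V t x) (Vx t x)) ≤ F * Real.exp (-l * t)
  mV : ∀ s t, 0 ≤ s → s < t → MemLp (fun x => V t x - V s x) 2 volume
  sV : ∀ s t, 0 ≤ s → s < t → S2 (fun x => V t x - V s x) ≤ A * (F * Real.exp (-l * s))

namespace Fr
variable {γ κ l A F : ℝ} {V Vx : ℝ → ℝ → E3}

lemma F0 (R : Fr γ κ l A F V Vx) : 0 ≤ F := by
  have := (S2_nonneg _).trans (R.sD 0 le_rfl)
  simpa using this

lemma at0 (R : Fr γ κ l A F V Vx) (hγ : |γ| ≤ 1) (hκ : |κ| ≤ 1) (hl : 0 < l) {s t : ℝ} (hs : 0 ≤ s) (hst : s < t) (x : ℝ) :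
    ‖V t x - V s x‖ ^ 2 ≤ (28 * A + 6) * (F * Real.exp (-l * s)) := by
  have ht := hs.trans hst.le
  have mq := R.mV s t hs hst
  have hb : ∀ x, ‖Vx t x - Vx s x‖ ≤ 3 * ‖V t x - V s x‖ + ‖cD γ κ (V t x) (Vx t x)‖ +
      ‖cD γ κ (V s x) (Vx s x)‖ := fun x => by
    have h1 := deriv_diff hγ hκ (V t x) (V s x) (Vx t x) (Vx s x) (R.un t ht x) (R.un s hs x)
    have h2 := norm_sub_le (cD γ κ (V t x) (Vx t x)) (cD γ κ (V s x) (Vx s x))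
    linarith
  have mb : MemLp (fun x => Vx t x - Vx s x) 2 volume :=
    memLp_dom (((mq.norm.const_mul 3).add (R.mD t ht).norm).add (R.mD s hs).norm)
      ((R.cx t ht).sub (R.cx s hs)) hb
  have h1 : ‖V t x - V s x‖ ^ 2 ≤ S2 (fun x => V t x - V s x) + S2 (fun x => Vx t x - Vx s x) :=
    sup_sq_le (fun x => (R.dx t ht x).sub (R.dx s hs x)) mq mb x
  have mm : MemLp (fun x => ‖cD γ κ (V t x) (Vx t x)‖ + ‖cD γ κ (V s x) (Vx s x)‖) 2 volume :=
    (R.mD t ht).norm.add (R.mD s hs).norm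
  have h2 : S2 (fun x => Vx t x - Vx s x) ≤ 27 * S2 (fun x => V t x - V s x) +
      (3/2) * S2 (fun x => ‖cD γ κ (V t x) (Vx t x)‖ + ‖cD γ κ (V s x) (Vx s x)‖) := by
    apply S2_le_sum2 mq mm
    intro x
    have h3 := hb x
    have h4 : ‖Vx t x - Vx s x‖ ^ 2 ≤ (3 * ‖V t x - V s x‖ + ‖cD γ κ (V t x) (Vx t x)‖ +
      ‖cD γ κ (V s x) (Vx s x)‖) ^ 2 := by gcongr
    refine h4.trans ?_
    rw [Real.norm_of_nonneg (by positivity)]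
    nlinarith [sq_nonneg (6 * ‖V t x - V s x‖ - (‖cD γ κ (V t x) (Vx t x)‖ +
      ‖cD γ κ (V s x) (Vx s x)‖))]
  have h3 : S2 (fun x => ‖cD γ κ (V t x) (Vx t x)‖ + ‖cD γ κ (V s x) (Vx s x)‖) ≤
      2 * S2 (fun x => cD γ κ (V t x) (Vx t x)) + 2 * S2 (fun x => cD γ κ (V s x) (Vx s x)) := by
    apply S2_le_sum2 (R.mD t ht) (R.mD s hs)
    intro x
    rw [Real.norm_of_nonneg (by positivity)]
    nlinarith [sq_nonneg (‖cD γ κ (V t x) (Vx t x)‖ - ‖cD γ κ (V s x) (Vx s x)‖)]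
  have h4 := R.sD t ht
  have h5 := R.sD s hs
  have h6 := R.sV s t hs hst
  have h7 : F * Real.exp (-l * t) ≤ F * Real.exp (-l * s) := by
    have := R.F0
    have : -l * t ≤ -l * s := by nlinarith
    gcongr
  linarith

lemma lim (R : Fr γ κ l A F V Vx) (hγ : |γ| ≤ 1) (hκ : |κ| ≤ 1) (hl : 0 < l) (hA : 0 ≤ A) :
    ∃ p : E3, Tendsto (fun n : ℕ => V n 0) atTop (nhds p) ∧ ‖p‖ = 1 ∧
      ‖p - V 0 0‖ ^ 2 ≤ (28 * A + 6) * F := by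
  have hF := R.F0
  have hc : CauchySeq (fun n : ℕ => V n 0) := by
    apply cauchySeq_of_le_tendsto_0 (fun n : ℕ => √((28 * A + 6) * (F * Real.exp (-l * n))))
    · have key : ∀ n k N : ℕ, N ≤ n → n < k →
        dist (V n 0) (V k 0) ≤ √((28 * A + 6) * (F * Real.exp (-l * N))) := by
        intro n k N h1 h2
        rw [dist_comm, dist_eq_norm]
        apply Real.le_sqrt_of_sq_le
        refine (R.at0 hγ hκ hl (Nat.cast_nonneg n) (Nat.cast_lt.2 h2) 0).trans ?_
        have : -l * (n:ℝ) ≤ -l * (N:ℝ) := by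
          have : (N:ℝ) ≤ n := Nat.cast_le.2 h1
          nlinarith
        gcongr
      intro n k N h1 h2
      rcases lt_trichotomy n k with h | h | h
      · exact key n k N h1 h
      · rw [h, dist_self]; positivity
      · rw [dist_comm]; exact key k n N h2 h
    · have h1 : Tendsto (fun n : ℕ => -l * (n:ℝ)) atTop atBot :=
        tendsto_natCast_atTop_atTop.const_mul_atTop_of_neg (by linarith)
      have h2 := Real.tendsto_exp_atBot.comp h1
      have h3 := (((h2.const_mul F).const_mul (28 * A + 6))).sqrt
      simpa [Function.comp_def] using h3
  obtain ⟨p, hp⟩ := cauchySeq_tendsto_of_complete hc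
  refine ⟨p, hp, ?_, ?_⟩
  · have h1 := hp.norm
    have h2 : Tendsto (fun n : ℕ => ‖V n 0‖) atTop (nhds 1) := by
      simp only [R.un _ (Nat.cast_nonneg _)]
      exact tendsto_const_nhds
    exact tendsto_nhds_unique h1 h2
  · have h1 := ((hp.sub_const (V 0 0)).norm).pow 2
    refine le_of_tendsto h1 ?_
    filter_upwards [eventually_gt_atTop 0] with n hn
    have := R.at0 hγ hκ hl le_rfl (Nat.cast_pos.2 hn) 0
    simpa using this

lemma pointwise (R : Fr γ κ l A F V Vx) (hγ : |γ| ≤ 1) (hκ : |κ| ≤ 1) (hl : 0 < l)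
    {W W' : ℝ → E3} (hW : ∀ x, ‖W x‖ = 1) (hWd : ∀ x, HasDerivAt W (W' x) x)
    (hWD : ∀ x, cD γ κ (W x) (W' x) = 0)
    (hp : Tendsto (fun n : ℕ => V n 0) atTop (nhds (W 0))) (x : ℝ) :
    Tendsto (fun n : ℕ => V n x) atTop (nhds (W x)) := by
  have key : ∀ n : ℕ, ‖V n x - W x‖ ^ 2 ≤
      Real.exp (7 * |x|) * (‖V n 0 - W 0‖ ^ 2 + F * Real.exp (-l * n)) := by
    intro n
    have hn : (0:ℝ) ≤ n := Nat.cast_nonneg n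
    have cV : Continuous (V n) := continuous_iff_continuousAt.2 fun x => (R.dx n hn x).continuousAt
    have h := gron2 (ψ := fun x => ‖V n x - W x‖ ^ 2)
      (d := fun x => ‖cD γ κ (V n x) (Vx n x)‖ ^ 2)
      (fun x => ((R.dx n hn x).sub (hWd x)).norm_sq)
      ((cont_cD γ κ cV (R.cx n hn)).norm.pow 2) (fun x => by positivity) (fun x => by positivity)
      (sq_int (R.mD n hn)) (fun x => by
        have h1 := deriv_diff hγ hκ (V n x) (W x) (Vx n x) (W' x) (R.un n hn x) (hW x)
        rw [hWD, sub_zero] at h1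
        have h2 := abs_real_inner_le_norm (V n x - W x) (Vx n x - W' x)
        rw [abs_mul, abs_two]
        have h3 := norm_nonneg (V n x - W x)
        simp only [Pi.sub_apply]
        nlinarith [mul_le_mul_of_nonneg_left h1 h3,
          sq_nonneg (‖V n x - W x‖ - ‖cD γ κ (V n x) (Vx n x)‖)]) x
    refine h.trans ?_
    have := R.sD n hn
    rw [S2] at this
    gcongr
  have hlim : Tendsto (fun n : ℕ => Real.exp (7 * |x|) *
      (‖V n 0 - W 0‖ ^ 2 + F * Real.exp (-l * n))) atTop (nhds 0) := by
    have h1 : Tendsto (fun n : ℕ => -l * (n:ℝ)) atTop atBot :=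
      tendsto_natCast_atTop_atTop.const_mul_atTop_of_neg (by linarith)
    have h2 := (Real.tendsto_exp_atBot.comp h1).const_mul F
    have h3 := ((hp.sub_const (W 0)).norm.pow 2).add h2
    have h4 := h3.const_mul (Real.exp (7 * |x|))
    simpa [Function.comp_def] using h4
  rw [tendsto_iff_norm_sub_tendsto_zero]
  have h5 := squeeze_zero (fun n => by positivity) key hlim
  have h6 := h5.sqrt
  simpa [Real.sqrt_sq] using h6

lemma final (R : Fr γ κ l A F V Vx) (hγ : |γ| ≤ 1) (hκ : |κ| ≤ 1) (hl : 0 < l) (hA : 0 ≤ A)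
    {W W' : ℝ → E3} (hW : ∀ x, ‖W x‖ = 1) (hWd : ∀ x, HasDerivAt W (W' x) x)
    (hWc : Continuous W')
    (hWD : ∀ x, cD γ κ (W x) (W' x) = 0)
    (hp : Tendsto (fun n : ℕ => V n 0) atTop (nhds (W 0))) {t : ℝ} (ht : 0 ≤ t) :
    MemLp (fun x => V t x - W x) 2 volume ∧
    S2 (fun x => V t x - W x) ≤ A * (F * Real.exp (-l * t)) ∧
    MemLp (fun x => Vx t x - W' x) 2 volume ∧
    S2 (fun x => Vx t x - W' x) ≤ (18 * A + 2) * (F * Real.exp (-l * t)) := by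
  have hF := R.F0
  have cV : ∀ t, 0 ≤ t → Continuous (V t) := fun t ht =>
    continuous_iff_continuousAt.2 fun x => (R.dx t ht x).continuousAt
  have cW : Continuous W := continuous_iff_continuousAt.2 fun x => (hWd x).continuousAt
  have h1 : ∫⁻ x, ENNReal.ofReal (‖V t x - W x‖ ^ 2) ≤
      ENNReal.ofReal (A * (F * Real.exp (-l * t))) := by
    have e : ∀ x, ENNReal.ofReal (‖V t x - W x‖ ^ 2) =
        liminf (fun n : ℕ => ENNReal.ofReal (‖V n x - V t x‖ ^ 2)) atTop := by
      intro x
      symm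
      apply Tendsto.liminf_eq
      have h2 := R.pointwise hγ hκ hl hW hWd hWD hp x
      have h3 := ((h2.sub_const (V t x)).norm.pow 2)
      rw [norm_sub_rev (W x)] at h3
      exact (ENNReal.continuous_ofReal.tendsto _).comp h3
    simp only [e]
    refine (lintegral_liminf_le fun n => ?_).trans ?_
    · have := cV n (Nat.cast_nonneg n)
      have := cV t ht
      fun_prop
    · obtain ⟨N, hN⟩ := exists_nat_gt t
      refine liminf_le_of_frequently_le' (Eventually.frequently ?_)
      filter_upwards [eventually_ge_atTop N] with n hn
      have htn : t < n := hN.trans_le (Nat.cast_le.2 hn)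
      rw [← ofReal_integral_eq_lintegral_ofReal (sq_int (R.mV t n ht htn))
        (Eventually.of_forall fun x => by positivity)]
      exact ENNReal.ofReal_le_ofReal (R.sV t n ht htn)
  obtain ⟨m1, s1⟩ : MemLp (fun x => V t x - W x) 2 volume ∧ S2 (fun x => V t x - W x) ≤
      A * (F * Real.exp (-l * t)) := S2_lintegral (by positivity) ((cV t ht).sub cW) h1
  have hb : ∀ x, ‖Vx t x - W' x‖ ≤ 3 * ‖V t x - W x‖ + ‖cD γ κ (V t x) (Vx t x)‖ := fun x => by
    have h1 := deriv_diff hγ hκ (V t x) (W x) (Vx t x) (W' x) (R.un t ht x) (hW x)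
    rwa [hWD, sub_zero] at h1
  refine ⟨m1, s1, memLp_dom ((m1.norm.const_mul 3).add (R.mD t ht).norm)
      ((R.cx t ht).sub hWc) hb, ?_⟩
  have h2 : S2 (fun x => Vx t x - W' x) ≤ 18 * S2 (fun x => V t x - W x) +
      2 * S2 (fun x => cD γ κ (V t x) (Vx t x)) := by
    apply S2_le_sum2 m1 (R.mD t ht)
    intro x
    have h4 : ‖Vx t x - W' x‖ ^ 2 ≤ (3 * ‖V t x - W x‖ + ‖cD γ κ (V t x) (Vx t x)‖) ^ 2 := by
      have := hb x
      gcongr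
    refine h4.trans ?_
    nlinarith [sq_nonneg (3 * ‖V t x - W x‖ - ‖cD γ κ (V t x) (Vx t x)‖)]
  have := R.sD t ht
  linarith

end Fr

end

section

/-- the wall parameters, via z = exp(-κ x) -/
lemma cos_two_arctan (z : ℝ) : Real.cos (2 * Real.arctan z) = (1 - z ^ 2) / (1 + z ^ 2) := by
  have h : (0:ℝ) < 1 + z ^ 2 := by positivity
  rw [Real.cos_two_mul, Real.cos_sq_arctan]
  field_simp; ring

lemma sin_two_arctan (z : ℝ) : Real.sin (2 * Real.arctan z) = 2 * z / (1 + z ^ 2) := by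
  have h : (0:ℝ) < 1 + z ^ 2 := by positivity
  have h2 : √(1 + z ^ 2) ^ 2 = 1 + z ^ 2 := Real.sq_sqrt h.le
  have h3 : 0 < √(1 + z ^ 2) := Real.sqrt_pos.2 h
  rw [Real.sin_two_mul, Real.sin_arctan, Real.cos_arctan]
  field_simp
  rw [h2]

section
variable {γ κ s : ℝ}

/-- space derivative of the wall -/
def wDer (γ κ s x : ℝ) : E3 := κ • cF (wStar γ s x) - γ • cross3 e1 (wStar γ s x)

@[simp] lemma w_0 (γ s x : ℝ) : wStar γ s x 0 = Real.cos (thetaStar γ x) := by simp [wStar]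
@[simp] lemma w_1 (γ s x : ℝ) : wStar γ s x 1 =
    s * (Real.sin (thetaStar γ x) * Real.cos (phiStar γ x)) := by simp [wStar]
@[simp] lemma w_2 (γ s x : ℝ) : wStar γ s x 2 =
    s * (Real.sin (thetaStar γ x) * Real.sin (phiStar γ x)) := by simp [wStar]

lemma w_un (hs : s ^ 2 = 1) (x : ℝ) : ‖wStar γ s x‖ = 1 := by
  have h : ‖wStar γ s x‖ ^ 2 = 1 ^ 2 := by
    rw [nsq]
    simp only [w_0, w_1, w_2]
    have h1 := Real.sin_sq_add_cos_sq (thetaStar γ x)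
    have h2 := Real.sin_sq_add_cos_sq (phiStar γ x)
    linear_combination h1 + (s ^ 2 * Real.sin (thetaStar γ x) ^ 2) * h2 +
      Real.sin (thetaStar γ x) ^ 2 * hs
  exact (pow_left_inj₀ (norm_nonneg _) zero_le_one two_ne_zero).1 h

lemma theta_deriv (hκ : κ = √(1 - γ ^ 2)) (x : ℝ) :
    HasDerivAt (thetaStar γ) (-κ * Real.sin (thetaStar γ x)) x := by
  have h1 : HasDerivAt (fun x => Real.exp (-√(1 - γ ^ 2) * x))
      (Real.exp (-√(1 - γ ^ 2) * x) * -√(1 - γ ^ 2)) x := by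
    have := ((hasDerivAt_id x).const_mul (-√(1 - γ ^ 2))).exp
    simpa using this
  have h2 := h1.arctan.const_mul 2
  refine h2.congr_deriv ?_
  rw [thetaStar, sin_two_arctan, ← hκ]
  ring

lemma w_deriv (hs : s ^ 2 = 1) (hκ : κ = √(1 - γ ^ 2)) (x : ℝ) :
    HasDerivAt (wStar γ s) (wDer γ κ s x) x := by
  have hθ := theta_deriv hκ x
  have hφ : HasDerivAt (phiStar γ) (-γ) x := by
    have := (hasDerivAt_id x).const_mul (-γ)
    refine (this.congr_deriv (by simp)).congr_of_eventuallyEq (Eventually.of_forall fun y => ?_)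
    simp [phiStar]
  have e : wStar γ s = fun x => Real.cos (thetaStar γ x) • e1 +
      ((s * (Real.sin (thetaStar γ x) * Real.cos (phiStar γ x))) • e2 +
      (s * (Real.sin (thetaStar γ x) * Real.sin (phiStar γ x))) • e3) := by
    funext x
    apply ext3 <;> simp
  rw [e]
  have h := (hθ.cos.smul_const e1).add ((((hθ.sin.mul hφ.cos).const_mul s).smul_const e2).add
    (((hθ.sin.mul hφ.sin).const_mul s).smul_const e3))
  refine h.congr_deriv ?_
  have h1 := Real.sin_sq_add_cos_sq (thetaStar γ x)
  unfold wDer cF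
  apply ext3
  · simp
    linear_combination κ * h1
  · simp
    ring
  · simp
    ring

lemma w_cD (x : ℝ) : cD γ κ (wStar γ s x) (wDer γ κ s x) = 0 := by
  unfold cD wDer
  abel

lemma w_cont (hs : s ^ 2 = 1) : Continuous (wStar γ s) :=
  continuous_iff_continuousAt.2 fun x => (w_deriv hs rfl x).continuousAt

lemma wDer_cont (hs : s ^ 2 = 1) : Continuous (wDer γ κ s) := by
  unfold wDer
  have := w_cont (γ := γ) hs
  have h1 := cont_cF this
  have h2 := cont_cross (continuous_const (y := e1)) this
  fun_prop

lemma sin_theta_pos (x : ℝ) : 0 < Real.sin (thetaStar γ x) := by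
  rw [thetaStar, sin_two_arctan]
  have := Real.exp_pos (-√(1 - γ ^ 2) * x)
  positivity

lemma sin_theta_le (hκ : κ = √(1 - γ ^ 2)) (x : ℝ) :
    Real.sin (thetaStar γ x) ≤ 2 * Real.exp (-κ * |x|) := by
  rw [thetaStar, sin_two_arctan, ← hκ]
  have h0 : 0 ≤ κ := hκ ▸ Real.sqrt_nonneg _
  have hz := Real.exp_pos (-κ * x)
  rw [div_le_iff₀ (by positivity)]
  rcases le_total 0 x with hx | hx
  · rw [abs_of_nonneg hx]
    nlinarith [mul_pos hz (mul_pos hz hz)]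
  · rw [abs_of_nonpos hx]
    have e : Real.exp (-κ * -x) * Real.exp (-κ * x) = 1 := by
      rw [← Real.exp_add]; simp
    have h2 := Real.exp_pos (-κ * -x)
    nlinarith

lemma exp_abs_mem {κ : ℝ} (hκ : 0 < κ) : MemLp (fun x : ℝ => Real.exp (-κ * |x|)) 2 volume := by
  rw [memLp_two_iff_integrable_sq (by fun_prop)]
  have h : Integrable (fun x : ℝ => Real.exp (-(2 * κ) * |x|)) := by
    rw [← integrableOn_univ, ← Set.Iic_union_Ioi (a := (0:ℝ)), integrableOn_union]
    constructor
    · refine (integrableOn_exp_mul_Iic (show 0 < 2 * κ by linarith) 0).congr_fun (fun x hx => ?_)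
        measurableSet_Iic
      simp [abs_of_nonpos (Set.mem_Iic.1 hx)]
    · refine (exp_neg_integrableOn_Ioi 0 (show 0 < 2 * κ by linarith)).congr_fun (fun x hx => ?_)
        measurableSet_Ioi
      simp [abs_of_pos (Set.mem_Ioi.1 hx)]
  refine h.congr (Eventually.of_forall fun x => ?_)
  simp only
  rw [← Real.exp_nat_mul]
  congr 1
  push_cast
  ring

lemma sin_theta_mem (hκ : κ = √(1 - γ ^ 2)) (hκ0 : 0 < κ) :
    MemLp (fun x => Real.sin (thetaStar γ x)) 2 volume := by
  refine memLp_dom ((exp_abs_mem hκ0).const_mul 2) ?_ fun x => ?_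
  · have : Continuous (thetaStar γ) :=
      continuous_iff_continuousAt.2 fun x => (theta_deriv rfl x).continuousAt
    fun_prop
  · rw [Real.norm_of_nonneg (sin_theta_pos x).le]
    exact sin_theta_le hκ x

lemma w_mem (hs : s ^ 2 = 1) (hκ : κ = √(1 - γ ^ 2)) (hκ0 : 0 < κ) :
    MemLp (fun x => wStar γ s x 1) 2 volume ∧ MemLp (fun x => wStar γ s x 2) 2 volume ∧
    MemLp (wDer γ κ s) 2 volume := by
  have hm := sin_theta_mem hκ hκ0
  have hs1 : |s| = 1 := by
    exact (sq_eq_sq₀ (abs_nonneg s) zero_le_one).1 (by rw [sq_abs, hs, one_pow])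
  have hp : ∀ x, |Real.sin (thetaStar γ x)| = Real.sin (thetaStar γ x) := fun x =>
    abs_of_pos (sin_theta_pos x)
  have hc1 := cont_comp (w_cont (γ := γ) hs) 1
  have hc2 := cont_comp (w_cont (γ := γ) hs) 2
  have b1 : ∀ x, ‖wStar γ s x 1‖ ≤ Real.sin (thetaStar γ x) := fun x => by
    rw [w_1, Real.norm_eq_abs, abs_mul, abs_mul, hs1, hp, one_mul]
    exact mul_le_of_le_one_right (sin_theta_pos x).le (Real.abs_cos_le_one _)
  have b2 : ∀ x, ‖wStar γ s x 2‖ ≤ Real.sin (thetaStar γ x) := fun x => by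
    rw [w_2, Real.norm_eq_abs, abs_mul, abs_mul, hs1, hp, one_mul]
    exact mul_le_of_le_one_right (sin_theta_pos x).le (Real.abs_sin_le_one _)
  refine ⟨memLp_dom hm hc1 b1, memLp_dom hm hc2 b2, ?_⟩
  refine memLp_dom (hm.const_mul (2 * (|κ| + |γ|))) (wDer_cont hs) fun x => ?_
  have hpp : pp (wStar γ s x) ≤ 2 * Real.sin (thetaStar γ x) := by
    have := b1 x
    have := b2 x
    rw [Real.norm_eq_abs] at *
    unfold pp
    linarith
  have h1 := norm_cF_le (wStar γ s x) (w_un hs x)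
  have h2 := norm_cross_e1_le (wStar γ s x)
  unfold wDer
  refine (norm_sub_le _ _).trans ?_
  rw [norm_smul, norm_smul, Real.norm_eq_abs, Real.norm_eq_abs]
  have h3 := mul_le_mul_of_nonneg_left (h1.trans hpp) (abs_nonneg κ)
  have h4 := mul_le_mul_of_nonneg_left (h2.trans hpp) (abs_nonneg γ)
  linarith
end

end

section

lemma abs_log_le {u : ℝ} (hu : |u| ≤ 1 / 2) : |Real.log (1 + u)| ≤ 2 * |u| := by
  have h1 := abs_le.1 hu
  have hp : 0 < 1 + u := by linarith
  rw [abs_le]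
  constructor
  · have h2 := Real.one_sub_inv_le_log_of_pos hp
    refine le_trans ?_ h2
    have h3 : 1 - (1 + u)⁻¹ = u / (1 + u) := by field_simp; ring
    rw [h3, le_div_iff₀ hp]
    have h4 := neg_abs_le u
    have h5 := abs_nonneg u
    nlinarith
  · have h2 := Real.log_le_sub_one_of_pos hp
    have h4 := le_abs_self u
    have h5 := abs_nonneg u
    linarith

lemma abs_arctan_le (z : ℝ) : |Real.arctan z| ≤ |z| := by
  have key : ∀ z : ℝ, 0 ≤ z → Real.arctan z ≤ z := fun z hz => by
    have := Real.le_tan (Real.arctan_nonneg.2 hz) (Real.arctan_lt_pi_div_two z)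
    rwa [Real.tan_arctan] at this
  rcases le_total 0 z with hz | hz
  · rw [abs_of_nonneg hz, abs_of_nonneg (Real.arctan_nonneg.2 hz)]; exact key z hz
  · rw [abs_of_nonpos hz, abs_of_nonpos (Real.arctan_le_zero.2 hz), ← Real.arctan_neg]
    exact key (-z) (by linarith)

lemma w_zero (γ s : ℝ) : wStar γ s 0 0 = 0 ∧ wStar γ s 0 1 = s ∧ wStar γ s 0 2 = 0 := by
  have h : thetaStar γ 0 = Real.pi / 2 := by
    simp [thetaStar, Real.arctan_one]; ring
  simp [h, phiStar]

lemma gauge_fix {γ κ s : ℝ} (hγ : |γ| ≤ 1) (hκ : κ = √(1 - γ ^ 2)) (hκ0 : 0 < κ) (hs : s ^ 2 = 1)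
    (p : E3) (hp : ‖p‖ = 1) (hd : ‖p - wStar γ s 0‖ ≤ 1 / 2) :
    ∃ y φ : ℝ, rot φ (wStar γ s (0 - y)) = p ∧ |y| ≤ 2 / κ * ‖p - wStar γ s 0‖ ∧
      |φ| ≤ (2 + 2 / κ) * ‖p - wStar γ s 0‖ := by
  set d := ‖p - wStar γ s 0‖ with hdd
  obtain ⟨w0, w1, w2⟩ := w_zero γ s
  have hp2 : p 0 ^ 2 + p 1 ^ 2 + p 2 ^ 2 = 1 := by
    have := nsq p; rw [hp] at this; linarith
  have c0 : |p 0| ≤ d := by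
    have := abs_comp_le (p - wStar γ s 0) 0
    simpa only [PiLp.sub_apply, w0, sub_zero] using this
  have c1 : |p 1 - s| ≤ d := by
    have := abs_comp_le (p - wStar γ s 0) 1
    simpa only [PiLp.sub_apply, w1, sub_zero] using this
  have c2 : |p 2| ≤ d := by
    have := abs_comp_le (p - wStar γ s 0) 2
    simpa only [PiLp.sub_apply, w2, sub_zero] using this
  have hs1 : |s| = 1 := (sq_eq_sq₀ (abs_nonneg s) zero_le_one).1 (by rw [sq_abs, hs, one_pow])
  have hp1 : 1 / 2 ≤ s * p 1 := by
    have h1 : |s * (p 1 - s)| ≤ 1 / 2 := by rw [abs_mul, hs1, one_mul]; linarith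
    have := (abs_le.1 h1).1
    nlinarith
  have hp1' : p 1 ≠ 0 := by
    rintro h; rw [h] at hp1; norm_num at hp1
  have hp0 := abs_le.1 (c0.trans hd)
  have hm : 0 < 1 - p 0 := by linarith
  have hpl : 0 < 1 + p 0 := by linarith
  set y := (Real.log (1 - p 0) - Real.log (1 + p 0)) / (2 * κ) with hy
  set β := Real.arctan (p 2 / p 1) with hβ
  have hyb : |y| ≤ 2 / κ * d := by
    have h1 : |Real.log (1 - p 0)| ≤ 2 * d := by
      have := abs_log_le (u := -p 0) (by rw [abs_neg]; linarith)
      rw [abs_neg, ← sub_eq_add_neg] at this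
      linarith
    have h2 : |Real.log (1 + p 0)| ≤ 2 * d := by
      have := abs_log_le (u := p 0) (by linarith)
      linarith
    rw [hy, abs_div, abs_of_pos (by positivity : 0 < 2 * κ), div_le_iff₀ (by positivity)]
    have h3 := abs_sub (Real.log (1 - p 0)) (Real.log (1 + p 0))
    have e : 2 / κ * d * (2 * κ) = 4 * d := by field_simp; ring
    rw [e]; linarith
  have hβb : |β| ≤ 2 * d := by
    have h1 : |β| ≤ |p 2 / p 1| := by
      rw [hβ]
      exact abs_arctan_le _
    refine h1.trans ?_
    rw [abs_div, div_le_iff₀ (abs_pos.2 hp1')]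
    have h2 : |p 1| = |s * p 1| := by rw [abs_mul, hs1, one_mul]
    have h3 := le_abs_self (s * p 1)
    have hd0 : 0 ≤ d := norm_nonneg _
    nlinarith
  refine ⟨y, β - γ * y, ?_, hyb, ?_⟩
  · set z := Real.exp (κ * y) with hz
    have hz0 : 0 < z := Real.exp_pos _
    have hz2 : z ^ 2 = (1 - p 0) / (1 + p 0) := by
      rw [hz, ← Real.exp_nat_mul]
      have : ((2:ℕ):ℝ) * (κ * y) = Real.log (1 - p 0) - Real.log (1 + p 0) := by
        rw [hy]; push_cast; field_simp
      rw [this, Real.exp_sub, Real.exp_log hm, Real.exp_log hpl]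
    have hθ : thetaStar γ (0 - y) = 2 * Real.arctan z := by
      rw [thetaStar, ← hκ, hz]; congr 3; ring
    have hcos : Real.cos (thetaStar γ (0 - y)) = p 0 := by
      rw [hθ, cos_two_arctan, hz2]; field_simp; ring
    set r := Real.sin (thetaStar γ (0 - y)) with hr
    have hr0 : 0 < r := sin_theta_pos _
    have hr2 : r ^ 2 = p 1 ^ 2 + p 2 ^ 2 := by
      have := Real.sin_sq_add_cos_sq (thetaStar γ (0 - y))
      rw [hcos, ← hr] at this
      linarith
    have hcβ : 0 < Real.cos β := Real.cos_arctan_pos _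
    have hcβ2 : Real.cos β ^ 2 = 1 / (1 + (p 2 / p 1) ^ 2) := Real.cos_sq_arctan _
    have hsβ : Real.sin β = Real.cos β * (p 2 / p 1) := by
      have := Real.tan_arctan (p 2 / p 1)
      rw [← hβ, Real.tan_eq_sin_div_cos, div_eq_iff hcβ.ne'] at this
      linarith
    have hrc : r * Real.cos β = s * p 1 := by
      apply (sq_eq_sq₀ (by positivity) (by linarith)).1
      rw [mul_pow, mul_pow, hr2, hcβ2, hs, one_mul]
      have : 0 < p 1 ^ 2 + p 2 ^ 2 := hr2 ▸ (by positivity)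
      field_simp
    have hrs : r * Real.sin β = s * p 2 := by
      rw [hsβ, ← mul_assoc, hrc]; field_simp
    have hφ : phiStar γ (0 - y) = γ * y := by rw [phiStar]; ring
    have cb : Real.cos β = Real.cos (γ * y) * Real.cos (β - γ * y) -
        Real.sin (γ * y) * Real.sin (β - γ * y) := by
      rw [← Real.cos_add]; congr 1; ring
    have sb : Real.sin β = Real.sin (γ * y) * Real.cos (β - γ * y) +
        Real.cos (γ * y) * Real.sin (β - γ * y) := by
      rw [← Real.sin_add]; congr 1; ring
    apply ext3
    · rw [rot_0, w_0, hcos]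
    · rw [rot_1, w_1, w_2, hφ, ← hr]
      linear_combination (-s * r) * cb + s * hrc + p 1 * hs
    · rw [rot_2, w_1, w_2, hφ, ← hr]
      linear_combination (-s * r) * sb + s * hrs + p 2 * hs
  · have h1 := abs_sub β (γ * y)
    have h2 : |γ * y| ≤ |y| := by
      rw [abs_mul]; exact mul_le_of_le_one_left (abs_nonneg _) hγ
    linarith

end

section

/-- the part orthogonal to e1 -/
def perp (v : E3) : E3 := v - v 0 • e1

lemma perp_sq (v : E3) : ‖perp v‖ ^ 2 = v 1 ^ 2 + v 2 ^ 2 := by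
  rw [nsq]; simp [perp]

lemma perp_le (v : E3) : ‖perp v‖ ≤ ‖v‖ := by
  apply abs_le_of_sq_le_sq' _ (norm_nonneg _) |>.2
  rw [perp_sq, nsq v]
  nlinarith [sq_nonneg (v 0)]

lemma cont_perp : Continuous perp := by
  unfold perp
  fun_prop

lemma deriv_perp {g : ℝ → E3} {g' : E3} {x : ℝ} (hg : HasDerivAt g g' x) :
    HasDerivAt (fun x => perp (g x)) (perp g') x := by
  unfold perp
  exact hg.sub ((deriv_comp3 hg 0).smul_const e1)

lemma sphere_rel (a w : E3) (ha : ‖a‖ = 1) (hw : ‖w‖ = 1) :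
    |(a - w) 0| * |2 * w 0 + (a - w) 0| ≤ 2 * ‖perp (a - w)‖ := by
  have h1 := nsq a
  have h2 := nsq w
  rw [ha] at h1
  rw [hw] at h2
  have e : (a - w) 0 * (2 * w 0 + (a - w) 0) = - inner ℝ (perp (a - w)) (a + w) := by
    rw [inner3]
    simp [perp]
    nlinarith
  rw [← abs_mul, e, abs_neg]
  refine (abs_real_inner_le_norm _ _).trans ?_
  have : ‖a + w‖ ≤ 2 := (norm_add_le _ _).trans (by rw [ha, hw]; norm_num)
  nlinarith [norm_nonneg (perp (a - w))]

lemma osc {q q' : ℝ → E3} (hd : ∀ x, HasDerivAt q (q' x) x) (hc : Continuous q')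
    (hm : MemLp q' 2 volume) {x y : ℝ} (hxy : x < y) :
    ‖q y - q x‖ ^ 2 ≤ (y - x) * S2 q' := by
  have h1 := cs_weight hxy hc (continuous_const (y := (1:ℝ))) (fun _ => zero_lt_one)
  rw [intervalIntegral.integral_eq_sub_of_hasDerivAt (fun x _ => hd x)
    (hc.intervalIntegrable _ _)] at h1
  refine h1.trans ?_
  simp only [intervalIntegral.integral_const, smul_eq_mul, mul_one, inv_one, one_mul]
  have : ∫ τ in x..y, ‖q' τ‖ ^ 2 ≤ S2 q' := by
    rw [intervalIntegral.integral_of_le hxy.le]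
    exact setIntegral_le_integral (sq_int hm) (Eventually.of_forall fun x => by positivity)
  have : 0 ≤ y - x := by linarith
  gcongr

/-- size of the core of the wall -/
def RR (κ : ℝ) : ℝ := Real.log 3 / (2 * κ)

lemma RR_pos {κ : ℝ} (hκ : 0 < κ) : 0 < RR κ := by
  unfold RR
  have := Real.log_pos (show (1:ℝ) < 3 by norm_num)
  positivity

lemma exp_RR {κ : ℝ} (hκ : 0 < κ) : Real.exp (2 * κ * RR κ) = 3 := by
  rw [RR, mul_div_cancel₀ _ (by positivity), Real.exp_log (by norm_num)]

lemma w0_right {γ κ : ℝ} (hκ : κ = √(1 - γ ^ 2)) (hκ0 : 0 < κ) {x : ℝ} (hx : RR κ ≤ x) :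
    1 / 2 ≤ Real.cos (thetaStar γ x) := by
  rw [thetaStar, cos_two_arctan, ← hκ, le_div_iff₀ (by positivity), ← Real.exp_nat_mul]
  have h1 : Real.exp ((2:ℕ) * (-κ * x)) * Real.exp (2 * κ * x) = 1 := by
    rw [← Real.exp_add]; simp; ring
  have h2 : 3 ≤ Real.exp (2 * κ * x) := by
    rw [← exp_RR hκ0]; gcongr
  have h3 := Real.exp_pos ((2:ℕ) * (-κ * x))
  have h4 := mul_le_mul_of_nonneg_left h2 h3.le
  rw [h1] at h4
  generalize Real.exp ((2:ℕ) * (-κ * x)) = z at *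
  linarith

lemma w0_left {γ κ : ℝ} (hκ : κ = √(1 - γ ^ 2)) (hκ0 : 0 < κ) {x : ℝ} (hx : x ≤ -RR κ) :
    Real.cos (thetaStar γ x) ≤ -(1 / 2) := by
  rw [thetaStar, cos_two_arctan, ← hκ, div_le_iff₀ (by positivity), ← Real.exp_nat_mul]
  have h2 : 3 ≤ Real.exp ((2:ℕ) * (-κ * x)) := by
    rw [← exp_RR hκ0]
    apply Real.exp_le_exp.2
    push_cast
    nlinarith
  generalize Real.exp ((2:ℕ) * (-κ * x)) = z at *
  linarith

/-- the constant K -/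
def KK (κ : ℝ) : ℝ := 4 + √(2 * RR κ)
/-- the constant for initial data -/
def C1 (κ : ℝ) : ℝ := 17 + 3 * KK κ ^ 2 * S2 (fun x : ℝ => Real.exp (-κ * |x|))

lemma q0_far {γ κ s N : ℝ} (hκ : κ = √(1 - γ ^ 2)) (hκ0 : 0 < κ) (hs : s ^ 2 = 1)
    {a : ℝ → E3} (ca : Continuous a) (ua : ∀ x, ‖a x‖ = 1)
    (hu : ∀ x, ‖perp (a x - wStar γ s x)‖ ≤ N) (hN : N < 1 / 16)
    (hosc : |(a (RR κ) - wStar γ s (RR κ)) 0 - (a (-RR κ) - wStar γ s (-RR κ)) 0| ≤ 1 / 16)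
    {x : ℝ} (hx : RR κ ≤ |x|) :
    |(a x - wStar γ s x) 0| ≤ 4 * ‖perp (a x - wStar γ s x)‖ := by
  have cq : Continuous fun x => (a x - wStar γ s x) 0 :=
    cont_comp (ca.sub (w_cont (γ := γ) hs)) 0
  have rel : ∀ x, _ := fun x => sphere_rel (a x) (wStar γ s x) (ua x) (w_un hs x)
  set q : ℝ → ℝ := fun x => (a x - wStar γ s x) 0 with hq
  have rel' : ∀ x, |q x| * |2 * Real.cos (thetaStar γ x) + q x| ≤
      2 * ‖perp (a x - wStar γ s x)‖ := fun x => by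
    have := rel x; rwa [w_0] at this
  -- good sides
  have gr : ∀ x, RR κ ≤ x → -(1 / 2) < q x → |q x| ≤ 4 * ‖perp (a x - wStar γ s x)‖ := by
    intro x hx h
    have h1 := w0_right hκ hκ0 hx
    have h2 := rel' x
    have h3 : 1 / 2 ≤ |2 * Real.cos (thetaStar γ x) + q x| :=
      le_trans (by linarith) (le_abs_self _)
    nlinarith [abs_nonneg (q x)]
  have gl : ∀ x, x ≤ -RR κ → q x < 1 / 2 → |q x| ≤ 4 * ‖perp (a x - wStar γ s x)‖ := by
    intro x hx h
    have h1 := w0_left hκ hκ0 hx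
    have h2 := rel' x
    have h3 : 1 / 2 ≤ |2 * Real.cos (thetaStar γ x) + q x| :=
      le_trans (by linarith) (neg_le_abs _)
    nlinarith [abs_nonneg (q x)]
  have nr : ∀ x, RR κ ≤ x → q x ≠ -(1 / 2) := by
    intro x hx h
    have h1 := w0_right hκ hκ0 hx
    have h2 := rel' x
    have h3 : 1 / 2 ≤ |2 * Real.cos (thetaStar γ x) + q x| :=
      le_trans (by linarith) (le_abs_self _)
    have h4 : |q x| = 1 / 2 := by rw [h, abs_neg]; norm_num
    have := hu x
    rw [h4] at h2
    linarith
  have nl : ∀ x, x ≤ -RR κ → q x ≠ 1 / 2 := by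
    intro x hx h
    have h1 := w0_left hκ hκ0 hx
    have h2 := rel' x
    have h3 : 1 / 2 ≤ |2 * Real.cos (thetaStar γ x) + q x| :=
      le_trans (by linarith) (neg_le_abs _)
    have h4 : |q x| = 1 / 2 := by rw [h]; norm_num
    have := hu x
    rw [h4] at h2
    linarith
  have ho := abs_le.1 hosc
  change -(1 / 16) ≤ q (RR κ) - q (-RR κ) ∧ q (RR κ) - q (-RR κ) ≤ 1 / 16 at ho
  have bR : -(1 / 2) < q (RR κ) := by
    by_contra hc
    have h1 : q (-RR κ) < 1 / 2 := by linarith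
    have h2 := abs_le.1 (gl _ le_rfl h1)
    have := hu (-RR κ)
    linarith
  have bL : q (-RR κ) < 1 / 2 := by
    by_contra hc
    have h2 := abs_le.1 (gr _ le_rfl bR)
    have := hu (RR κ)
    linarith
  rcases le_abs.1 hx with h | h
  · apply gr x h
    by_contra hc
    obtain ⟨y, hy, hy2⟩ := intermediate_value_Icc' h cq.continuousOn
      (show -(1 / 2) ∈ Set.Icc (q x) (q (RR κ)) from ⟨by linarith, bR.le⟩)
    exact nr y hy.1 hy2
  · have h' : x ≤ -RR κ := by linarith
    apply gl x h'
    by_contra hc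
    obtain ⟨y, hy, hy2⟩ := intermediate_value_Icc' h' cq.continuousOn
      (show 1 / 2 ∈ Set.Icc (q (-RR κ)) (q x) from ⟨bL.le, by linarith⟩)
    exact nl y hy.2 hy2

set_option maxHeartbeats 1000000 in
lemma initial {γ κ s : ℝ} (hγ : |γ| ≤ 1) (hκ1 : |κ| ≤ 1) (hκ : κ = √(1 - γ ^ 2)) (hκ0 : 0 < κ)
    (hs : s ^ 2 = 1)
    {a b c : ℝ → E3} (P : Prof a b c) {N : ℝ}
    (hN : L2norm (fun x => (a x - wStar γ s x) 1) + L2norm (fun x => (a x - wStar γ s x) 2) +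
      L2norm (fun x => b x - wDer γ κ s x) = N) (hN1 : N < 1 / (16 * (1 + √(2 * RR κ)))) :
    ‖a 0 - wStar γ s 0‖ ^ 2 ≤ (C1 κ + 1) * N ^ 2 ∧
    S2 (fun x => cD γ κ (a x) (b x)) ≤ (18 * C1 κ + 2) * N ^ 2 := by
  obtain ⟨w1, w2, w3⟩ := w_mem (γ := γ) hs hκ hκ0
  have m1 : MemLp (fun x => (a x - wStar γ s x) 1) 2 volume := P.m1.sub w1
  have m2 : MemLp (fun x => (a x - wStar γ s x) 2) 2 volume := P.m2.sub w2
  have mb : MemLp (fun x => b x - wDer γ κ s x) 2 volume := P.mb.sub w3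
  set q : ℝ → E3 := fun x => a x - wStar γ s x with hq
  set q' : ℝ → E3 := fun x => b x - wDer γ κ s x with hq'
  have cq : Continuous q := P.ca.sub (w_cont hs)
  have cq' : Continuous q' := P.cb.sub (wDer_cont hs)
  have dq : ∀ x, HasDerivAt q (q' x) x := fun x => (P.da x).sub (w_deriv hs hκ x)
  have n1 := L2norm_nonneg (fun x => q x 1)
  have n2 := L2norm_nonneg (fun x => q x 2)
  have n3 := L2norm_nonneg q'
  have hN0 : 0 ≤ N := by rw [← hN]; positivity
  have hsum : S2 (fun x => q x 1) + S2 (fun x => q x 2) + S2 q' ≤ N ^ 2 := by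
    rw [L2norm_sq m1, L2norm_sq m2, L2norm_sq mb, ← hN]
    nlinarith [mul_nonneg n1 n2, mul_nonneg n1 n3, mul_nonneg n2 n3]
  have S0 := S2_nonneg (fun x => q x 1)
  have S0' := S2_nonneg (fun x => q x 2)
  have S0'' := S2_nonneg q'
  have cu : Continuous fun x => perp (q x) := cont_perp.comp cq
  have hpsq : ∀ x, ‖perp (q x)‖ ^ 2 = ‖q x 1‖ ^ 2 + ‖q x 2‖ ^ 2 := fun x => by
    rw [perp_sq, Real.norm_eq_abs, Real.norm_eq_abs, sq_abs, sq_abs]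
  have mu : MemLp (fun x => perp (q x)) 2 volume := by
    refine memLp_dom (m1.norm.add m2.norm) cu fun x => ?_
    simp only [Pi.add_apply]
    apply abs_le_of_sq_le_sq' _ (by positivity) |>.2
    rw [hpsq]
    nlinarith [mul_nonneg (norm_nonneg (q x 1)) (norm_nonneg (q x 2))]
  have su : S2 (fun x => perp (q x)) ≤ 1 * S2 (fun x => q x 1) + 1 * S2 (fun x => q x 2) :=
    S2_le_sum2 m1 m2 fun x => by rw [hpsq]; linarith
  have mu' : MemLp (fun x => perp (q' x)) 2 volume :=
    memLp_dom mb.norm (cont_perp.comp cq') fun x => perp_le _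
  have su' : S2 (fun x => perp (q' x)) ≤ S2 q' := S2_mono mb fun x => perp_le _
  have hu : ∀ x, ‖perp (q x)‖ ≤ N := fun x => by
    have := sup_sq_le (fun x => deriv_perp (dq x)) mu mu' x
    exact abs_le_of_sq_le_sq' (by linarith) hN0 |>.2
  have hR := RR_pos hκ0
  have hrt := Real.sqrt_nonneg (2 * RR κ)
  have hN2 : N * (16 * (1 + √(2 * RR κ))) < 1 := by
    rwa [lt_div_iff₀ (by positivity)] at hN1
  have hN3 : N < 1 / 16 := by nlinarith [mul_nonneg hN0 hrt]
  have hN4 : √(2 * RR κ) * N ≤ 1 / 16 := by nlinarith [mul_nonneg hN0 hrt]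
  have hosc : ∀ x y, x < y → y - x ≤ 2 * RR κ → ‖q y - q x‖ ≤ √(2 * RR κ) * N := by
    intro x y h1 h2
    have h3 := osc dq cq' mb h1
    apply abs_le_of_sq_le_sq' _ (by positivity) |>.2
    rw [mul_pow, Real.sq_sqrt (by positivity)]
    have h4 : S2 q' ≤ N ^ 2 := by linarith
    exact h3.trans (mul_le_mul h2 h4 S0'' (by positivity))
  have hfar : ∀ x, RR κ ≤ |x| → |q x 0| ≤ 4 * ‖perp (q x)‖ := fun x hx =>
    q0_far hκ hκ0 hs P.ca P.un hu hN3 (by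
      have h1 := hosc (-RR κ) (RR κ) (by linarith) (by linarith)
      have h2 := abs_comp_le (q (RR κ) - q (-RR κ)) 0
      exact (h2.trans h1).trans hN4) hx
  have hnear : ∀ x, |x| < RR κ → |q x 0| ≤ KK κ * N := by
    intro x hx
    have h0 := abs_lt.1 hx
    have h1 := hosc x (RR κ) h0.2 (by linarith)
    have h2 := abs_comp_le (q (RR κ) - q x) 0
    have h3 := hfar (RR κ) (le_abs_self _)
    have h4 := hu (RR κ)
    simp only [PiLp.sub_apply] at h2
    have h5 : |q x 0| ≤ |q (RR κ) 0| + |q (RR κ) 0 - q x 0| := by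
      have := abs_sub (q (RR κ) 0) (q (RR κ) 0 - q x 0)
      simpa using this
    unfold KK
    linarith
  have hall : ∀ x, ‖q x‖ ^ 2 ≤ 17 * ‖perp (q x)‖ ^ 2 +
      (3 * KK κ ^ 2 * N ^ 2) * ‖Real.exp (-κ * |x|)‖ ^ 2 := by
    intro x
    have e : ‖q x‖ ^ 2 = ‖perp (q x)‖ ^ 2 + |q x 0| ^ 2 := by
      rw [perp_sq, nsq, sq_abs]; ring
    rw [e]
    rcases le_or_gt (RR κ) |x| with hx | hx
    · have h1 := hfar x hx
      have h2 : |q x 0| ^ 2 ≤ (4 * ‖perp (q x)‖) ^ 2 := by gcongr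
      have h3 : 0 ≤ (3 * KK κ ^ 2 * N ^ 2) * ‖Real.exp (-κ * |x|)‖ ^ 2 := by positivity
      linarith
    · have h1 := hnear x hx
      have h2 : |q x 0| ^ 2 ≤ (KK κ * N) ^ 2 := by gcongr
      have h3 : 1 ≤ 3 * ‖Real.exp (-κ * |x|)‖ ^ 2 := by
        rw [Real.norm_of_nonneg (Real.exp_pos _).le, ← exp_RR hκ0, ← Real.exp_nat_mul,
          ← Real.exp_add]
        apply Real.one_le_exp
        push_cast
        nlinarith
      have h4 := mul_le_mul_of_nonneg_left h3 (sq_nonneg (KK κ * N))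
      nlinarith [sq_nonneg ‖perp (q x)‖]
  have me := exp_abs_mem hκ0
  have mq : MemLp q 2 volume := by
    rw [memLp_two_iff_integrable_sq_norm cq.aestronglyMeasurable]
    refine (((sq_int mu).const_mul 17).add
      ((sq_int me).const_mul (3 * KK κ ^ 2 * N ^ 2))).mono' (by fun_prop) ?_
    refine Eventually.of_forall fun x => ?_
    rw [Real.norm_of_nonneg (by positivity)]
    exact hall x
  have sq : S2 q ≤ C1 κ * N ^ 2 := by
    have := S2_le_sum2 mu me hall
    unfold C1
    nlinarith
  refine ⟨?_, ?_⟩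
  · have := sup_sq_le dq mq mb 0
    change ‖q 0‖ ^ 2 ≤ _
    linarith
  · have : S2 (fun x => cD γ κ (a x) (b x)) ≤ 18 * S2 q + 2 * S2 q' := by
      apply S2_le_sum2 mq mb
      intro x
      have h1 := cD_lip hγ hκ1 (a x) (wStar γ s x) (b x) (wDer γ κ s x) (P.un x) (w_un hs x)
      rw [w_cD, sub_zero] at h1
      change _ ≤ ‖q' x‖ + 3 * ‖q x‖ at h1
      have h2 : ‖cD γ κ (a x) (b x)‖ ^ 2 ≤ (‖q' x‖ + 3 * ‖q x‖) ^ 2 := by gcongr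
      nlinarith [sq_nonneg (‖q' x‖ - 3 * ‖q x‖)]
    linarith

end

section

namespace Sol
variable {α γ : ℝ} {h : ℝ → ℝ} {m b c : ℝ → ℝ → E3}

lemma KA_pos {α κ : ℝ} (hα : 0 < α) (hκ0 : 0 < κ) : 0 < KA α κ := by
  unfold KA; positivity

lemma toFr (S : Sol α γ h m b c) (hα : 0 < α) (hγ : |γ| ≤ 1) {κ : ℝ} (hκ : |κ| ≤ 1)
    (hκ0 : 0 < κ) (hk : γ ^ 2 + κ ^ 2 = 1) (hh : ∀ t, |h t| ≤ κ ^ 2 / 8)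
    (h0 : ff γ κ m b 0 ≤ κ ^ 2 / 8) :
    Fr γ κ (α * κ ^ 2 / 8) (KA α κ) (ff γ κ m b 0) (VV α γ κ h m) (VV α γ κ h b) := by
  have eD : ∀ t, (fun x => cD γ κ (VV α γ κ h m t x) (VV α γ κ h b t x)) =
      fun x => rot (-PH α γ κ h t) ((fun x => cD γ κ (m t x) (b t x)) (x + YY α κ h t)) := by
    intro t; funext x
    simp only [VV, rot_cD]
  have hx : ∀ t x : ℝ, HasDerivAt (fun x => x + YY α κ h t) 1 x := fun t x =>
    (hasDerivAt_id x).add_const _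
  refine ⟨?_, ?_, ?_, ?_, ?_, ?_, ?_⟩
  · intro t ht x
    rw [VV, norm_rot]; exact (S.pr t ht).un _
  · intro t ht x
    have := ((S.pr t ht).da (x + YY α κ h t)).scomp x (hx t x)
    rw [one_smul] at this
    exact deriv_rot' _ this
  · intro t ht
    exact cont_rot continuous_const ((S.pr t ht).cb.comp (by fun_prop))
  · intro t ht
    rw [eD]
    exact mem_rot _ (mem_trans ((S.pr t ht).mD hγ hκ) _)
  · intro t ht
    rw [eD, S2_rot _ (fun x => (fun x => cD γ κ (m t x) (b t x)) (x + YY α κ h t))]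
    refine (le_of_eq (S2_trans (fun x => cD γ κ (m t x) (b t x)) (YY α κ h t))).trans ?_
    exact S.ff_decay hα hγ hκ hκ0 hk hh h0 ht
  · intro s t hs hst
    exact (S.VV_cauchy hα hγ hκ hκ0 hk hh h0 hs hst).1
  · intro s t hs hst
    exact (S.VV_cauchy hα hγ hκ hκ0 hk hh h0 hs hst).2

/-- the gauge constant -/
def EE (α κ : ℝ) : ℝ := √((28 * KA α κ + 6) * (18 * C1 κ + 2)) + √(C1 κ + 1)

lemma C1_pos (κ : ℝ) : 0 < C1 κ := by
  unfold C1
  have := S2_nonneg (fun x : ℝ => Real.exp (-κ * |x|))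
  positivity

set_option maxHeartbeats 2000000 in
theorem main (S : Sol α γ h m b c) (hα : 0 < α) (hγ : |γ| ≤ 1) {κ s : ℝ} (hκ : |κ| ≤ 1)
    (hκ0 : 0 < κ) (hκd : κ = √(1 - γ ^ 2)) (hk : γ ^ 2 + κ ^ 2 = 1) (hs : s ^ 2 = 1)
    (hh : ∀ t, |h t| ≤ κ ^ 2 / 8) {N : ℝ}
    (hN : L2norm (fun x => (m 0 x - wStar γ s x) 1) + L2norm (fun x => (m 0 x - wStar γ s x) 2) +
      L2norm (fun x => b 0 x - wDer γ κ s x) = N) (hN1 : N < 1 / (16 * (1 + √(2 * RR κ))))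
    (hN2 : (18 * C1 κ + 2) * N ^ 2 ≤ κ ^ 2 / 8) (hN3 : EE α κ * N ≤ 1 / 2) :
    ∃ y φ : ℝ, |y| ≤ 2 / κ * (EE α κ * N) ∧ |φ| ≤ (2 + 2 / κ) * (EE α κ * N) ∧
      ∀ t, 0 ≤ t →
        L2norm (fun x => m t x - rot (φ + PH α γ κ h t) (wStar γ s (x - y - YY α κ h t))) ≤
          √(KA α κ * (18 * C1 κ + 2)) * (Real.exp (-(α * κ ^ 2 / 16) * t) * N) ∧
        L2norm (fun x => b t x - rot (φ + PH α γ κ h t) (wDer γ κ s (x - y - YY α κ h t))) ≤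
          √((18 * KA α κ + 2) * (18 * C1 κ + 2)) * (Real.exp (-(α * κ ^ 2 / 16) * t) * N) := by
  have P0 := S.pr 0 le_rfl
  obtain ⟨i1, i2⟩ := initial hγ hκ hκd hκ0 hs P0 hN hN1
  have hC := C1_pos κ
  have hA := KA_pos hα hκ0
  have hN0 : 0 ≤ N := by
    rw [← hN]
    have h1 := L2norm_nonneg (fun x => (m 0 x - wStar γ s x) 1)
    have h2 := L2norm_nonneg (fun x => (m 0 x - wStar γ s x) 2)
    have h3 := L2norm_nonneg (fun x => b 0 x - wDer γ κ s x)
    linarith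
  change ff γ κ m b 0 ≤ _ at i2
  have R := S.toFr hα hγ hκ hκ0 hk hh (i2.trans hN2)
  have hl : 0 < α * κ ^ 2 / 8 := by positivity
  obtain ⟨p, hp, hp1, hpd⟩ := R.lim hγ hκ hl hA.le
  have hV0 : VV α γ κ h m 0 0 = m 0 0 := by
    simp [VV, PH, YY, rot_zero]
  rw [hV0] at hpd
  have hd : ‖p - wStar γ s 0‖ ≤ EE α κ * N := by
    have h1 : ‖p - m 0 0‖ ≤ √((28 * KA α κ + 6) * (18 * C1 κ + 2)) * N := by
      apply abs_le_of_sq_le_sq' _ (by positivity) |>.2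
      rw [mul_pow, Real.sq_sqrt (by positivity)]
      refine hpd.trans ?_
      rw [mul_assoc]
      gcongr
    have h2 : ‖m 0 0 - wStar γ s 0‖ ≤ √(C1 κ + 1) * N := by
      apply abs_le_of_sq_le_sq' _ (by positivity) |>.2
      rw [mul_pow, Real.sq_sqrt (by positivity)]
      exact i1
    have h3 := norm_sub_le_norm_sub_add_norm_sub p (m 0 0) (wStar γ s 0)
    unfold EE
    linarith
  obtain ⟨y, φ, g1, g2, g3⟩ := gauge_fix hγ hκd hκ0 hs p hp1 (hd.trans hN3)
  refine ⟨y, φ, g2.trans (by gcongr), g3.trans (by gcongr), fun t ht => ?_⟩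
  have hx : ∀ x : ℝ, HasDerivAt (fun x => x - y) 1 x := fun x =>
    (hasDerivAt_id x).sub_const _
  have key := R.final hγ hκ hl hA.le (W := fun x => rot φ (wStar γ s (x - y)))
    (W' := fun x => rot φ (wDer γ κ s (x - y)))
    (fun x => by rw [norm_rot, w_un hs])
    (fun x => by
      have := (w_deriv hs hκd (x - y)).scomp x (hx x)
      rw [one_smul] at this
      exact deriv_rot' _ this)
    (cont_rot continuous_const ((wDer_cont hs).comp (by fun_prop)))
    (fun x => by
      rw [← rot_cD, w_cD]
      apply ext3 <;> simp)
    (by rw [g1]; exact hp) ht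
  obtain ⟨k1, k2, k3, k4⟩ := key
  have e1 : (fun x => m t x - rot (φ + PH α γ κ h t) (wStar γ s (x - y - YY α κ h t))) =
      fun x => rot (PH α γ κ h t) ((fun x => VV α γ κ h m t x - rot φ (wStar γ s (x - y)))
        (x + -YY α κ h t)) := by
    funext x
    simp only [rot_sub, VV, rot_rot]
    rw [add_neg_cancel, rot_zero, neg_add_cancel_right, add_comm φ]
    congr 3; ring
  have e2 : (fun x => b t x - rot (φ + PH α γ κ h t) (wDer γ κ s (x - y - YY α κ h t))) =
      fun x => rot (PH α γ κ h t) ((fun x => VV α γ κ h b t x - rot φ (wDer γ κ s (x - y)))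
        (x + -YY α κ h t)) := by
    funext x
    simp only [rot_sub, VV, rot_rot]
    rw [add_neg_cancel, rot_zero, neg_add_cancel_right, add_comm φ]
    congr 3; ring
  have hexp : Real.exp (-(α * κ ^ 2 / 16) * t) ^ 2 = Real.exp (-(α * κ ^ 2 / 8) * t) := by
    rw [← Real.exp_nat_mul]; congr 1; push_cast; ring
  have fin : ∀ B : ℝ, 0 ≤ B → ∀ u : ℝ → E3, MemLp u 2 volume →
      S2 u ≤ B * (ff γ κ m b 0 * Real.exp (-(α * κ ^ 2 / 8) * t)) →
      L2norm (fun x => rot (PH α γ κ h t) (u (x + -YY α κ h t))) ≤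
        √(B * (18 * C1 κ + 2)) * (Real.exp (-(α * κ ^ 2 / 16) * t) * N) := by
    intro B hB u mu su
    rw [L2norm_eq (mem_rot _ (mem_trans mu _)), S2_rot _ (fun x => u (x + -YY α κ h t)), S2_trans]
    apply Real.sqrt_le_iff.2 ⟨by positivity, ?_⟩
    rw [mul_pow, mul_pow, Real.sq_sqrt (by positivity), hexp]
    refine su.trans ?_
    calc _ ≤ B * (((18 * C1 κ + 2) * N ^ 2) * Real.exp (-(α * κ ^ 2 / 8) * t)) := by gcongr
      _ = _ := by ring
  constructor
  · rw [e1]; exact fin _ hA.le (fun x => VV α γ κ h m t x - rot φ (wStar γ s (x - y))) k1 k2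
  · rw [e2]; exact fin _ (by positivity) (fun x => VV α γ κ h b t x - rot φ (wDer γ κ s (x - y))) k3 k4

end Sol

end

lemma toSol {α γ : ℝ} {h : ℝ → ℝ} {m : ℝ → ℝ → E3}
    (hc : ContinuousOn h (Set.Ici 0)) (hb : ∀ t ∈ Set.Ici (0:ℝ), |h t| ≤ 1)
    (un : ∀ t ∈ Set.Ici (0:ℝ), ∀ x : ℝ, ‖m t x‖ = 1)
    (dt : ∀ x : ℝ, ∀ t ∈ Set.Ici (0:ℝ), DifferentiableAt ℝ (fun τ => m τ x) t)
    (dx : ∀ t ∈ Set.Ici (0:ℝ), ContDiff ℝ 2 (fun ξ => m t ξ))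
    (cm : Continuous (fun p : ℝ × ℝ => m p.1 p.2))
    (cb : Continuous (fun p : ℝ × ℝ => deriv (fun ξ => m p.1 ξ) p.2))
    (cc : Continuous (fun p : ℝ × ℝ => deriv (deriv (fun ξ => m p.1 ξ)) p.2))
    (eq : ∀ t ∈ Set.Ici (0:ℝ), ∀ x : ℝ,
        deriv (fun τ => m τ x) t =
          cross3 (m t x) (Hfield γ h m t x)
            - α • cross3 (m t x) (cross3 (m t x) (Hfield γ h m t x)))
    (L : ∀ t ∈ Set.Ici (0:ℝ),
        MemLp (fun x => m t x 1) 2 volume ∧ MemLp (fun x => m t x 2) 2 volume ∧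
        MemLp (deriv (fun ξ => m t ξ)) 2 volume ∧
        MemLp (deriv (deriv (fun ξ => m t ξ))) 2 volume)
    (ct : ∀ t₀ ∈ Set.Ici (0:ℝ), ∀ ε > (0:ℝ), ∃ δ > (0:ℝ), ∀ t ∈ Set.Ici (0:ℝ),
        |t - t₀| < δ →
          H1norm (fun x => m t x - m t₀ x) < ε ∧
          L2norm (fun x =>
            deriv (deriv (fun ξ => m t ξ)) x - deriv (deriv (fun ξ => m t₀ ξ)) x) < ε) :
    Sol α γ (fun t => h (max t 0)) m (fun t x => deriv (fun ξ => m t ξ) x)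
      (fun t x => deriv (deriv (fun ξ => m t ξ)) x) := by
  have d1 : ∀ t ∈ Set.Ici (0:ℝ), ∀ x, HasDerivAt (m t) (deriv (fun ξ => m t ξ) x) x := by
    intro t ht x
    exact ((dx t ht).differentiable (by norm_num) x).hasDerivAt
  refine ⟨?_, ?_, cm, cb, cc, ?_, ?_, ?_⟩
  · have : Continuous (fun t : ℝ => max t 0) := by fun_prop
    exact hc.comp_continuous this fun t => Set.mem_Ici.2 (le_max_right t 0)
  · exact fun t => hb _ (Set.mem_Ici.2 (le_max_right t 0))
  · intro t ht x
    have h1 := (dt x t ht).hasDerivAt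
    rw [eq t ht x] at h1
    simpa only [cM, cX, Hfield, max_eq_left ht] using h1
  · intro t ht
    refine ⟨un t ht, d1 t ht, ?_, ?_, (L t ht).1, (L t ht).2.1, (L t ht).2.2.1, (L t ht).2.2.2⟩
    · intro x
      have h2 : ContDiff ℝ 1 (deriv (fun ξ => m t ξ)) := by
        have : ContDiff ℝ (1 + 1) (fun ξ => m t ξ) := by
          have := dx t ht
          norm_num; exact this
        exact (contDiff_succ_iff_deriv.1 this).2.2
      exact (h2.differentiable (by norm_num) x).hasDerivAt
    · exact cc.comp (by fun_prop : Continuous fun x : ℝ => (t, x))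
  · intro t₀ h₀ ε hε
    obtain ⟨δ, hδ, H⟩ := ct t₀ h₀ ε hε
    refine ⟨δ, hδ, fun t ht htd => ?_⟩
    obtain ⟨H1, H2⟩ := H t ht htd
    have e : deriv (fun x => m t x - m t₀ x) =
        fun x => deriv (fun ξ => m t ξ) x - deriv (fun ξ => m t₀ ξ) x := by
      funext x
      exact ((d1 t ht x).sub (d1 t₀ h₀ x)).deriv
    unfold H1norm at H1
    rw [e] at H1
    have n1 := L2norm_nonneg (fun x => m t x - m t₀ x)
    have n2 := L2norm_nonneg (fun x => deriv (fun ξ => m t ξ) x - deriv (fun ξ => m t₀ ξ) x)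
    exact ⟨by linarith, by linarith, H2⟩

/-- asymptotic stability of precessing domain walls in H¹. -/
theorem asymptotic_stability (α γ : ℝ) (hα : 0 < α) (hγ : -1 < γ ∧ γ < 1) :
    ∃ δ₀ σ C : ℝ, 0 < δ₀ ∧ 0 < σ ∧ 0 < C ∧
      ∀ (h : ℝ → ℝ), ContinuousOn h (Set.Ici 0) →
      (∀ t ∈ Set.Ici (0:ℝ), |h t| < δ₀) →
      ∀ (s : ℝ), (s = 1 ∨ s = -1) →
      ∀ (m : ℝ → ℝ → E3),
      -- m takes values in the unit sphere
      (∀ t ∈ Set.Ici (0:ℝ), ∀ x : ℝ, ‖m t x‖ = 1) →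
      -- regularity: C¹ in time, C² in space, with jointly continuous derivatives
      (∀ x : ℝ, ∀ t ∈ Set.Ici (0:ℝ), DifferentiableAt ℝ (fun τ => m τ x) t) →
      (∀ t ∈ Set.Ici (0:ℝ), ContDiff ℝ 2 (fun ξ => m t ξ)) →
      Continuous (fun p : ℝ × ℝ => m p.1 p.2) →
      Continuous (fun p : ℝ × ℝ => deriv (fun τ => m τ p.2) p.1) →
      Continuous (fun p : ℝ × ℝ => deriv (fun ξ => m p.1 ξ) p.2) →
      Continuous (fun p : ℝ × ℝ => deriv (deriv (fun ξ => m p.1 ξ)) p.2) →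
      -- m solves the Landau–Lifshitz–Gilbert equation
      (∀ t ∈ Set.Ici (0:ℝ), ∀ x : ℝ,
        deriv (fun τ => m τ x) t =
          cross3 (m t x) (Hfield γ h m t x)
            - α • cross3 (m t x) (cross3 (m t x) (Hfield γ h m t x))) →
      -- integrability: m₂(t,·), m₃(t,·), ∂ₓm(t,·), ∂ₓₓm(t,·) ∈ L²
      (∀ t ∈ Set.Ici (0:ℝ),
        MemLp (fun x => m t x 1) 2 volume ∧ MemLp (fun x => m t x 2) 2 volume ∧
        MemLp (deriv (fun ξ => m t ξ)) 2 volume ∧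
        MemLp (deriv (deriv (fun ξ => m t ξ))) 2 volume) →
      -- t ↦ m(t,·) − w_* continuous into H¹ and t ↦ ∂ₓₓ m(t,·) continuous into L²
      (∀ t₀ ∈ Set.Ici (0:ℝ), ∀ ε > (0:ℝ), ∃ δ > (0:ℝ), ∀ t ∈ Set.Ici (0:ℝ),
        |t - t₀| < δ →
          H1norm (fun x => m t x - m t₀ x) < ε ∧
          L2norm (fun x =>
            deriv (deriv (fun ξ => m t ξ)) x - deriv (deriv (fun ξ => m t₀ ξ)) x) < ε) →
      -- initial closeness to the static domain wall in ℋ¹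
      HH1 (fun x => m 0 x - wStar γ s x) < δ₀ →
      -- conclusion: exponential convergence to a gauged precessing domain wall
      ∃ yinf finf : ℝ,
        Real.sqrt (yinf ^ 2 + finf ^ 2) ≤ C * HH1 (fun x => m 0 x - wStar γ s x) ∧
        ∀ t ∈ Set.Ici (0:ℝ),
          H1norm (fun x => m t x -
              rot (finf + (-1 + α * γ / Real.sqrt (1 - γ ^ 2)) * ∫ τ in (0:ℝ)..t, h τ)
                (wStar γ s
                  (x - yinf - (-(α / Real.sqrt (1 - γ ^ 2)) * ∫ τ in (0:ℝ)..t, h τ))))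
            ≤ C * Real.exp (-σ * t) * HH1 (fun x => m 0 x - wStar γ s x) := by
  obtain ⟨κ, hκd⟩ : ∃ κ, κ = √(1 - γ ^ 2) := ⟨_, rfl⟩
  have hg2 : 0 < 1 - γ ^ 2 := by nlinarith [hγ.1, hγ.2]
  have hκ0 : 0 < κ := by rw [hκd]; exact Real.sqrt_pos.2 hg2
  have hk : γ ^ 2 + κ ^ 2 = 1 := by
    rw [hκd, Real.sq_sqrt hg2.le]; ring
  have hκ1 : |κ| ≤ 1 := by
    rw [abs_le]; constructor <;> nlinarith [sq_nonneg γ]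
  have hγ1 : |γ| ≤ 1 := abs_le.2 ⟨hγ.1.le, hγ.2.le⟩
  have hC := Sol.C1_pos κ
  have hA := Sol.KA_pos hα hκ0
  have hE : 0 ≤ Sol.EE α κ := by unfold Sol.EE; positivity
  obtain ⟨E, hEd⟩ : ∃ E, E = Sol.EE α κ := ⟨_, rfl⟩
  obtain ⟨A, hAd⟩ : ∃ A, A = √(Sol.KA α κ * (18 * C1 κ + 2)) := ⟨_, rfl⟩
  obtain ⟨B, hBd⟩ : ∃ B, B = √((18 * Sol.KA α κ + 2) * (18 * C1 κ + 2)) := ⟨_, rfl⟩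
  rw [← hEd] at hE
  have hA0 : 0 ≤ A := by rw [hAd]; positivity
  have hB0 : 0 ≤ B := by rw [hBd]; positivity
  obtain ⟨δ, hδ0, hδ1, hδ2, hδ3, hδ4, hδ5⟩ : ∃ δ : ℝ, 0 < δ ∧ δ ≤ 1 ∧ δ ≤ κ ^ 2 / 8 ∧
      δ ≤ 1 / (16 * (1 + √(2 * RR κ))) ∧ δ ≤ κ ^ 2 / 8 / (18 * C1 κ + 2) ∧
      δ ≤ 1 / (2 * (E + 1)) := by
    refine ⟨min 1 (min (κ ^ 2 / 8) (min (1 / (16 * (1 + √(2 * RR κ))))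
      (min (κ ^ 2 / 8 / (18 * C1 κ + 2)) (1 / (2 * (E + 1)))))), ?_, ?_, ?_, ?_, ?_, ?_⟩
    · refine lt_min one_pos (lt_min (by positivity) (lt_min (by positivity)
        (lt_min (by positivity) (by positivity))))
    all_goals simp
  refine ⟨δ, α * κ ^ 2 / 16, 1 + (2 + 4 / κ) * E + A + B, hδ0, by positivity, by positivity, ?_⟩
  intro h hc hb s hs m un dt dx cm _ cb cc eq L ct hN
  have hs2 : s ^ 2 = 1 := by rcases hs with rfl | rfl <;> norm_num
  have S := toSol hc (fun t ht => (hb t ht).le.trans hδ1) un dt dx cm cb cc eq L ct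
  have P0 := S.pr 0 le_rfl
  have eN : deriv (fun x => m 0 x - wStar γ s x) =
      fun x => deriv (fun ξ => m 0 ξ) x - wDer γ κ s x := by
    funext x
    exact ((P0.da x).sub (w_deriv hs2 hκd x)).deriv
  obtain ⟨N, hNd⟩ : ∃ N, N = HH1 (fun x => m 0 x - wStar γ s x) := ⟨_, rfl⟩
  rw [← hNd] at hN ⊢
  have hNd' := hNd.symm
  unfold HH1 at hNd'
  rw [eN] at hNd'
  have hN0 : 0 ≤ N := by
    rw [hNd]; unfold HH1 L2norm; positivity
  have hN2 : (18 * C1 κ + 2) * N ^ 2 ≤ κ ^ 2 / 8 := by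
    have h1 : N ^ 2 ≤ κ ^ 2 / 8 / (18 * C1 κ + 2) := by nlinarith
    rw [le_div_iff₀ (by positivity)] at h1
    linarith
  have hN3 : Sol.EE α κ * N ≤ 1 / 2 := by
    rw [← hEd]
    have h1 : N ≤ 1 / (2 * (E + 1)) := by linarith
    rw [le_div_iff₀ (by positivity)] at h1
    nlinarith
  obtain ⟨y, φ, g1, g2, g3⟩ := S.main hα hγ1 hκ1 hκ0 hκd hk hs2
    (fun t => (hb _ (Set.mem_Ici.2 (le_max_right t 0))).le.trans hδ2) hNd' (hN.trans_le hδ3) hN2 hN3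
  rw [← hEd] at g1 g2
  refine ⟨y, φ, ?_, fun t ht => ?_⟩
  · have h1 : √(y ^ 2 + φ ^ 2) ≤ |y| + |φ| := by
      apply Real.sqrt_le_iff.2 ⟨by positivity, ?_⟩
      nlinarith [sq_abs y, sq_abs φ, mul_nonneg (abs_nonneg y) (abs_nonneg φ)]
    have h2 : (1 + (2 + 4 / κ) * E + A + B) * N =
        2 / κ * (E * N) + (2 + 2 / κ) * (E * N) + (1 + A + B) * N := by ring
    have h3 : 0 ≤ (1 + A + B) * N := by positivity
    linarith
  · have ei : ∫ τ in (0:ℝ)..t, h τ = ∫ τ in (0:ℝ)..t, h (max τ 0) := by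
      apply intervalIntegral.integral_congr
      intro τ hτ
      rw [Set.uIcc_of_le ht] at hτ
      simp only [max_eq_left hτ.1]
    obtain ⟨k1, k2⟩ := g3 t ht
    rw [ei, ← hκd]
    change H1norm (fun x => m t x - rot (φ + Sol.PH α γ κ (fun t => h (max t 0)) t)
      (wStar γ s (x - y - Sol.YY α κ (fun t => h (max t 0)) t))) ≤ _
    have ed : deriv (fun x => m t x - rot (φ + Sol.PH α γ κ (fun t => h (max t 0)) t)
        (wStar γ s (x - y - Sol.YY α κ (fun t => h (max t 0)) t))) =
        fun x => deriv (fun ξ => m t ξ) x - rot (φ + Sol.PH α γ κ (fun t => h (max t 0)) t)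
        (wDer γ κ s (x - y - Sol.YY α κ (fun t => h (max t 0)) t)) := by
      funext x
      have hx : HasDerivAt (fun x => x - y - Sol.YY α κ (fun t => h (max t 0)) t) 1 x :=
        ((hasDerivAt_id x).sub_const _).sub_const _
      have h1 := (w_deriv hs2 hκd (x - y - Sol.YY α κ (fun t => h (max t 0)) t)).scomp x hx
      rw [one_smul] at h1
      exact (((S.pr t ht).da x).sub (deriv_rot' _ h1)).deriv
    unfold H1norm
    rw [ed]
    rw [← hAd] at k1
    rw [← hBd] at k2
    have h3 : 0 ≤ (1 + (2 + 4 / κ) * E) * (Real.exp (-(α * κ ^ 2 / 16) * t) * N) := by positivity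
    calc _ ≤ _ := add_le_add k1 k2
      _ ≤ _ := by linarith
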